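/- arXiv:1101.3021 — 6 statements merged into one kernel-verified Lean document; each statement's English description precedes it below -/
import Mathlib

section
/- For every integer n ≥ 2 there exists a constant C > 0, depending only on n, such that the following holds: for every G-invariant Borel probability measure μ on X = SL_n(ℝ)/SL_n(ℤ) and every real R > 0, one has μ({⟦g⟧ ∈ X : Q(Δ_n, g·ℤ^n) > R}) < C·R^{−n}. (With n = d−1 this says the tail Ψ(R) = μ̄₀({L unimodular : Q₀(L) > R}) of the limit distribution of Frobenius numbers satisfies Ψ(R) < C_d·R^{−(d−1)}, i.e. it decays at least polynomially in R.) -/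
noncomputable section

open MeasureTheory Matrix Pointwise

/-- `SL_n(ℝ)` -/
abbrev SLR (n : ℕ) := Matrix.SpecialLinearGroup (Fin n) ℝ

instance (n : ℕ) : TopologicalSpace (SLR n) :=
  TopologicalSpace.induced (fun g => (g : Matrix (Fin n) (Fin n) ℝ)) inferInstance

/-- `SL_n(ℤ)` viewed as a subgroup of `SL_n(ℝ)`. -/
def SLZsub (n : ℕ) : Subgroup (SLR n) :=
  (Matrix.SpecialLinearGroup.map (n := Fin n) (Int.castRingHom ℝ)).range

/-- The space of unimodular lattices `X = SL_n(ℝ)/SL_n(ℤ)`. -/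
abbrev XQuot (n : ℕ) := SLR n ⧸ SLZsub n

instance (n : ℕ) : MeasurableSpace (XQuot n) := borel _

/-- The lattice `M·ℤ^n` associated to a matrix `M`. -/
def matLattice {n : ℕ} (M : Matrix (Fin n) (Fin n) ℝ) : Set (Fin n → ℝ) :=
  {x | ∃ v : Fin n → ℤ, x = M.mulVec fun i => (v i : ℝ)}

/-- The covering radius `Q(K, L) = inf{t > 0 : tK + L = ℝ^n}`. -/
def covRad (n : ℕ) (K L : Set (Fin n → ℝ)) : ℝ :=
  sInf {t : ℝ | 0 < t ∧ ∀ x : Fin n → ℝ, ∃ k ∈ K, ∃ l ∈ L, x = t • k + l}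

/-- The standard simplex `Δ_n = {x : x_i ≥ 0, ∑ x_i ≤ 1}`. -/
def simplexStd (n : ℕ) : Set (Fin n → ℝ) :=
  {x | (∀ i, 0 ≤ x i) ∧ ∑ i, x i ≤ 1}

/-- The unimodular lattice `g·ℤ^n` of `g ∈ SL_n(ℝ)`. -/
def latticeOf {n : ℕ} (g : SLR n) : Set (Fin n → ℝ) :=
  matLattice (g : Matrix (Fin n) (Fin n) ℝ)

/-- A form of the transference principle: if the nonzero vectors of the image of `ι` have norm at
least `ε`, then every additive function on `A` agrees modulo `1` with pairing against a vector of
norm at most `2 ^ n / ε`. -/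
theorem exists_norm_le_inner_congr_int {E A : Type*} [NormedAddCommGroup E]
    [InnerProductSpace ℝ E] [FiniteDimensional ℝ E] [AddCommGroup A] (n : ℕ) :
    ∀ (W : Submodule ℝ E) (_ : Module.finrank ℝ W ≤ n) (ι : A →+ E) (φ : A →+ ℝ) (ε : ℝ)
      (_ : 0 < ε) (_ : ∀ a, ι a ∈ W) (_ : ∀ a, ι a = 0 → ∃ k : ℤ, φ a = k)
      (_ : ∀ a, ι a ≠ 0 → ε ≤ ‖ι a‖),
      ∃ y ∈ W, ‖y‖ ≤ 2 ^ n / ε ∧ ∀ a, ∃ k : ℤ, φ a - inner ℝ (ι a) y = k := by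
  induction n with
  | zero =>
    intro W hW ι φ ε hε hιW hφ hι
    have hW0 : W = ⊥ := Submodule.finrank_eq_zero.mp (Nat.le_zero.mp hW)
    refine ⟨0, W.zero_mem, by simp [hε.le], fun a => ?_⟩
    have : ι a = 0 := by simpa [hW0] using hιW a
    simpa using hφ a this
  | succ n ih =>
    intro W hW ι φ ε hε hιW hφ hι
    by_cases h0 : ∀ a, ι a = 0
    · exact ⟨0, W.zero_mem, by simp; positivity, fun a => by simpa using hφ a (h0 a)⟩
    push Not at h0
    obtain ⟨a₀, ha₀⟩ := h0
    set N : Set ℝ := {r | ∃ a, ι a ≠ 0 ∧ ‖ι a‖ = r} with hN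
    have hNne : N.Nonempty := ⟨_, a₀, ha₀, rfl⟩
    have hNbdd : BddBelow N := ⟨ε, by rintro _ ⟨a, ha, rfl⟩; exact hι a ha⟩
    set l := sInf N with hl
    have hεl : ε ≤ l := le_csInf hNne (by rintro _ ⟨a, ha, rfl⟩; exact hι a ha)
    have hl0 : 0 < l := hε.trans_le hεl
    have hlmin : ∀ a, ι a ≠ 0 → l ≤ ‖ι a‖ := fun a ha => csInf_le hNbdd ⟨a, ha, rfl⟩
    obtain ⟨_, ⟨a₁, ha₁, rfl⟩, hlt⟩ := exists_lt_of_csInf_lt hNne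
      (show sInf N < 6 / 5 * l by rw [← hl]; linarith)
    set w := ι a₁ with hw
    have hwpos : 0 < ‖w‖ := norm_pos_iff.mpr ha₁
    have hlw : l ≤ ‖w‖ := hlmin a₁ ha₁
    have hww : inner ℝ w w = ‖w‖ ^ 2 := real_inner_self_eq_norm_sq w
    set t : ℝ := φ a₁ - round (φ a₁) with ht
    have htabs : |t| ≤ 1 / 2 := abs_sub_round _
    set c : E → ℝ := fun v => inner ℝ w v / ‖w‖ ^ 2 with hc
    set ι' : A →+ E := AddMonoidHom.mk' (fun a => ι a - c (ι a) • w) (by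
      intro a b
      simp only [hc, map_add, inner_add_right, add_div, add_smul]
      abel) with hι'
    set φ' : A →+ ℝ := AddMonoidHom.mk' (fun a => φ a - c (ι a) * t) (by
      intro a b
      simp only [hc, map_add, inner_add_right, add_div, add_mul]
      ring) with hφ'
    have hι'a : ∀ a, ι' a = ι a - c (ι a) • w := fun a => rfl
    have hφ'a : ∀ a, φ' a = φ a - c (ι a) * t := fun a => rfl
    have hcw : c w = 1 := by simp only [hc, hww]; field_simp
    have hperp : ∀ a, inner ℝ w (ι' a) = 0 := by
      intro a
      rw [hι'a, inner_sub_right, inner_smul_right, hww]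
      simp only [hc]
      field_simp
      ring
    -- every element can be shifted by a multiple of `a₁` to have a small component along `w`
    have hshift : ∀ a, ∃ b, ∃ k : ℤ, a = b + k • a₁ ∧ ι' b = ι' a ∧ |c (ι b)| ≤ 1 / 2 ∧
        c (ι a) = c (ι b) + k := by
      intro a
      have hcb : c (ι (a - round (c (ι a)) • a₁)) = c (ι a) - round (c (ι a)) := by
        have : c w = 1 := hcw
        simp only [hc] at this
        rw [map_sub, map_zsmul, ← hw]
        simp only [hc, inner_sub_right, sub_div, ← Int.cast_smul_eq_zsmul ℝ, inner_smul_right,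
          mul_div_assoc, this, mul_one]
      refine ⟨a - round (c (ι a)) • a₁, round (c (ι a)), by abel, ?_, ?_, ?_⟩
      · rw [hι'a, hcb, hι'a, map_sub, map_zsmul, ← hw, sub_smul, Int.cast_smul_eq_zsmul]
        abel
      · rw [hcb]; exact abs_sub_round _
      · rw [hcb]; ring
    have hnorm : ∀ b, ‖ι b‖ ^ 2 = ‖ι' b‖ ^ 2 + c (ι b) ^ 2 * ‖w‖ ^ 2 := by
      intro b
      have h1 : ι b = ι' b + c (ι b) • w := by rw [hι'a]; abel
      have h2 : inner ℝ (ι' b) w = 0 := by rw [real_inner_comm]; exact hperp b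
      have h3 := norm_add_sq_real (ι' b) (c (ι b) • w)
      rw [← h1, inner_smul_right, h2, norm_smul, mul_pow, Real.norm_eq_abs, sq_abs] at h3
      linarith
    have hcsq : ∀ b, |c (ι b)| ≤ 1 / 2 → c (ι b) ^ 2 * ‖w‖ ^ 2 ≤ (3 / 5 * l) ^ 2 := by
      intro b hb
      rw [← mul_pow, ← sq_abs, abs_mul, abs_of_pos hwpos]
      have h1 : |c (ι b)| * ‖w‖ ≤ 1 / 2 * (6 / 5 * l) := by gcongr
      exact pow_le_pow_left₀ (by positivity) (h1.trans (by linarith)) 2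
    obtain ⟨y, hyW, hy, hyk⟩ := ih (W ⊓ (Submodule.span ℝ {w})ᗮ) (by
      have hlt : W ⊓ (Submodule.span ℝ {w})ᗮ < W := by
        refine lt_of_le_of_ne inf_le_left fun h => ?_
        have h1 : w ∈ W ⊓ (Submodule.span ℝ {w})ᗮ := by rw [h]; exact hιW a₁
        have := Submodule.mem_orthogonal_singleton_iff_inner_right.mp h1.2
        rw [hww] at this
        exact (pow_pos hwpos 2).ne' this
      have := Submodule.finrank_lt_finrank_of_lt hlt
      omega) ι' φ' (4 / 5 * ε) (by positivity)
      (fun a => ⟨W.sub_mem (hιW a) (W.smul_mem _ (hιW a₁)),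
        Submodule.mem_orthogonal_singleton_iff_inner_right.mpr (hperp a)⟩)
      (by
        intro a ha
        obtain ⟨b, k, hab, hb, hcb, hcab⟩ := hshift a
        have hb0 : ι b = 0 := by
          by_contra hne
          have h1 := hnorm b
          have h2 := hcsq b hcb
          have h3 := hlmin b hne
          rw [hb, ha, norm_zero] at h1
          nlinarith
        obtain ⟨m, hm⟩ := hφ b hb0
        have hcb0 : c (ι b) = 0 := by simp [hc, hb0]
        refine ⟨m + k * round (φ a₁), ?_⟩
        rw [hφ'a, hcab, hcb0, hab, map_add, map_zsmul, hm, ht]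
        push_cast
        simp only [zsmul_eq_mul]
        ring)
      (by
        intro a ha
        obtain ⟨b, k, hab, hb, hcb, hcab⟩ := hshift a
        have hb0 : ι b ≠ 0 := by
          intro h
          apply ha
          rw [← hb, hι'a, h]
          simp [hc]
        have h1 := hnorm b
        have h2 := hcsq b hcb
        have h3 := hlmin b hb0
        rw [← hb]
        refine le_trans (show 4 / 5 * ε ≤ 4 / 5 * l by linarith) ?_
        refine abs_le_of_sq_le_sq' ?_ (norm_nonneg _) |>.2
        nlinarith)
    have hwy : inner ℝ w y = 0 := Submodule.mem_orthogonal_singleton_iff_inner_right.mp hyW.2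
    refine ⟨y + (t / ‖w‖ ^ 2) • w, W.add_mem hyW.1 (W.smul_mem _ (hιW a₁)), ?_, fun a => ?_⟩
    · have h1 : ‖(t / ‖w‖ ^ 2) • w‖ ≤ (1 / 2) / ε := by
        rw [norm_smul, Real.norm_eq_abs, abs_div, abs_of_pos (pow_pos hwpos 2)]
        rw [show |t| / ‖w‖ ^ 2 * ‖w‖ = |t| / ‖w‖ by field_simp]
        gcongr
        linarith
      calc _ ≤ ‖y‖ + ‖(t / ‖w‖ ^ 2) • w‖ := norm_add_le _ _
        _ ≤ 2 ^ n / (4 / 5 * ε) + (1 / 2) / ε := add_le_add hy h1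
        _ = (2 ^ n * (5 / 4) + 1 / 2) / ε := by field_simp
        _ ≤ 2 ^ (n + 1) / ε := by
          gcongr
          have : (1 : ℝ) ≤ 2 ^ n := one_le_pow₀ (by norm_num)
          rw [pow_succ]
          linarith
    · obtain ⟨k, hk⟩ := hyk a
      refine ⟨k, ?_⟩
      rw [← hk, hφ'a, hι'a, inner_add_right, inner_sub_left, inner_smul_left, inner_smul_right, hwy,
        real_inner_comm w (ι a)]
      simp only [hc, mul_zero]
      ring

/-- If the covering radius of the simplex is large, the dual lattice has a short vector. -/
theorem exists_short_dual_of_lt_covRad {n : ℕ} (hn : 0 < n) (g : SLR n) {R : ℝ} (hR : 0 < R)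
    (h : R < covRad n (simplexStd n) (latticeOf g)) :
    ∃ a : Fin n → ℤ, a ≠ 0 ∧ ∀ j,
      |((fun i => (a i : ℝ)) ᵥ* ((g⁻¹ : SLR n) : Matrix (Fin n) (Fin n) ℝ)) j|
        ≤ 2 * n * 2 ^ n / R := by
  by_contra! hcon
  have hn' : (0 : ℝ) < n := Nat.cast_pos.mpr hn
  set ε : ℝ := 2 * n * 2 ^ n / R with hε
  have hε0 : 0 < ε := by positivity
  set H : Matrix (Fin n) (Fin n) ℝ := ((g⁻¹ : SLR n) : Matrix (Fin n) (Fin n) ℝ) with hH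
  have hGH : (g : Matrix (Fin n) (Fin n) ℝ) * H = 1 := by
    rw [hH, ← Matrix.SpecialLinearGroup.coe_mul, mul_inv_cancel,
      Matrix.SpecialLinearGroup.coe_one]
  refine absurd h (not_lt.mpr (csInf_le ⟨0, fun t ht => ht.1.le⟩ ⟨hR, fun x => ?_⟩))
  set ρ : ℝ := R / (2 * n) with hρ
  have hρ0 : 0 < ρ := by positivity
  have hρε : 2 ^ n / ε = ρ := by rw [hε, hρ]; field_simp
  let ι : (Fin n → ℤ) →+ EuclideanSpace ℝ (Fin n) :=
    AddMonoidHom.mk' (fun a => WithLp.toLp 2 ((fun i => (a i : ℝ)) ᵥ* H)) (by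
      intro a b
      rw [← WithLp.toLp_add, ← Matrix.add_vecMul]
      congr 2
      ext i
      simp)
  have hι : ∀ a, ι a = WithLp.toLp 2 ((fun i => (a i : ℝ)) ᵥ* H) := fun a => rfl
  let X : EuclideanSpace ℝ (Fin n) := WithLp.toLp 2 (fun i => x i - ρ)
  let φ : (Fin n → ℤ) →+ ℝ := AddMonoidHom.mk' (fun a => inner ℝ (ι a) X) (by
    intro a b
    rw [map_add, inner_add_left])
  have hφ : ∀ a, φ a = inner ℝ (ι a) X := fun a => rfl
  obtain ⟨y, -, hy, hyk⟩ := exists_norm_le_inner_congr_int n (⊤ : Submodule ℝ _)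
    (by simp) ι φ ε hε0 (fun _ => Submodule.mem_top)
    (fun a ha => ⟨0, by rw [hφ, ha]; simp⟩) (by
      intro a ha
      have ha0 : a ≠ 0 := fun h0 => ha (by rw [h0, map_zero])
      obtain ⟨j, hj⟩ := hcon a ha0
      have := PiLp.norm_apply_le (ι a) j
      rw [hι, Real.norm_eq_abs] at this
      rw [hι]
      exact hj.le.trans this)
  rw [hρε] at hy
  choose v hv using fun i => hyk (Pi.single i 1)
  have hz : ∀ i, (H *ᵥ (fun i => x i - ρ - y i)) i = v i := by
    intro i
    rw [← hv i, hφ, ← inner_sub_right, hι]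
    simp only [PiLp.inner_apply, Matrix.mulVec, dotProduct, X]
    refine Finset.sum_congr rfl fun j _ => ?_
    have : ((fun k => ((Pi.single i (1 : ℤ) : Fin n → ℤ) k : ℝ)) ᵥ* H) j = H i j := by
      have : (fun k => ((Pi.single i (1 : ℤ) : Fin n → ℤ) k : ℝ)) = Pi.single i 1 := by
        ext k
        by_cases hk : k = i <;> simp [hk]
      rw [this, Matrix.single_one_vecMul]
      rfl
    simp [this, mul_comm]
  have hyi : ∀ i, |y i| ≤ ρ := fun i => by
    have := (PiLp.norm_apply_le y i).trans hy
    rwa [Real.norm_eq_abs] at this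
  refine ⟨fun i => (y i + ρ) / R, ⟨fun i => ?_, ?_⟩, fun i => x i - ρ - y i, ⟨v, ?_⟩, ?_⟩
  · have := abs_le.mp (hyi i)
    exact div_nonneg (by linarith) hR.le
  · calc ∑ i, (y i + ρ) / R ≤ ∑ _i : Fin n, (2 * ρ) / R := by
          gcongr with i
          have := abs_le.mp (hyi i)
          linarith
      _ = 1 := by
          rw [Finset.sum_const, Finset.card_univ, Fintype.card_fin, nsmul_eq_mul, hρ]
          field_simp
  · have : (fun i => (v i : ℝ)) = H *ᵥ (fun i => x i - ρ - y i) := (funext hz).symm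
    rw [this, Matrix.mulVec_mulVec]
    rw [hGH, Matrix.one_mulVec]
  · ext i
    simp only [Pi.add_apply, Pi.smul_apply, smul_eq_mul]
    field_simp
    ring

theorem vecMul_transvection {ι R : Type*} [Fintype ι] [DecidableEq ι] [CommRing R] (a : ι → R)
    (i j : ι) (c : R) : a ᵥ* transvection i j c = a + Pi.single j (a i * c) := by
  rw [transvection, vecMul_add, vecMul_one]
  congr 1
  ext l
  simp only [vecMul, dotProduct, Matrix.single_apply, Pi.single_apply]
  rw [Finset.sum_eq_single i]
  · by_cases hl : l = j
    · simp [hl]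
    · simp [hl, Ne.symm hl]
  · intro b _ hb
    simp [Ne.symm hb]
  · simp

/-- Every integer row vector is carried to a multiple of the first unit vector by `SL_n(ℤ)`. -/
theorem exists_vecMul_eq_single {m : ℕ} (a : Fin (m + 1) → ℤ) :
    ∃ (γ : Matrix.SpecialLinearGroup (Fin (m + 1)) ℤ) (k : ℤ),
      a ᵥ* (γ : Matrix (Fin (m + 1)) (Fin (m + 1)) ℤ) = Pi.single 0 k := by
  suffices H : ∀ N : ℕ, ∀ a : Fin (m + 1) → ℤ, ∑ i, (a i).natAbs ≤ N →
      ∃ (γ : Matrix.SpecialLinearGroup (Fin (m + 1)) ℤ) (k : ℤ),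
        a ᵥ* (γ : Matrix (Fin (m + 1)) (Fin (m + 1)) ℤ) = Pi.single 0 k from H _ a le_rfl
  have step : ∀ (a : Fin (m + 1) → ℤ) {i j : Fin (m + 1)} (hij : i ≠ j) (c : ℤ),
      (∃ (γ : Matrix.SpecialLinearGroup (Fin (m + 1)) ℤ) (k : ℤ),
        (a + Pi.single j (a i * c)) ᵥ* (γ : Matrix (Fin (m + 1)) (Fin (m + 1)) ℤ)
          = Pi.single 0 k) →
      ∃ (γ : Matrix.SpecialLinearGroup (Fin (m + 1)) ℤ) (k : ℤ),
        a ᵥ* (γ : Matrix (Fin (m + 1)) (Fin (m + 1)) ℤ) = Pi.single 0 k := by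
    rintro a i j hij c ⟨γ, k, h⟩
    refine ⟨Matrix.SpecialLinearGroup.transvection hij c * γ, k, ?_⟩
    rw [Matrix.SpecialLinearGroup.coe_mul, ← vecMul_vecMul]
    exact (congrArg (· ᵥ* _) (vecMul_transvection a i j c)).trans h
  intro N
  induction N with
  | zero =>
    intro a ha
    have h0 : a = 0 := by
      ext i
      have := (Finset.sum_eq_zero_iff.mp (Nat.le_zero.mp ha)) i (Finset.mem_univ i)
      simpa using this
    exact ⟨1, 0, by simp [h0]⟩
  | succ N ih =>
    intro a ha
    by_cases h : ∃ i j, i ≠ j ∧ a i ≠ 0 ∧ (a i).natAbs ≤ (a j).natAbs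
    · obtain ⟨i, j, hij, hi, hle⟩ := h
      obtain ⟨c, hc⟩ : ∃ c : ℤ, (a j + a i * c).natAbs < (a j).natAbs := by
        rcases le_total 0 (a i) with h1 | h1 <;> rcases le_total 0 (a j) with h2 | h2
        · exact ⟨-1, by omega⟩
        · exact ⟨1, by omega⟩
        · exact ⟨1, by omega⟩
        · exact ⟨-1, by omega⟩
      refine step a hij c (ih _ (Nat.le_of_lt_succ (lt_of_lt_of_le ?_ ha)))
      refine Finset.sum_lt_sum (fun l _ => ?_) ⟨j, Finset.mem_univ j, by simpa using hc⟩
      by_cases hl : l = j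
      · subst hl; simpa using hc.le
      · simp [hl]
    · push Not at h
      by_cases h0 : ∃ i, i ≠ 0 ∧ a i ≠ 0
      · obtain ⟨i, hi0, hi⟩ := h0
        have ha' : a = Pi.single i (a i) := by
          ext l
          by_cases hl : l = i
          · subst hl; simp
          · by_contra hne
            rw [Pi.single_eq_of_ne hl] at hne
            have h1 := h i l (Ne.symm hl) hi
            have h2 := h l i hl hne
            omega
        refine step a hi0 1 (step _ hi0.symm (-1) ⟨1, a i, ?_⟩)
        rw [Matrix.SpecialLinearGroup.coe_one, vecMul_one, ha']
        ext l
        by_cases hl : l = i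
        · subst hl; simp [hi0]
        · by_cases hl0 : l = 0
          · subst hl0; simp [hl]
          · simp [hl, hl0]
      · push Not at h0
        refine ⟨1, a 0, ?_⟩
        rw [Matrix.SpecialLinearGroup.coe_one, vecMul_one]
        ext l
        by_cases hl : l = 0
        · subst hl; simp
        · simp [hl, h0 l hl]

theorem exists_eq_smul_row {m : ℕ} (a : Fin (m + 1) → ℤ) :
    ∃ (γ : Matrix.SpecialLinearGroup (Fin (m + 1)) ℤ) (k : ℤ), a = k • γ 0 := by
  obtain ⟨γ, k, h⟩ := exists_vecMul_eq_single a
  refine ⟨γ⁻¹, k, ?_⟩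
  have h1 : a ᵥ* ((γ * γ⁻¹ : Matrix.SpecialLinearGroup (Fin (m + 1)) ℤ) :
      Matrix (Fin (m + 1)) (Fin (m + 1)) ℤ) = Pi.single 0 k ᵥ*
        ((γ⁻¹ : Matrix.SpecialLinearGroup (Fin (m + 1)) ℤ) :
          Matrix (Fin (m + 1)) (Fin (m + 1)) ℤ) := by
    rw [Matrix.SpecialLinearGroup.coe_mul, ← vecMul_vecMul, h]
  rw [mul_inv_cancel, Matrix.SpecialLinearGroup.coe_one, vecMul_one, single_vecMul] at h1
  rw [h1]
  rfl

/-- The coordinates of `b` along `v` and along a complement of `v`, normalised so that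
`rowSplit v` has determinant one. -/
def rowSplit {m : ℕ} (v : Fin (m + 1) → ℝ) : (Fin (m + 1) → ℝ) →ₗ[ℝ] ℝ × (Fin m → ℝ) where
  toFun b := (b 0 / v 0,
    fun j => (b j.succ - v j.succ * (b 0 / v 0)) * (if (j : ℕ) = 0 then v 0 else 1))
  map_add' b c := by
    ext j
    · simp [add_div]
    · simp only [Pi.add_apply, Prod.snd_add]; ring
  map_smul' t b := by
    ext j
    · simp [mul_div_assoc]
    · simp only [Pi.smul_apply, Prod.smul_snd, smul_eq_mul, RingHom.id_apply]; ring

theorem rowSplit_fst {m : ℕ} (v b : Fin (m + 1) → ℝ) : (rowSplit v b).1 = b 0 / v 0 := rfl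

theorem rowSplit_snd {m : ℕ} (v b : Fin (m + 1) → ℝ) (j : Fin m) : (rowSplit v b).2 j =
    (b j.succ - v j.succ * (b 0 / v 0)) * (if (j : ℕ) = 0 then v 0 else 1) := rfl

theorem rowSplit_self {m : ℕ} {v : Fin (m + 1) → ℝ} (hv : v 0 ≠ 0) : rowSplit v v = (1, 0) := by
  ext j
  · simp [rowSplit_fst, hv]
  · simp [rowSplit_snd, hv]

/-- The matrices whose first row `v` is bounded by `r` and whose other rows have, relative to
`v`, first coordinate in `[0, 1]` and remaining coordinates in `T`. -/
def stepSet {m : ℕ} (r : ℝ) (T : Set (Fin m → Fin m → ℝ)) :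
    Set (Fin (m + 1) → Fin (m + 1) → ℝ) :=
  {M | (∀ j, |M 0 j| ≤ r) ∧ (M 0 0 ≠ 0 →
    (∀ i : Fin m, (rowSplit (M 0) (M i.succ)).1 ∈ Set.Icc (0 : ℝ) 1) ∧
      (fun i : Fin m => (rowSplit (M 0) (M i.succ)).2) ∈ T)}

theorem det_rowSplit {m : ℕ} (M : Matrix (Fin (m + 2)) (Fin (m + 2)) ℝ) (h0 : M 0 0 ≠ 0) :
    (Matrix.of fun i : Fin (m + 1) => (rowSplit (M 0) (M i.succ)).2).det = M.det := by
  set N : Matrix (Fin (m + 2)) (Fin (m + 2)) ℝ :=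
    Matrix.of fun i j => M i j - (if i = 0 then 0 else M i 0 / M 0 0) * M 0 j with hN
  have h1 : M.det = N.det := by
    refine det_eq_of_forall_row_eq_smul_add_const
      (fun i => if i = 0 then 0 else M i 0 / M 0 0) 0 (by simp) fun i j => ?_
    simp [hN]
  have h2 : N.det = M 0 0 * (N.submatrix Fin.succ Fin.succ).det := by
    rw [det_succ_column_zero, Finset.sum_eq_single 0]
    · simp [hN]
    · intro i _ hi
      have : N i 0 = 0 := by simp [hN, hi, h0]
      simp [this]
    · simp
  have h3 : (Matrix.of fun i : Fin (m + 1) => (rowSplit (M 0) (M i.succ)).2) =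
      N.submatrix Fin.succ Fin.succ *
        diagonal (fun j : Fin (m + 1) => if (j : ℕ) = 0 then M 0 0 else 1) := by
    ext i j
    simp only [mul_diagonal, of_apply, rowSplit_snd, submatrix_apply, hN, Fin.succ_ne_zero,
      if_false]
    ring
  have h4 : ∏ j : Fin (m + 1), (if (j : ℕ) = 0 then M 0 0 else 1) = M 0 0 := by
    rw [Fin.prod_univ_succ]
    simp
  rw [h3, det_mul, det_diagonal, h4, h1, h2, mul_comm]

/-- The block matrix with first row `(1, 0)` and remaining rows `(k, γ)`. -/
def blockLower {m : ℕ} (k : Fin m → ℤ) (γ : Matrix.SpecialLinearGroup (Fin m) ℤ) :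
    Matrix.SpecialLinearGroup (Fin (m + 1)) ℤ :=
  ⟨Matrix.of (Fin.cons (Pi.single 0 1) fun i => Fin.cons (k i) (γ i)), by
    rw [det_succ_row_zero, Finset.sum_eq_single 0]
    · have : (Matrix.of (Fin.cons (Pi.single 0 1) fun i => Fin.cons (k i) (γ i)) :
          Matrix (Fin (m + 1)) (Fin (m + 1)) ℤ).submatrix Fin.succ (Fin.succAbove 0) = γ := by
        ext i j
        simp
      rw [this]
      simp
    · intro j _ hj
      simp [hj]
    · simp⟩

theorem blockLower_zero {m : ℕ} (k : Fin m → ℤ) (γ : Matrix.SpecialLinearGroup (Fin m) ℤ) :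
    blockLower k γ 0 = Pi.single 0 1 := rfl

theorem blockLower_succ {m : ℕ} (k : Fin m → ℤ) (γ : Matrix.SpecialLinearGroup (Fin m) ℤ)
    (i : Fin m) : blockLower k γ i.succ = Fin.cons (k i) (γ i) := rfl

theorem map_mul_row {m : ℕ} (A : Matrix (Fin m) (Fin m) ℤ) (h : Matrix (Fin m) (Fin m) ℝ)
    (i : Fin m) : (A.map (Int.cast : ℤ → ℝ) * h) i = ∑ l, (A i l : ℝ) • h l := by
  ext j
  simp [Matrix.mul_apply]

theorem exists_mul_mem_stepSet {m : ℕ} {r : ℝ} {T : Set (Fin (m + 1) → Fin (m + 1) → ℝ)}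
    (hT : ∀ h : Matrix (Fin (m + 1)) (Fin (m + 1)) ℝ, h.det = 1 →
      ∃ γ : Matrix.SpecialLinearGroup (Fin (m + 1)) ℤ,
        Matrix.of.symm ((γ : Matrix (Fin (m + 1)) (Fin (m + 1)) ℤ).map (Int.cast : ℤ → ℝ) * h) ∈ T)
    (h : Matrix (Fin (m + 2)) (Fin (m + 2)) ℝ) (hdet : h.det = 1)
    {a : Fin (m + 2) → ℤ} (ha : a ≠ 0) (har : ∀ j, |((fun i => (a i : ℝ)) ᵥ* h) j| ≤ r) :
    ∃ γ : Matrix.SpecialLinearGroup (Fin (m + 2)) ℤ,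
      Matrix.of.symm ((γ : Matrix (Fin (m + 2)) (Fin (m + 2)) ℤ).map (Int.cast : ℤ → ℝ) * h)
        ∈ stepSet r T := by
  obtain ⟨γ₁, k, hk⟩ := exists_eq_smul_row a
  set M := (γ₁ : Matrix (Fin (m + 2)) (Fin (m + 2)) ℤ).map (Int.cast : ℤ → ℝ) * h with hM
  have hMdet : M.det = 1 := by
    rw [hM, det_mul, hdet, mul_one]
    have := congrArg (Int.cast : ℤ → ℝ) γ₁.det_coe
    rwa [Int.cast_det, Int.cast_one] at this
  have hk0 : k ≠ 0 := by
    rintro rfl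
    exact ha (by rw [hk, zero_smul])
  have hrow : ∀ j, ((fun i => (a i : ℝ)) ᵥ* h) j = k * M 0 j := by
    intro j
    rw [hM, map_mul_row, hk]
    simp [vecMul, dotProduct, Finset.mul_sum, mul_assoc]
  have hM0 : ∀ j, |M 0 j| ≤ r := by
    intro j
    refine le_trans ?_ (har j)
    rw [hrow, abs_mul]
    have : (1 : ℝ) ≤ |(k : ℝ)| := by exact_mod_cast Int.one_le_abs hk0
    exact le_mul_of_one_le_left (abs_nonneg _) this
  by_cases h00 : M 0 0 = 0
  · exact ⟨γ₁, hM0, fun hne => absurd h00 hne⟩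
  obtain ⟨γ₂, hγ₂⟩ := hT _ ((det_rowSplit M h00).trans hMdet)
  set f : Fin (m + 1) → ℤ :=
    fun i => -⌊∑ l, (γ₂ i l : ℝ) * (rowSplit (M 0) (M l.succ)).1⌋ with hf
  have hprod : ((blockLower f γ₂ * γ₁ : Matrix.SpecialLinearGroup (Fin (m + 2)) ℤ) :
      Matrix (Fin (m + 2)) (Fin (m + 2)) ℤ).map (Int.cast : ℤ → ℝ) * h =
      (blockLower f γ₂ : Matrix (Fin (m + 2)) (Fin (m + 2)) ℤ).map (Int.cast : ℤ → ℝ) * M := by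
    rw [hM, ← Matrix.mul_assoc, Matrix.SpecialLinearGroup.coe_mul]
    congr 1
    exact Matrix.map_mul (f := Int.castRingHom ℝ)
  have hp0 : ((blockLower f γ₂ : Matrix (Fin (m + 2)) (Fin (m + 2)) ℤ).map
      (Int.cast : ℤ → ℝ) * M) 0 = M 0 := by
    rw [map_mul_row, blockLower_zero, Finset.sum_eq_single 0]
    · simp
    · intro b _ hb; simp [hb]
    · simp
  have hps : ∀ i : Fin (m + 1), ((blockLower f γ₂ : Matrix (Fin (m + 2)) (Fin (m + 2)) ℤ).map
      (Int.cast : ℤ → ℝ) * M) i.succ = (f i : ℝ) • M 0 + ∑ l, (γ₂ i l : ℝ) • M l.succ := by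
    intro i
    rw [map_mul_row, blockLower_succ, Fin.sum_univ_succ]
    simp
  have key : ∀ P : Fin (m + 2) → Fin (m + 2) → ℝ, P 0 = M 0 →
      (∀ i : Fin (m + 1), P i.succ = (f i : ℝ) • M 0 + ∑ l, (γ₂ i l : ℝ) • M l.succ) →
      P ∈ stepSet r T := by
    intro P hP0 hPs
    have h1 : ∀ i : Fin (m + 1), rowSplit (P 0) (P i.succ) =
        (f i : ℝ) • ((1, 0) : ℝ × (Fin (m + 1) → ℝ)) +
          ∑ l, (γ₂ i l : ℝ) • rowSplit (M 0) (M l.succ) := by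
      intro i
      rw [hP0, hPs, map_add, map_smul, map_sum, rowSplit_self h00]
      simp only [map_smul]
    refine ⟨fun j => hP0 ▸ hM0 j, fun _ => ⟨fun i => ?_, ?_⟩⟩
    · rw [h1]
      simp only [Prod.fst_add, Prod.smul_fst, Prod.fst_sum, smul_eq_mul, mul_one, hf]
      push_cast
      constructor
      · linarith [Int.floor_le (∑ l, (γ₂ i l : ℝ) * (rowSplit (M 0) (M l.succ)).1)]
      · linarith [Int.lt_floor_add_one (∑ l, (γ₂ i l : ℝ) * (rowSplit (M 0) (M l.succ)).1)]
    · convert hγ₂ using 1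
      funext i
      rw [h1]
      refine Eq.trans ?_ (map_mul_row _ _ i).symm
      simp only [Prod.snd_add, Prod.smul_snd, smul_zero, zero_add, Prod.snd_sum]
      rfl
  exact ⟨blockLower f γ₂ * γ₁, hprod ▸ key _ hp0 hps⟩

theorem measurePreserving_mulVec {ι : Type*} [Fintype ι] [DecidableEq ι] {A : Matrix ι ι ℝ}
    (hA : A.det = 1) : MeasurePreserving (fun v : ι → ℝ => A *ᵥ v) := by
  refine ⟨by fun_prop, ?_⟩
  have := Real.map_matrix_volume_pi_eq_smul_volume_pi (M := A) (by simp [hA])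
  rw [hA, inv_one, abs_one, ENNReal.ofReal_one, one_smul] at this
  exact this

theorem measurePreserving_vecMul {ι : Type*} [Fintype ι] [DecidableEq ι] {A : Matrix ι ι ℝ}
    (hA : A.det = 1) : MeasurePreserving (fun v : ι → ℝ => v ᵥ* A) := by
  have := measurePreserving_mulVec (A := Aᵀ) (by rwa [det_transpose])
  simpa only [mulVec_transpose] using this

/-- **Minkowski's theorem** for a cube and a unimodular linear map. -/
theorem exists_ne_zero_abs_vecMul_le {m : ℕ} {h : Matrix (Fin (m + 1)) (Fin (m + 1)) ℝ}
    (hdet : h.det = 1) :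
    ∃ a : Fin (m + 1) → ℤ, a ≠ 0 ∧ ∀ j, |((fun i => (a i : ℝ)) ᵥ* h) j| ≤ 2 := by
  set b := Pi.basisFun ℝ (Fin (m + 1))
  set s : Set (Fin (m + 1) → ℝ) := (fun v => v ᵥ* h) ⁻¹' Metric.closedBall 0 2
  have hvol : volume s = ENNReal.ofReal 4 ^ (m + 1) := by
    rw [(measurePreserving_vecMul hdet).measure_preimage
      Metric.isClosed_closedBall.measurableSet.nullMeasurableSet,
      Real.volume_pi_closedBall _ zero_le_two]
    norm_num
  have hmem : ∀ v, v ∈ s ↔ ∀ j, |(v ᵥ* h) j| ≤ 2 := by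
    intro v
    simp only [s, Set.mem_preimage, mem_closedBall_zero_iff, pi_norm_le_iff_of_nonneg zero_le_two,
      Real.norm_eq_abs]
  have : Countable (Submodule.span ℤ (Set.range b)).toAddSubgroup :=
    inferInstanceAs (Countable (Submodule.span ℤ (Set.range b)))
  obtain ⟨⟨x, hx⟩, hx0, hxs⟩ := exists_ne_zero_mem_lattice_of_measure_mul_two_pow_lt_measure
    (ZSpan.isAddFundamentalDomain' b volume) (s := s)
    (fun v hv => by
      rw [hmem] at hv ⊢
      intro j
      rw [neg_vecMul, Pi.neg_apply, abs_neg]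
      exact hv j)
    ((convex_closedBall (0 : Fin (m + 1) → ℝ) 2).linear_preimage h.vecMulLinear)
    (by
      rw [hvol, ZSpan.fundamentalDomain_pi_basisFun, volume_pi_pi]
      simp only [Real.volume_Ico, sub_zero, ENNReal.ofReal_one, Finset.prod_const_one, one_mul,
        Module.finrank_fin_fun, ENNReal.ofReal_ofNat]
      exact ENNReal.pow_lt_pow_left (Nat.succ_ne_zero m) (by norm_num))
  have hx' : x ∈ Submodule.span ℤ (Set.range b) := hx
  rw [Module.Basis.mem_span_iff_repr_mem] at hx'
  choose a ha using hx'
  have hax : (fun i => (a i : ℝ)) = x := by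
    ext i
    simpa [b] using ha i
  refine ⟨a, ?_, ?_⟩
  · rintro rfl
    apply hx0
    ext i
    simp [← hax]
  · rw [hax]
    exact (hmem x).1 hxs

/-- Multiplication of the last row by `t`. -/
def scaleLast {m : ℕ} {E : Type*} [SMul ℝ E] (t : ℝ) (M : Fin (m + 1) → E) : Fin (m + 1) → E :=
  fun i => (if i = Fin.last m then t else 1) • M i

theorem smul_last_mem_stepSet {m : ℕ} {r : ℝ} {T : Set (Fin (m + 1) → Fin (m + 1) → ℝ)} {t : ℝ}
    (ht : t ∈ Set.Icc (0 : ℝ) 1)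
    (hT : ∀ M ∈ T, scaleLast t M ∈ T)
    {M : Fin (m + 2) → Fin (m + 2) → ℝ} (hM : M ∈ stepSet r T) :
    scaleLast t M ∈ stepSet r T := by
  unfold scaleLast at hT ⊢
  have h0 : (if (0 : Fin (m + 2)) = Fin.last (m + 1) then t else 1) • M 0 = M 0 := by
    rw [if_neg (by simp [Fin.ext_iff]), one_smul]
  have hi : ∀ i : Fin (m + 1), (if i.succ = Fin.last (m + 1) then t else 1) =
      if i = Fin.last m then t else 1 := by
    intro i
    simp only [← Fin.succ_last, Fin.succ_inj]
  refine ⟨fun j => by simpa only [h0] using hM.1 j, fun hne => ?_⟩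
  simp only [h0] at hne ⊢
  obtain ⟨h1, h2⟩ := hM.2 hne
  simp only [map_smul, hi]
  refine ⟨fun i => ?_, hT _ h2⟩
  simp only [Prod.smul_fst, smul_eq_mul]
  refine unitInterval.mul_mem ?_ (h1 i)
  split_ifs
  · exact ht
  · exact ⟨zero_le_one, le_rfl⟩

/-- A Siegel-type set: every unimodular matrix can be moved into it by a left multiplication
with an integral unimodular matrix. -/
def reducedSet : (m : ℕ) → Set (Fin (m + 1) → Fin (m + 1) → ℝ)
  | 0 => {M | M 0 0 ∈ Set.Icc (0 : ℝ) 1}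
  | m + 1 => stepSet 2 (reducedSet m)

theorem exists_mul_mem_reducedSet (m : ℕ) (h : Matrix (Fin (m + 1)) (Fin (m + 1)) ℝ)
    (hdet : h.det = 1) : ∃ γ : Matrix.SpecialLinearGroup (Fin (m + 1)) ℤ,
      Matrix.of.symm ((γ : Matrix (Fin (m + 1)) (Fin (m + 1)) ℤ).map (Int.cast : ℤ → ℝ) * h)
        ∈ reducedSet m := by
  induction m with
  | zero =>
    refine ⟨1, ?_⟩
    have : h 0 0 = 1 := by simpa using hdet
    simp [reducedSet, this]
  | succ m ih =>
    obtain ⟨a, ha, har⟩ := exists_ne_zero_abs_vecMul_le hdet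
    exact exists_mul_mem_stepSet ih h hdet ha har

theorem smul_last_mem_reducedSet {t : ℝ} (ht : t ∈ Set.Icc (0 : ℝ) 1) (m : ℕ)
    (M : Fin (m + 1) → Fin (m + 1) → ℝ) (hM : M ∈ reducedSet m) :
    scaleLast t M ∈ reducedSet m := by
  induction m with
  | zero =>
    have : M 0 0 ∈ Set.Icc (0 : ℝ) 1 := hM
    change (if (0 : Fin 1) = Fin.last 0 then t else 1) * M 0 0 ∈ Set.Icc (0 : ℝ) 1
    rw [if_pos (by simp)]
    exact unitInterval.mul_mem ht this
  | succ m ih => exact smul_last_mem_stepSet ht ih hM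

theorem measurable_rowSplit {m : ℕ} :
    Measurable fun p : (Fin (m + 1) → ℝ) × (Fin (m + 1) → ℝ) => rowSplit p.1 p.2 := by
  simp only [rowSplit, LinearMap.coe_mk, AddHom.coe_mk]
  refine Measurable.prodMk (by fun_prop) (measurable_pi_lambda _ fun j => ?_)
  split_ifs <;> fun_prop

theorem measurableSet_stepSet {m : ℕ} (r : ℝ) {T : Set (Fin m → Fin m → ℝ)}
    (hT : MeasurableSet T) : MeasurableSet (stepSet r T) := by
  have hs : ∀ i : Fin m, Measurable fun M : Fin (m + 1) → Fin (m + 1) → ℝ =>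
      rowSplit (M 0) (M i.succ) := fun i =>
    measurable_rowSplit.comp (f := fun M : Fin (m + 1) → Fin (m + 1) → ℝ => (M 0, M i.succ))
      (by fun_prop)
  have e : stepSet r T = (⋂ j, {M | |M 0 j| ≤ r}) ∩ ({M | M 0 0 = 0} ∪
      ((⋂ i : Fin m, (fun M : Fin (m + 1) → Fin (m + 1) → ℝ => (rowSplit (M 0) (M i.succ)).1) ⁻¹'
        Set.Icc (0 : ℝ) 1) ∩
      (fun M (i : Fin m) => (rowSplit (M 0) (M i.succ)).2) ⁻¹' T)) := by
    ext M
    simp only [stepSet, Set.mem_inter_iff, Set.mem_iInter, Set.mem_union, Set.mem_preimage,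
      Set.mem_ofPred_eq, ne_eq, imp_iff_not_or, not_not]
  rw [e]
  refine (MeasurableSet.iInter fun j => ?_).inter (MeasurableSet.union ?_
    ((MeasurableSet.iInter fun i => (hs i).fst measurableSet_Icc).inter
      (measurable_pi_lambda _ (fun i => (hs i).snd) hT)))
  · exact measurableSet_le (by fun_prop) measurable_const
  · exact measurableSet_eq_fun (by fun_prop) measurable_const

theorem measurableSet_reducedSet (m : ℕ) : MeasurableSet (reducedSet m) := by
  induction m with
  | zero =>
    have h : Measurable fun M : Fin 1 → Fin 1 → ℝ => M 0 0 := by fun_prop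
    exact h measurableSet_Icc
  | succ m ih => exact measurableSet_stepSet 2 ih

theorem measurePreserving_rowSplit {m : ℕ} {v : Fin (m + 2) → ℝ} (hv : v 0 ≠ 0) :
    MeasurePreserving (rowSplit v) := by
  set A : Matrix (Fin (m + 2)) (Fin (m + 2)) ℝ := LinearMap.toMatrix'
    ((Fin.consLinearEquiv ℝ fun _ => ℝ).toLinearMap ∘ₗ rowSplit v) with hA
  have hAv : ∀ b, A *ᵥ b = Fin.cons (rowSplit v b).1 (rowSplit v b).2 := by
    intro b
    rw [hA, LinearMap.toMatrix'_mulVec]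
    rfl
  have hAij : ∀ i j, A i j = (A *ᵥ Pi.single j 1) i := by
    intro i j
    simp
  have hdet : A.det = 1 := by
    rw [det_of_isLowerTriangular]
    · rw [Fin.prod_univ_succ, Fin.prod_univ_succ]
      simp only [hAij, hAv, Fin.cons_zero, Fin.cons_succ, rowSplit_fst, rowSplit_snd]
      simp [hv, Fin.succ_ne_zero]
    · intro i j hij
      have hij : i < j := hij
      rw [hAij, hAv]
      have h0 : (Pi.single j 1 : Fin (m + 2) → ℝ) 0 = 0 :=
        Pi.single_eq_of_ne (ne_of_lt ((Fin.zero_le i).trans_lt hij)) 1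
      cases i using Fin.cases with
      | zero => simp [rowSplit_fst, h0]
      | succ i => simp [rowSplit_snd, h0, Pi.single_eq_of_ne hij.ne]
  have h := (volume_preserving_piFinSuccAbove (fun _ : Fin (m + 2) => ℝ) 0).comp
    (measurePreserving_mulVec hdet)
  convert h using 1
  ext b i
  · simp [hAv]
  · simp [hAv]

theorem volume_stepSet_le {m : ℕ} {r : ℝ} (hr : 0 ≤ r) {T : Set (Fin (m + 1) → Fin (m + 1) → ℝ)}
    (hT : MeasurableSet T) :
    volume (stepSet r T) ≤ ENNReal.ofReal (2 * r) ^ (m + 2) * volume T := by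
  have e := (volume_preserving_piFinSuccAbove
    (fun _ : Fin (m + 2) => Fin (m + 2) → ℝ) 0).symm
  rw [← e.measure_preimage_equiv, Measure.volume_eq_prod,
    Measure.prod_apply ((MeasurableEquiv.measurable _) (measurableSet_stepSet r hT))]
  have hfib : ∀ᵐ v : Fin (m + 2) → ℝ, volume (Prod.mk v ⁻¹'
      ((MeasurableEquiv.piFinSuccAbove (fun _ : Fin (m + 2) => Fin (m + 2) → ℝ) 0).symm ⁻¹'
        stepSet r T)) ≤ (Metric.closedBall 0 r).indicator (fun _ => volume T) v := by
    filter_upwards [Measure.ae_eval_ne (μ := fun _ : Fin (m + 2) => (volume : Measure ℝ)) 0 0]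
      with v hv
    by_cases hvr : v ∈ Metric.closedBall (0 : Fin (m + 2) → ℝ) r
    · rw [Set.indicator_of_mem hvr]
      have hp := (volume_measurePreserving_arrowProdEquivProdArrow ℝ (Fin (m + 1) → ℝ)
        (Fin (m + 1))).comp (volume_preserving_pi fun _ : Fin (m + 1) =>
          measurePreserving_rowSplit hv)
      refine (measure_mono (t := _ ⁻¹' ((Set.univ.pi fun _ => Set.Icc (0 : ℝ) 1) ×ˢ T))
        fun B hB => ?_).trans_eq ((hp.measure_preimage ((MeasurableSet.univ_pi
          fun _ => measurableSet_Icc).prod hT).nullMeasurableSet).trans ?_)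
      · obtain ⟨h1, h2⟩ := hB.2 hv
        exact ⟨fun i _ => h1 i, h2⟩
      · rw [Measure.volume_eq_prod, Measure.prod_prod, volume_pi_pi]
        simp
    · rw [Set.indicator_of_notMem hvr, nonpos_iff_eq_zero]
      convert measure_empty (μ := volume)
      refine Set.eq_empty_of_forall_notMem fun B hB => hvr ?_
      rw [mem_closedBall_zero_iff, pi_norm_le_iff_of_nonneg hr]
      exact hB.1
  refine (lintegral_mono_ae hfib).trans ?_
  rw [lintegral_indicator_const Metric.isClosed_closedBall.measurableSet,
    Real.volume_pi_closedBall _ hr, mul_comm, Fintype.card_fin,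
    ENNReal.ofReal_pow (by positivity)]

theorem volume_reducedSet_lt_top (m : ℕ) : volume (reducedSet m) < ⊤ := by
  induction m with
  | zero =>
    have h : reducedSet 0 ⊆ Set.Icc (fun _ _ => 0) (fun _ _ => 1) := by
      intro M (hM : M 0 0 ∈ Set.Icc (0 : ℝ) 1)
      constructor <;> intro i j <;> rw [Fin.fin_one_eq_zero i, Fin.fin_one_eq_zero j]
      exacts [hM.1, hM.2]
    exact (measure_mono h).trans_lt isCompact_Icc.measure_lt_top
  | succ m ih =>
    exact (volume_stepSet_le zero_le_two (measurableSet_reducedSet m)).trans_lt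
      (ENNReal.mul_lt_top (by finiteness) ih)

section Unfolding

variable {G : Type*} [Group G] [MeasurableSpace G] (Γ : Subgroup G)

/-- The counting measure on a coset of `Γ`. -/
def cosetCount (x : G ⧸ Γ) : Measure G :=
  Quotient.liftOn' x (fun g => Measure.sum fun γ : Γ => Measure.dirac (g * γ)) fun a b hab => by
    rw [QuotientGroup.leftRel_apply] at hab
    ext s hs
    simp only [Measure.sum_apply _ hs, Measure.dirac_apply' _ hs]
    rw [← (Equiv.mulLeft (⟨a⁻¹ * b, hab⟩ : Γ)).tsum_eq
      fun γ : Γ => s.indicator (1 : G → ENNReal) (a * γ)]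
    simp [← mul_assoc]

theorem cosetCount_mk_apply (g : G) {s : Set G} (hs : MeasurableSet s) :
    cosetCount Γ (g : G ⧸ Γ) s = ∑' γ : Γ, s.indicator (1 : G → ENNReal) (g * γ) := by
  change (Measure.sum fun γ : Γ => Measure.dirac (g * γ)) s = _
  simp only [Measure.sum_apply _ hs, Measure.dirac_apply' _ hs]

theorem cosetCount_smul_apply [MeasurableMul G] (g : G) (x : G ⧸ Γ) {s : Set G}
    (hs : MeasurableSet s) :
    cosetCount Γ (g • x) s = cosetCount Γ x ((g * ·) ⁻¹' s) := by
  induction x using QuotientGroup.induction_on with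
  | H a =>
    rw [show g • (a : G ⧸ Γ) = ((g * a : G) : G ⧸ Γ) from rfl, cosetCount_mk_apply Γ _ hs,
      cosetCount_mk_apply Γ _ (measurable_const_mul g hs)]
    refine tsum_congr fun γ => ?_
    rw [mul_assoc]
    rfl

variable [TopologicalSpace G] [IsTopologicalGroup G] [PolishSpace G] [BorelSpace G]
  [Countable Γ] [IsClosed (Γ : Set G)] [MeasurableSpace (G ⧸ Γ)] [BorelSpace (G ⧸ Γ)]

theorem measurable_cosetCount : Measurable (cosetCount Γ) := by
  refine Measure.measurable_of_measurable_coe _ fun s hs => ?_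
  have hmap : MeasurableSpace.map ((↑) : G → G ⧸ Γ) ‹MeasurableSpace G› =
      ‹MeasurableSpace (G ⧸ Γ)› :=
    (QuotientGroup.continuous_mk.map_eq_borel QuotientGroup.mk_surjective).trans
      (BorelSpace.measurable_eq (α := G ⧸ Γ)).symm
  have : Measurable fun g : G => cosetCount Γ (g : G ⧸ Γ) s := by
    simp only [cosetCount_mk_apply Γ _ hs]
    exact Measurable.tsum fun γ =>
      (measurable_one.indicator hs).comp (measurable_mul_const (γ : G))
  intro t ht
  rw [← hmap]
  exact this ht

/-- The `Γ`-periodic measure on `G` which descends to `μ`. -/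
def unfolded (μ : Measure (G ⧸ Γ)) : Measure G := μ.bind (cosetCount Γ)

theorem unfolded_apply (μ : Measure (G ⧸ Γ)) {s : Set G} (hs : MeasurableSet s) :
    unfolded Γ μ s = ∫⁻ x, cosetCount Γ x s ∂μ :=
  Measure.bind_apply hs (measurable_cosetCount Γ).aemeasurable

theorem isMulLeftInvariant_unfolded {μ : Measure (G ⧸ Γ)}
    (hμ : ∀ g : G, Measure.map (fun x => g • x) μ = μ) :
    (unfolded Γ μ).IsMulLeftInvariant := by
  refine ⟨fun g => ?_⟩
  ext s hs
  have hmeas : Measurable fun x : G ⧸ Γ => g • x := (continuous_const_smul g).measurable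
  rw [Measure.map_apply (measurable_const_mul g) hs, unfolded_apply Γ μ hs,
    unfolded_apply Γ μ (measurable_const_mul g hs)]
  have h := lintegral_map (μ := μ)
    ((Measure.measurable_coe hs).comp (measurable_cosetCount Γ)) hmeas
  rw [hμ g] at h
  simp only [Function.comp_apply, cosetCount_smul_apply Γ g _ hs] at h
  exact h.symm

theorem measure_le_unfolded (μ : Measure (G ⧸ Γ)) {s : Set G} (hs : MeasurableSet s)
    {A : Set (G ⧸ Γ)} (hA : A ⊆ QuotientGroup.mk '' s) : μ A ≤ unfolded Γ μ s := by
  rw [unfolded_apply Γ μ hs]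
  have h := mul_meas_ge_le_lintegral (μ := μ)
    ((Measure.measurable_coe hs).comp (measurable_cosetCount Γ)) 1
  rw [one_mul] at h
  refine (measure_mono fun x hx => ?_).trans h
  obtain ⟨g, hg, rfl⟩ := hA hx
  change 1 ≤ cosetCount Γ (g : G ⧸ Γ) s
  rw [cosetCount_mk_apply Γ g hs]
  refine le_trans ?_ (ENNReal.le_tsum (1 : Γ))
  simp [hg]

theorem unfolded_le (μ : Measure (G ⧸ Γ)) [IsProbabilityMeasure μ] {s : Set G}
    (hs : MeasurableSet s) {F : Set Γ}
    (hsF : ∀ g ∈ s, ∀ γ : Γ, g * γ ∈ s → γ ∈ F) : unfolded Γ μ s ≤ F.encard := by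
  rw [unfolded_apply Γ μ hs]
  have hb : ∀ x : G ⧸ Γ, cosetCount Γ x s ≤ F.encard := by
    intro x
    induction x using QuotientGroup.induction_on with
    | H a =>
      by_cases ha : ∃ γ : Γ, a * γ ∈ s
      · obtain ⟨γ₀, h₀⟩ := ha
        rw [show (a : G ⧸ Γ) = ((a * γ₀ : G) : G ⧸ Γ) from
          (QuotientGroup.mk_mul_of_mem a γ₀.2).symm, cosetCount_mk_apply Γ _ hs]
        calc ∑' γ : Γ, s.indicator (1 : G → ENNReal) (a * γ₀ * γ)
            ≤ ∑' γ : Γ, F.indicator 1 γ := by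
              refine ENNReal.tsum_le_tsum fun γ => ?_
              by_cases h : a * γ₀ * γ ∈ s
              · simp [h, hsF _ h₀ γ h]
              · simp [h]
          _ = F.encard := by
            rw [← tsum_subtype]
            simp
      · rw [cosetCount_mk_apply Γ _ hs]
        push Not at ha
        simp [ha]
  exact (lintegral_mono hb).trans (by simp)

end Unfolding

theorem isClosedEmbedding_coe (n : ℕ) :
    Topology.IsClosedEmbedding fun g : SLR n => (g : Matrix (Fin n) (Fin n) ℝ) :=
  Matrix.SpecialLinearGroup.isClosedEmbedding_val

instance (n : ℕ) : IsTopologicalGroup (SLR n) :=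
  Matrix.SpecialLinearGroup.topologicalGroup

instance (n : ℕ) : PolishSpace (SLR n) :=
  have : PolishSpace (Matrix (Fin n) (Fin n) ℝ) :=
    inferInstanceAs (PolishSpace (Fin n → Fin n → ℝ))
  (isClosedEmbedding_coe n).polishSpace

instance (n : ℕ) : MeasurableSpace (SLR n) := borel _

instance (n : ℕ) : BorelSpace (SLR n) := ⟨rfl⟩

instance (n : ℕ) : BorelSpace (XQuot n) := ⟨rfl⟩

instance (n : ℕ) : Countable (SLZsub n) :=
  have : Countable (Matrix.SpecialLinearGroup (Fin n) ℤ) :=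
    Function.Injective.countable (β := Fin n → Fin n → ℤ) Subtype.val_injective
  (Set.countable_range _).to_subtype

instance (n : ℕ) : IsClosed (SLZsub n : Set (SLR n)) :=
  (Topology.IsClosedEmbedding.specialLinearGroup_map
    (f := Int.castRingHom ℝ) Int.isClosedEmbedding_coe_real).isClosed_range

/-- The matrices of determinant one with entries bounded by `k`. -/
def boundedSL (n k : ℕ) : Set (SLR n) := {g | ∀ i j, |g i j| ≤ k}

theorem measurableSet_boundedSL (n k : ℕ) : MeasurableSet (boundedSL n k) := by
  refine IsClosed.measurableSet ?_
  simp only [boundedSL, Set.ofPred_forall]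
  refine isClosed_iInter fun i => isClosed_iInter fun j => isClosed_le ?_ continuous_const
  exact ((isClosedEmbedding_coe n).continuous.matrix_elem i j).abs

theorem isCompact_boundedSL (n k : ℕ) : IsCompact (boundedSL n k) := by
  have : IsCompact (Set.univ.pi fun _ => Set.univ.pi fun _ => Set.Icc (-k : ℝ) k :
      Set (Matrix (Fin n) (Fin n) ℝ)) :=
    isCompact_univ_pi fun _ => isCompact_univ_pi fun _ => isCompact_Icc
  convert (isClosedEmbedding_coe n).isCompact_preimage this using 1
  ext g
  exact ⟨fun h i _ j _ => abs_le.1 (h i j), fun h i j => abs_le.2 (h i trivial j trivial)⟩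

theorem iUnion_boundedSL (n : ℕ) : ⋃ k, boundedSL n k = Set.univ := by
  refine Set.eq_univ_of_forall fun g => Set.mem_iUnion.2 ?_
  obtain ⟨k, hk⟩ := exists_nat_ge (∑ i, ∑ j, |g i j|)
  refine ⟨k, fun i j => le_trans ?_ hk⟩
  exact (Finset.single_le_sum (f := fun j => |g i j|) (fun _ _ => abs_nonneg _)
    (Finset.mem_univ j)).trans (Finset.single_le_sum (f := fun i => ∑ j, |g i j|)
      (fun _ _ => Finset.sum_nonneg fun _ _ => abs_nonneg _) (Finset.mem_univ i))

theorem finite_setOf_mem_SLZsub {n : ℕ} {K : Set (SLR n)} (hK : IsCompact K) :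
    {γ : SLZsub n | (γ : SLR n) ∈ K}.Finite := by
  have h := (Topology.IsClosedEmbedding.specialLinearGroup_map (n := Fin n)
    (f := Int.castRingHom ℝ) Int.isClosedEmbedding_coe_real).isCompact_preimage hK
  refine Set.Finite.of_finite_image ((h.finite_of_discrete.image
    (Matrix.SpecialLinearGroup.map (Int.castRingHom ℝ))).subset ?_) Subtype.val_injective.injOn
  rintro _ ⟨⟨_, γ, rfl⟩, hγ, rfl⟩
  exact ⟨γ, hγ, rfl⟩

/-- A bound for the number of integral unimodular matrices moving a point of `boundedSL n k` to
another one. -/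
def returnBound (n k : ℕ) : ENNReal :=
  {γ : SLZsub n | (γ : SLR n) ∈ (boundedSL n k)⁻¹ * boundedSL n k}.encard

theorem returnBound_ne_top (n k : ℕ) : returnBound n k ≠ ⊤ := by
  have h := finite_setOf_mem_SLZsub ((isCompact_boundedSL n k).inv.mul (isCompact_boundedSL n k))
  simpa [returnBound] using h

theorem unfolded_boundedSL_le {n : ℕ} (k : ℕ) (μ : Measure (XQuot n)) [IsProbabilityMeasure μ] :
    unfolded (SLZsub n) μ (boundedSL n k) ≤ returnBound n k :=
  unfolded_le _ μ (measurableSet_boundedSL n k) fun g hg γ hγ =>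
    ⟨g⁻¹, Set.inv_mem_inv.2 hg, g * γ, hγ, by simp⟩

theorem continuous_scaleLast {m : ℕ} {E : Type*} [TopologicalSpace E] [SMul ℝ E]
    [ContinuousSMul ℝ E] :
    Continuous fun p : ℝ × (Fin (m + 1) → E) => scaleLast p.1 p.2 := by
  refine continuous_pi fun i => ?_
  unfold scaleLast
  split_ifs <;> fun_prop

theorem scaleLast_scaleLast {m : ℕ} {E : Type*} [MulAction ℝ E] (s t : ℝ) (M : Fin (m + 1) → E) :
    scaleLast s (scaleLast t M) = scaleLast (s * t) M := by
  ext i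
  by_cases h : i = Fin.last m <;> simp [scaleLast, h, mul_smul]

theorem scaleLast_one {m : ℕ} {E : Type*} [MulAction ℝ E] (M : Fin (m + 1) → E) :
    scaleLast 1 M = M := by
  ext i
  simp [scaleLast]

theorem det_scaleLast {m : ℕ} (t : ℝ) (M : Fin (m + 1) → Fin (m + 1) → ℝ) :
    (Matrix.of (scaleLast t M)).det = t * (Matrix.of M).det := by
  have h := det_mul_column (fun i => if i = Fin.last m then t else 1) (Matrix.of M)
  have e : Matrix.of (scaleLast t M) = Matrix.of fun i j =>
      (if i = Fin.last m then t else 1) * Matrix.of M i j := rfl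
  rw [e, h, Fin.prod_univ_castSucc]
  simp [Fin.castSucc_ne_last]

/-- The rows of a matrix of determinant one. -/
def slRows {n : ℕ} (g : SLR n) : Fin n → Fin n → ℝ := Matrix.of.symm (g : Matrix (Fin n) (Fin n) ℝ)

theorem isClosedEmbedding_slRows (n : ℕ) : Topology.IsClosedEmbedding (slRows (n := n)) :=
  isClosedEmbedding_coe n

theorem measurableEmbedding_slRows (n : ℕ) : MeasurableEmbedding (slRows (n := n)) :=
  (isClosedEmbedding_slRows n).measurableEmbedding

theorem slRows_mul {n : ℕ} (g h : SLR n) :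
    slRows (g * h) = fun i => slRows g i ᵥ* (h : Matrix (Fin n) (Fin n) ℝ) := by
  ext i j
  rfl

/-- The element of `SLR n` with given rows. -/
def slOfRows {n : ℕ} (M : Fin n → Fin n → ℝ) (h : (Matrix.of M).det = 1) : SLR n :=
  ⟨Matrix.of M, h⟩

theorem slRows_slOfRows {n : ℕ} {M : Fin n → Fin n → ℝ} (h : (Matrix.of M).det = 1) :
    slRows (slOfRows M h) = M := rfl

/-- The rescaling of the last row of an invertible matrix to determinant one. -/
def normalizeLast {m : ℕ} (M : Fin (m + 1) → Fin (m + 1) → ℝ) : SLR (m + 1) :=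
  if h : (Matrix.of M).det ≠ 0 then
    slOfRows (scaleLast (Matrix.of M).det⁻¹ M) (by rw [det_scaleLast, inv_mul_cancel₀ h])
  else 1

theorem slRows_normalizeLast {m : ℕ} {M : Fin (m + 1) → Fin (m + 1) → ℝ}
    (h : (Matrix.of M).det ≠ 0) :
    slRows (normalizeLast M) = scaleLast (Matrix.of M).det⁻¹ M := by
  rw [normalizeLast, dif_pos h, slRows_slOfRows]

theorem scaleLast_normalizeLast {m : ℕ} {M : Fin (m + 1) → Fin (m + 1) → ℝ}
    (h : (Matrix.of M).det ≠ 0) :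
    scaleLast (Matrix.of M).det (slRows (normalizeLast M)) = M := by
  rw [slRows_normalizeLast h, scaleLast_scaleLast, mul_inv_cancel₀ h, scaleLast_one]

theorem continuous_det_of (m : ℕ) :
    Continuous fun M : Fin m → Fin m → ℝ => (Matrix.of M).det :=
  (continuous_id (X := Matrix (Fin m) (Fin m) ℝ)).matrix_det

theorem measurable_normalizeLast (m : ℕ) : Measurable (normalizeLast (m := m)) := by
  rw [← (measurableEmbedding_slRows (m + 1)).measurable_comp_iff]
  have : slRows ∘ normalizeLast (m := m) = fun M =>
      if (Matrix.of M).det ≠ 0 then scaleLast (Matrix.of M).det⁻¹ M else slRows 1 := by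
    funext M
    split_ifs with h
    · rw [Function.comp_apply, slRows_normalizeLast h]
    · rw [Function.comp_apply, normalizeLast, dif_neg h]
  rw [this]
  have hdet := (continuous_det_of (m + 1)).measurable
  refine Measurable.ite (hdet (measurableSet_singleton 0).compl) ?_ measurable_const
  exact continuous_scaleLast.measurable.comp
    (f := fun M : Fin (m + 1) → Fin (m + 1) → ℝ => ((Matrix.of M).det⁻¹, M))
    (hdet.inv.prodMk measurable_id)

theorem det_of_vecMul {n : ℕ} (M : Fin n → Fin n → ℝ) (g : SLR n) :
    (Matrix.of fun i => M i ᵥ* (g : Matrix (Fin n) (Fin n) ℝ)).det = (Matrix.of M).det := by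
  have h : (Matrix.of fun i => M i ᵥ* (g : Matrix (Fin n) (Fin n) ℝ)) =
      Matrix.of M * (g : Matrix (Fin n) (Fin n) ℝ) := rfl
  rw [h, det_mul, g.det_coe, mul_one]

theorem normalizeLast_vecMul {m : ℕ} {M : Fin (m + 1) → Fin (m + 1) → ℝ} (g : SLR (m + 1))
    (h : (Matrix.of M).det ≠ 0) :
    normalizeLast (fun i => M i ᵥ* (g : Matrix (Fin (m + 1)) (Fin (m + 1)) ℝ)) =
      normalizeLast M * g := by
  apply (isClosedEmbedding_slRows _).injective
  rw [slRows_mul, slRows_normalizeLast h, slRows_normalizeLast (by rwa [det_of_vecMul]),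
    det_of_vecMul]
  ext1 i
  simp only [scaleLast, smul_vecMul]

/-- The matrices with determinant in `(0, 1]`. -/
def detUnit (n : ℕ) : Set (Fin n → Fin n → ℝ) := {M | (Matrix.of M).det ∈ Set.Ioc (0 : ℝ) 1}

theorem measurableSet_detUnit (n : ℕ) : MeasurableSet (detUnit n) :=
  (continuous_det_of n).measurable measurableSet_Ioc

theorem volume_detUnit_ne_zero (m : ℕ) : volume (detUnit (m + 1)) ≠ 0 := by
  have hopen : IsOpen {M : Fin (m + 1) → Fin (m + 1) → ℝ |
      (Matrix.of M).det ∈ Set.Ioo (0 : ℝ) 1} := isOpen_Ioo.preimage (continuous_det_of _)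
  have hne : {M : Fin (m + 1) → Fin (m + 1) → ℝ |
      (Matrix.of M).det ∈ Set.Ioo (0 : ℝ) 1}.Nonempty := by
    refine ⟨scaleLast 2⁻¹ (slRows 1), ?_⟩
    have h1 : (Matrix.of (slRows (1 : SLR (m + 1)))).det = 1 :=
      Matrix.SpecialLinearGroup.det_coe 1
    rw [Set.mem_ofPred_eq, det_scaleLast, h1]
    norm_num
  have hsub : {M : Fin (m + 1) → Fin (m + 1) → ℝ | (Matrix.of M).det ∈ Set.Ioo (0 : ℝ) 1} ⊆
      detUnit (m + 1) := fun M hM => ⟨hM.1, hM.2.le⟩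
  exact ((hopen.measure_pos volume hne).trans_le (measure_mono hsub)).ne'

/-- A left invariant measure on `SLR (m + 1)`, obtained by pushing Lebesgue measure forward along
the inverse of the normalization of the last row. -/
def slMeasure (m : ℕ) : Measure (SLR (m + 1)) :=
  (volume.restrict (detUnit (m + 1))).map fun M => (normalizeLast M)⁻¹

theorem measurable_inv_normalizeLast (m : ℕ) :
    Measurable fun M => (normalizeLast (m := m) M)⁻¹ :=
  measurable_inv.comp (measurable_normalizeLast m)

theorem slMeasure_apply {m : ℕ} {s : Set (SLR (m + 1))} (hs : MeasurableSet s) :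
    slMeasure m s = volume {M ∈ detUnit (m + 1) | (normalizeLast M)⁻¹ ∈ s} := by
  have h := measurable_inv_normalizeLast m
  rw [slMeasure, Measure.map_apply h hs, Measure.restrict_apply (h hs), Set.inter_comm]
  rfl

instance (m : ℕ) : (slMeasure m).IsMulLeftInvariant := by
  refine ⟨fun g => ?_⟩
  ext s hs
  have hρ : MeasurePreserving fun (M : Fin (m + 1) → Fin (m + 1) → ℝ) i =>
      M i ᵥ* ((g⁻¹ : SLR (m + 1)) : Matrix (Fin (m + 1)) (Fin (m + 1)) ℝ) :=
    volume_preserving_pi fun _ => measurePreserving_vecMul (Matrix.SpecialLinearGroup.det_coe _)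
  have hset : MeasurableSet {M ∈ detUnit (m + 1) | (normalizeLast M)⁻¹ ∈ s} :=
    (measurableSet_detUnit _).inter (measurable_inv_normalizeLast m hs)
  rw [Measure.map_apply (measurable_const_mul g) hs, slMeasure_apply (measurable_const_mul g hs),
    slMeasure_apply hs, ← hρ.measure_preimage hset.nullMeasurableSet]
  congr 1
  ext M
  simp only [detUnit, Set.mem_preimage, Set.mem_ofPred_eq, det_of_vecMul]
  refine and_congr_right fun h => ?_
  rw [normalizeLast_vecMul _ h.1.ne', _root_.mul_inv_rev, inv_inv]

theorem slMeasure_boundedSL_lt_top (m k : ℕ) : slMeasure m (boundedSL (m + 1) k) < ⊤ := by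
  rw [slMeasure_apply (measurableSet_boundedSL _ k)]
  have hK := ((isCompact_Icc (a := (0 : ℝ)) (b := 1)).prod ((isCompact_boundedSL (m + 1) k).inv.image
    (isClosedEmbedding_slRows (m + 1)).continuous)).image continuous_scaleLast
  refine (measure_mono fun M hM => ?_).trans_lt hK.measure_lt_top
  obtain ⟨⟨h0, h1⟩, h⟩ := hM
  exact ⟨((Matrix.of M).det, slRows (normalizeLast M)), ⟨⟨h0.le, h1⟩, _, h, rfl⟩,
    scaleLast_normalizeLast h0.ne'⟩

theorem exists_slMeasure_boundedSL_ne_zero (m : ℕ) :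
    ∃ k, slMeasure m (boundedSL (m + 1) k) ≠ 0 := by
  by_contra! h
  have h1 := measure_iUnion_null h
  rw [iUnion_boundedSL, slMeasure_apply .univ] at h1
  exact volume_detUnit_ne_zero m (by simpa using h1)

theorem sigmaFinite_of_boundedSL {n : ℕ} {ν : Measure (SLR n)}
    (h : ∀ k, ν (boundedSL n k) < ⊤) : SigmaFinite ν :=
  ⟨⟨⟨boundedSL n, fun _ => trivial, h, iUnion_boundedSL n⟩⟩⟩

theorem slMeasure_preimage_le {m : ℕ} {T : Set (Fin (m + 1) → Fin (m + 1) → ℝ)}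
    (hT : MeasurableSet T) (hTs : ∀ t ∈ Set.Icc (0 : ℝ) 1, ∀ M ∈ T, scaleLast t M ∈ T) :
    slMeasure m ((fun g => slRows g⁻¹) ⁻¹' T) ≤ volume T := by
  have hmeas : Measurable fun g : SLR (m + 1) => slRows g⁻¹ :=
    (measurableEmbedding_slRows _).measurable.comp measurable_inv
  rw [slMeasure_apply (hmeas hT)]
  refine measure_mono fun M hM => ?_
  obtain ⟨⟨h0, h1⟩, h⟩ := hM
  rw [Set.mem_preimage, inv_inv] at h
  rw [← scaleLast_normalizeLast h0.ne']
  exact hTs _ ⟨h0.le, h1⟩ _ h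

theorem unfolded_eq_smul {m k : ℕ} (hk : slMeasure m (boundedSL (m + 1) k) ≠ 0)
    {μ : Measure (XQuot (m + 1))} [IsProbabilityMeasure μ]
    (hμ : ∀ g : SLR (m + 1), Measure.map (fun x => g • x) μ = μ) :
    unfolded (SLZsub (m + 1)) μ = (unfolded (SLZsub (m + 1)) μ (boundedSL (m + 1) k) /
      slMeasure m (boundedSL (m + 1) k)) • slMeasure m := by
  have := isMulLeftInvariant_unfolded (SLZsub (m + 1)) hμ
  have := sigmaFinite_of_boundedSL (slMeasure_boundedSL_lt_top m)
  have := sigmaFinite_of_boundedSL (ν := unfolded (SLZsub (m + 1)) μ) fun k =>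
    (unfolded_boundedSL_le k μ).trans_lt (returnBound_ne_top (m + 1) k).lt_top
  exact measure_eq_div_smul _ _ hk (slMeasure_boundedSL_lt_top m k).ne

theorem exists_const_measure_le (m : ℕ) : ∃ c : ENNReal, c ≠ ⊤ ∧
    ∀ (μ : Measure (XQuot (m + 1))), IsProbabilityMeasure μ →
      (∀ g : SLR (m + 1), Measure.map (fun x => g • x) μ = μ) →
      ∀ T : Set (Fin (m + 1) → Fin (m + 1) → ℝ), MeasurableSet T →
        (∀ t ∈ Set.Icc (0 : ℝ) 1, ∀ M ∈ T, scaleLast t M ∈ T) →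
        ∀ A : Set (XQuot (m + 1)), A ⊆ QuotientGroup.mk '' ((fun g => slRows g⁻¹) ⁻¹' T) →
          μ A ≤ c * volume T := by
  obtain ⟨k, hk⟩ := exists_slMeasure_boundedSL_ne_zero m
  refine ⟨returnBound (m + 1) k / slMeasure m (boundedSL (m + 1) k),
    ENNReal.div_ne_top (returnBound_ne_top _ _) hk, fun μ _ hμ T hT hTs A hA => ?_⟩
  have hmeas : Measurable fun g : SLR (m + 1) => slRows g⁻¹ :=
    (measurableEmbedding_slRows _).measurable.comp measurable_inv
  refine (measure_le_unfolded _ μ (hmeas hT) hA).trans ?_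
  rw [unfolded_eq_smul hk hμ, Measure.smul_apply, smul_eq_mul]
  exact mul_le_mul' (ENNReal.div_le_div_right (unfolded_boundedSL_le k μ) _)
    (slMeasure_preimage_le hT hTs)

theorem image_setOf_lt_covRad_subset {m : ℕ} {R : ℝ} (hR : 0 < R) :
    (QuotientGroup.mk '' {g : SLR (m + 2) |
      R < covRad (m + 2) (simplexStd (m + 2)) (latticeOf g)} : Set (XQuot (m + 2))) ⊆
    QuotientGroup.mk '' ((fun g : SLR (m + 2) => slRows g⁻¹) ⁻¹'
      stepSet (2 * (m + 2 : ℕ) * 2 ^ (m + 2) / R) (reducedSet m)) := by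
  rintro _ ⟨g, hg, rfl⟩
  obtain ⟨a, ha, har⟩ := exists_short_dual_of_lt_covRad (Nat.succ_pos _) g hR hg
  obtain ⟨γ, hγ⟩ := exists_mul_mem_stepSet (exists_mul_mem_reducedSet m) _
    (Matrix.SpecialLinearGroup.det_coe g⁻¹) ha har
  set δ : SLR (m + 2) := Matrix.SpecialLinearGroup.map (Int.castRingHom ℝ) γ
  have hδ : δ ∈ SLZsub (m + 2) := ⟨γ, rfl⟩
  refine ⟨g * δ⁻¹, ?_, QuotientGroup.mk_mul_of_mem _ (inv_mem hδ)⟩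
  rw [Set.mem_preimage, _root_.mul_inv_rev, inv_inv]
  exact hγ

/-- The tail of the limit distribution of Frobenius numbers satisfies
`Ψ(R) = μ({L : Q₀(L) > R}) < C·R^{-n}`. -/
theorem tail_bound (n : ℕ) (hn : 2 ≤ n) :
    ∃ C : ℝ, 0 < C ∧
      ∀ (μ : Measure (XQuot n)), IsProbabilityMeasure μ →
        (∀ g : SLR n, Measure.map (fun x => g • x) μ = μ) →
        ∀ R : ℝ, 0 < R →
          μ (QuotientGroup.mk '' {g : SLR n | R < covRad n (simplexStd n) (latticeOf g)})
            < ENNReal.ofReal (C / R ^ n) := by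
  obtain ⟨m, rfl⟩ := Nat.exists_eq_add_of_le' hn
  obtain ⟨c, hc, hmain⟩ := exists_const_measure_le (m + 1)
  set b : ℝ := 2 * (2 * (m + 2 : ℕ) * 2 ^ (m + 2))
  set D : ENNReal := c * (ENNReal.ofReal (b ^ (m + 2)) * volume (reducedSet m))
  have hD : D ≠ ⊤ := ENNReal.mul_ne_top hc
    (ENNReal.mul_ne_top ENNReal.ofReal_ne_top (volume_reducedSet_lt_top m).ne)
  refine ⟨D.toReal + 1, by positivity, fun μ hμ hinv R hR => ?_⟩
  set r : ℝ := 2 * (m + 2 : ℕ) * 2 ^ (m + 2) / R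
  have hb : 2 * r = b * R⁻¹ := by simp only [r, b]; ring
  calc _ ≤ c * volume (stepSet r (reducedSet m)) :=
        hmain μ hμ hinv _ (measurableSet_stepSet _ (measurableSet_reducedSet m))
          (fun t ht M hM => smul_last_mem_stepSet ht (smul_last_mem_reducedSet ht m) hM) _
          (image_setOf_lt_covRad_subset hR)
    _ ≤ c * (ENNReal.ofReal (2 * r) ^ (m + 2) * volume (reducedSet m)) := by
        gcongr
        exact volume_stepSet_le (by positivity) (measurableSet_reducedSet m)
    _ = D * ENNReal.ofReal (R⁻¹ ^ (m + 2)) := by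
        rw [hb, ← ENNReal.ofReal_pow (by positivity), mul_pow, ENNReal.ofReal_mul (by positivity)]
        simp only [D]
        ring
    _ < ENNReal.ofReal (D.toReal + 1) * ENNReal.ofReal (R⁻¹ ^ (m + 2)) := by
        refine ENNReal.mul_lt_mul_left (ENNReal.ofReal_pos.2 (by positivity)).ne'
          ENNReal.ofReal_ne_top ?_
        rw [ENNReal.lt_ofReal_iff_toReal_lt hD]
        exact lt_add_one _
    _ = ENNReal.ofReal ((D.toReal + 1) / R ^ (m + 2)) := by
        rw [← ENNReal.ofReal_mul (by positivity), inv_pow, div_eq_mul_inv]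
end
end

section
/- For every integer n ≥ 2, the function SL_n(ℝ) → ℝ given by g ↦ Q(Δ_n, g·ℤ^n) (the covering radius of the standard simplex with respect to the unimodular lattice g·ℤ^n) is continuous; equivalently, the covering-radius function Q₀ is continuous on the space of unimodular lattices SL_n(ℝ)/SL_n(ℤ). -/
noncomputable section

open MeasureTheory Matrix Pointwise

/-- The set of `t > 0` for which `t • Δ_n` together with its `g·ℤ^n`-translates covers `ℝ^n`. -/
def coveringScales {n : ℕ} (g : SLR n) : Set ℝ :=
  {t : ℝ | 0 < t ∧ ∀ x : Fin n → ℝ, ∃ k ∈ simplexStd n, ∃ l ∈ latticeOf g, x = t • k + l}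

/-- The entrywise `ℓ¹` distance of a matrix to the identity. -/
def entrywiseDistOne {n : ℕ} (M : Matrix (Fin n) (Fin n) ℝ) : ℝ :=
  ∑ i, ∑ j, |(M - 1) i j|

/-- A factor by which `Δ_n` may be scaled so that a translate of it contains `M Δ_n`. -/
def simplexDilation {n : ℕ} (M : Matrix (Fin n) (Fin n) ℝ) : ℝ :=
  1 + (n + 1) * entrywiseDistOne M

lemma entrywiseDistOne_nonneg {n : ℕ} (M : Matrix (Fin n) (Fin n) ℝ) :
    0 ≤ entrywiseDistOne M :=
  Finset.sum_nonneg fun _ _ => Finset.sum_nonneg fun _ _ => abs_nonneg _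

lemma simplexDilation_pos {n : ℕ} (M : Matrix (Fin n) (Fin n) ℝ) : 0 < simplexDilation M := by
  have := entrywiseDistOne_nonneg M
  unfold simplexDilation
  positivity

lemma simplexDilation_one (n : ℕ) : simplexDilation (1 : Matrix (Fin n) (Fin n) ℝ) = 1 := by
  simp [simplexDilation, entrywiseDistOne]

lemma continuous_simplexDilation (n : ℕ) :
    Continuous (simplexDilation : Matrix (Fin n) (Fin n) ℝ → ℝ) := by
  have hentry (i j : Fin n) : Continuous fun M : Matrix (Fin n) (Fin n) ℝ => (M - 1) i j :=
    (continuous_id.sub continuous_const).matrix_elem i j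
  unfold simplexDilation entrywiseDistOne
  exact continuous_const.add (continuous_const.mul (continuous_finsetSum _ fun i _ =>
    continuous_finsetSum _ fun j _ => (hentry i j).abs))

lemma sum_abs_mulVec_sub_le {n : ℕ} (M : Matrix (Fin n) (Fin n) ℝ) {k : Fin n → ℝ}
    (hk : k ∈ simplexStd n) : ∑ i, |(M *ᵥ k) i - k i| ≤ entrywiseDistOne M := by
  refine Finset.sum_le_sum fun i _ => ?_
  have hsub : (M *ᵥ k) i - k i = ∑ j, (M - 1) i j * k j := by
    have : (M *ᵥ k) i - k i = ((M - 1) *ᵥ k) i := by simp [Matrix.sub_mulVec]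
    rw [this]
    rfl
  rw [hsub]
  refine (Finset.abs_sum_le_sum_abs _ _).trans (Finset.sum_le_sum fun j _ => ?_)
  have hj : k j ≤ 1 :=
    (Finset.single_le_sum (fun i _ => hk.1 i) (Finset.mem_univ j)).trans hk.2
  rw [abs_mul, abs_of_nonneg (hk.1 j)]
  exact mul_le_of_le_one_right (abs_nonneg _) hj

lemma exists_mulVec_eq_smul_simplexStd {n : ℕ} (M : Matrix (Fin n) (Fin n) ℝ) {k : Fin n → ℝ}
    (hk : k ∈ simplexStd n) :
    ∃ k' ∈ simplexStd n, M *ᵥ k + (fun _ => entrywiseDistOne M) = simplexDilation M • k' := by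
  have hE := simplexDilation_pos M
  have hsum := sum_abs_mulVec_sub_le M hk
  refine ⟨(simplexDilation M)⁻¹ • (M *ᵥ k + fun _ => entrywiseDistOne M), ⟨fun i => ?_, ?_⟩, ?_⟩
  · have hi := (Finset.single_le_sum (fun i _ => abs_nonneg ((M *ᵥ k) i - k i))
      (Finset.mem_univ i)).trans hsum
    have := (abs_le.1 hi).1
    have hki := hk.1 i
    have : 0 ≤ (M *ᵥ k) i + entrywiseDistOne M := by linarith
    simp only [Pi.smul_apply, Pi.add_apply, smul_eq_mul]
    positivity
  · simp only [Pi.smul_apply, Pi.add_apply, smul_eq_mul]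
    rw [← Finset.mul_sum, inv_mul_le_one₀ hE, Finset.sum_add_distrib]
    have hle : ∑ i, (M *ᵥ k) i - ∑ i, k i ≤ ∑ i, |(M *ᵥ k) i - k i| := by
      rw [← Finset.sum_sub_distrib]
      exact Finset.sum_le_sum fun i _ => le_abs_self _
    have := hk.2
    simp only [Finset.sum_const, Finset.card_univ, Fintype.card_fin, nsmul_eq_mul, simplexDilation]
    linarith
  · rw [smul_inv_smul₀ hE.ne']

lemma simplexDilation_mul_mem_coveringScales {n : ℕ} (h g : SLR n) {t : ℝ}
    (ht : t ∈ coveringScales g) :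
    simplexDilation (h : Matrix (Fin n) (Fin n) ℝ) * t ∈ coveringScales (h * g) := by
  refine ⟨mul_pos (simplexDilation_pos _) ht.1, fun x => ?_⟩
  set c : Fin n → ℝ := fun _ => entrywiseDistOne (h : Matrix (Fin n) (Fin n) ℝ)
  obtain ⟨k, hk, _, ⟨v, rfl⟩, hx⟩ := ht.2 ((h⁻¹ : SLR n).1 *ᵥ (x - t • c))
  obtain ⟨k', hk', hkk'⟩ := exists_mulVec_eq_smul_simplexStd h.1 hk
  refine ⟨k', hk', _, ⟨v, rfl⟩, ?_⟩
  have hinv : h.1 * (h⁻¹ : SLR n).1 = 1 := by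
    rw [← Matrix.SpecialLinearGroup.coe_mul, mul_inv_cancel, Matrix.SpecialLinearGroup.coe_one]
  have hx' := congrArg (h.1 *ᵥ ·) hx
  simp only [Matrix.mulVec_mulVec, hinv, Matrix.one_mulVec, Matrix.mulVec_add,
    Matrix.mulVec_smul] at hx'
  rw [mul_comm, mul_smul, ← hkk', smul_add, Matrix.SpecialLinearGroup.coe_mul]
  linear_combination hx'

lemma covRad_mul_le {n : ℕ} (h g : SLR n) :
    covRad n (simplexStd n) (latticeOf (h * g)) ≤
      simplexDilation (h : Matrix (Fin n) (Fin n) ℝ) * covRad n (simplexStd n) (latticeOf g) := by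
  change sInf (coveringScales (h * g)) ≤ _ * sInf (coveringScales g)
  have hE := simplexDilation_pos (h : Matrix (Fin n) (Fin n) ℝ)
  have hbdd : BddBelow (coveringScales (h * g)) := ⟨0, fun t ht => ht.1.le⟩
  rcases (coveringScales g).eq_empty_or_nonempty with hg | hg
  · have hhg : coveringScales (h * g) = ∅ := by
      refine Set.eq_empty_iff_forall_notMem.2 fun t ht => ?_
      have := simplexDilation_mul_mem_coveringScales h⁻¹ (h * g) ht
      rw [inv_mul_cancel_left, hg] at this
      exact this
    simp [hg, hhg]
  · rw [← div_le_iff₀' hE]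
    refine le_csInf hg fun t ht => ?_
    rw [div_le_iff₀' hE]
    exact csInf_le hbdd (simplexDilation_mul_mem_coveringScales h g ht)

/-- The covering-radius function `g ↦ Q(Δ_n, g·ℤ^n)` is continuous on `SL_n(ℝ)`;
equivalently `Q₀` is continuous on the space of unimodular lattices. -/
theorem coveringRadius_continuous (n : ℕ) (hn : 2 ≤ n) :
    Continuous fun g : SLR n => covRad n (simplexStd n) (latticeOf g) := by
  have hcoe : Continuous fun g : SLR n => (g : Matrix (Fin n) (Fin n) ℝ) :=
    continuous_induced_dom
  refine continuous_iff_continuousAt.2 fun g₀ => ?_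
  have hupper : Filter.Tendsto
      (fun g : SLR n => simplexDilation ((g * g₀⁻¹ : SLR n) : Matrix (Fin n) (Fin n) ℝ) *
        covRad n (simplexStd n) (latticeOf g₀)) (nhds g₀)
      (nhds (covRad n (simplexStd n) (latticeOf g₀))) := by
    have hcont : Continuous fun g : SLR n =>
        simplexDilation ((g * g₀⁻¹ : SLR n) : Matrix (Fin n) (Fin n) ℝ) := by
      simp only [Matrix.SpecialLinearGroup.coe_mul]
      exact (continuous_simplexDilation n).comp (hcoe.mul continuous_const)
    have := (hcont.tendsto g₀).mul_const (covRad n (simplexStd n) (latticeOf g₀))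
    simpa only [mul_inv_cancel, Matrix.SpecialLinearGroup.coe_one, simplexDilation_one,
      one_mul] using this
  have hlower : Filter.Tendsto
      (fun g : SLR n => (simplexDilation ((g₀ * g⁻¹ : SLR n) : Matrix (Fin n) (Fin n) ℝ))⁻¹ *
        covRad n (simplexStd n) (latticeOf g₀)) (nhds g₀)
      (nhds (covRad n (simplexStd n) (latticeOf g₀))) := by
    have hcont : Continuous fun g : SLR n =>
        (simplexDilation ((g₀ * g⁻¹ : SLR n) : Matrix (Fin n) (Fin n) ℝ))⁻¹ := by
      simp only [Matrix.SpecialLinearGroup.coe_mul, Matrix.SpecialLinearGroup.coe_inv]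
      exact ((continuous_simplexDilation n).comp
        (continuous_const.mul hcoe.matrix_adjugate)).inv₀ fun g => (simplexDilation_pos _).ne'
    have := (hcont.tendsto g₀).mul_const (covRad n (simplexStd n) (latticeOf g₀))
    simpa only [mul_inv_cancel, Matrix.SpecialLinearGroup.coe_one, simplexDilation_one,
      inv_one, one_mul] using this
  refine tendsto_of_tendsto_of_tendsto_of_le_of_le hlower hupper (fun g => ?_) (fun g => ?_)
  · refine (inv_mul_le_iff₀ (simplexDilation_pos _)).2 ?_
    simpa only [inv_mul_cancel_right] using covRad_mul_le (g₀ * g⁻¹) g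
  · simpa only [inv_mul_cancel_right] using covRad_mul_le (g * g₀⁻¹) g₀
end
end

section
/- For every integer n ≥ 2, every SL_n(ℝ)-invariant Borel probability measure μ on X = SL_n(ℝ)/SL_n(ℤ), and every real R > 0, the level set of the covering-radius function has measure zero: μ({⟦g⟧ ∈ X : Q(Δ_n, g·ℤ^n) = R}) = 0. Consequently the limit distribution function R ↦ μ(E_R), with E_R = {⟦g⟧ : Q(Δ_n, g·ℤ^n) ≤ R}, is continuous in R. -/
noncomputable section

open MeasureTheory Matrix Pointwise

open Set Filter Topology

section CoveringRadius

variable {n : ℕ}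

/-- The scale `t` is admissible for the covering radius when `t Δ + L` is everything. -/
def IsCoveringScale (L : Set (Fin n → ℝ)) (t : ℝ) : Prop :=
  0 < t ∧ ∀ x : Fin n → ℝ, ∃ l ∈ L, (∀ i, l i ≤ x i) ∧ ∑ i, (x i - l i) ≤ t

theorem covering_simplexStd_iff {L : Set (Fin n → ℝ)} {t : ℝ} :
    (0 < t ∧ ∀ x : Fin n → ℝ, ∃ k ∈ simplexStd n, ∃ l ∈ L, x = t • k + l) ↔
      IsCoveringScale L t := by
  refine and_congr_right fun ht => forall_congr' fun x => ⟨?_, ?_⟩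
  · rintro ⟨k, ⟨hk0, hk1⟩, l, hl, rfl⟩
    refine ⟨l, hl, fun i => ?_, ?_⟩
    · simpa using mul_nonneg ht.le (hk0 i)
    · simp only [Pi.add_apply, Pi.smul_apply, smul_eq_mul, add_sub_cancel_right, ← Finset.mul_sum]
      nlinarith
  · rintro ⟨l, hl, h0, h1⟩
    refine ⟨t⁻¹ • (x - l), ⟨fun i => ?_, ?_⟩, l, hl, ?_⟩
    · have := h0 i
      simp only [Pi.smul_apply, Pi.sub_apply, smul_eq_mul]
      exact mul_nonneg (inv_nonneg.2 ht.le) (by linarith)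
    · simp only [Pi.smul_apply, Pi.sub_apply, smul_eq_mul, ← Finset.mul_sum]
      rw [inv_mul_le_iff₀ ht]
      linarith
    · rw [smul_inv_smul₀ ht.ne']
      abel

theorem covRad_simplexStd_eq (L : Set (Fin n → ℝ)) :
    covRad n (simplexStd n) L = sInf {t | IsCoveringScale L t} := by
  unfold covRad
  congr 1
  ext t
  exact covering_simplexStd_iff

theorem bddBelow_setOf_isCoveringScale (L : Set (Fin n → ℝ)) :
    BddBelow {t | IsCoveringScale L t} := ⟨0, fun _ ht => ht.1.le⟩

theorem covRad_le_of_isCoveringScale {L : Set (Fin n → ℝ)} {t : ℝ} (ht : IsCoveringScale L t) :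
    covRad n (simplexStd n) L ≤ t := by
  rw [covRad_simplexStd_eq]
  exact csInf_le (bddBelow_setOf_isCoveringScale L) ht

theorem mem_latticeOf_iff {g : SLR n} {x : Fin n → ℝ} :
    x ∈ latticeOf g ↔ ∃ v : Fin n → ℤ, x = (g : Matrix (Fin n) (Fin n) ℝ).mulVec fun i => (v i : ℝ) :=
  Iff.rfl

theorem add_mem_latticeOf {g : SLR n} {x y : Fin n → ℝ} (hx : x ∈ latticeOf g)
    (hy : y ∈ latticeOf g) : x + y ∈ latticeOf g := by
  obtain ⟨v, rfl⟩ := hx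
  obtain ⟨w, rfl⟩ := hy
  refine ⟨v + w, ?_⟩
  rw [← Matrix.mulVec_add]
  congr 1
  ext i
  simp

theorem inv_mulVec_mulVec (g : SLR n) (x : Fin n → ℝ) :
    ((g⁻¹ : SLR n) : Matrix (Fin n) (Fin n) ℝ).mulVec
      ((g : Matrix (Fin n) (Fin n) ℝ).mulVec x) = x := by
  rw [Matrix.mulVec_mulVec, ← Matrix.SpecialLinearGroup.coe_mul, inv_mul_cancel,
    Matrix.SpecialLinearGroup.coe_one, Matrix.one_mulVec]

theorem mulVec_inv_mulVec (g : SLR n) (x : Fin n → ℝ) :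
    (g : Matrix (Fin n) (Fin n) ℝ).mulVec
      (((g⁻¹ : SLR n) : Matrix (Fin n) (Fin n) ℝ).mulVec x) = x := by
  simpa using inv_mulVec_mulVec g⁻¹ x

theorem abs_mulVec_le (M : Matrix (Fin n) (Fin n) ℝ) {x : Fin n → ℝ} {C : ℝ}
    (hx : ∀ i, |x i| ≤ C) (i : Fin n) : |M.mulVec x i| ≤ (∑ i, ∑ j, |M i j|) * C := by
  have hC : 0 ≤ C := (abs_nonneg _).trans (hx i)
  calc |M.mulVec x i| ≤ ∑ j, |M i j * x j| := by
        rw [Matrix.mulVec, dotProduct]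
        exact Finset.abs_sum_le_sum_abs _ _
    _ ≤ ∑ j, |M i j| * C := Finset.sum_le_sum fun j _ => by
        rw [abs_mul]
        exact mul_le_mul_of_nonneg_left (hx j) (abs_nonneg _)
    _ = (∑ j, |M i j|) * C := by rw [Finset.sum_mul]
    _ ≤ _ := mul_le_mul_of_nonneg_right
        (Finset.single_le_sum (f := fun i => ∑ j, |M i j|)
          (fun i _ => Finset.sum_nonneg fun j _ => abs_nonneg _) (Finset.mem_univ i)) hC

theorem finite_latticeOf_inter_bounded (g : SLR n) (C : ℝ) :
    {l ∈ latticeOf g | ∀ i, |l i| ≤ C}.Finite := by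
  set D := (∑ i, ∑ j, |((g⁻¹ : SLR n) : Matrix (Fin n) (Fin n) ℝ) i j|) * C
  refine ((Set.finite_Icc (fun _ : Fin n => -⌈D⌉) (fun _ => ⌈D⌉)).image
    fun v => (g : Matrix (Fin n) (Fin n) ℝ).mulVec fun i => (v i : ℝ)).subset ?_
  rintro _ ⟨⟨v, rfl⟩, hv⟩
  refine ⟨v, ?_, rfl⟩
  have h := abs_mulVec_le ((g⁻¹ : SLR n) : Matrix (Fin n) (Fin n) ℝ) hv
  rw [inv_mulVec_mulVec] at h
  refine ⟨fun i => ?_, fun i => ?_⟩ <;> have h1 := abs_le.1 (h i) <;> have h2 := Int.le_ceil D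
  · exact_mod_cast (by push_cast; linarith : ((-⌈D⌉ : ℤ) : ℝ) ≤ v i)
  · exact_mod_cast (by linarith : (v i : ℝ) ≤ ⌈D⌉)

/-- Lattice points bounded above, with coordinate sum bounded below, form a finite set. -/
theorem finite_latticeOf_le_sum (g : SLR n) (a c : ℝ) :
    {l ∈ latticeOf g | (∀ i, l i ≤ a) ∧ c ≤ ∑ i, l i}.Finite := by
  refine (finite_latticeOf_inter_bounded g (|c| + n * |a|)).subset ?_
  rintro l ⟨hl, h1, h2⟩
  refine ⟨hl, fun i => abs_le.2 ⟨?_, ?_⟩⟩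
  · have h3 : ∑ j, l j ≤ l i + ∑ j ∈ Finset.univ.erase i, |a| := by
      rw [← Finset.add_sum_erase _ _ (Finset.mem_univ i)]
      gcongr with j
      exact (h1 j).trans (le_abs_self a)
    have h4 : ∑ j ∈ Finset.univ.erase i, |a| ≤ ∑ _j : Fin n, |a| :=
      Finset.sum_le_sum_of_subset_of_nonneg (Finset.erase_subset _ _) fun _ _ _ => abs_nonneg a
    rw [Finset.sum_const (s := Finset.univ), Finset.card_univ, Fintype.card_fin, nsmul_eq_mul] at h4
    have := neg_abs_le c
    linarith
  · have h3 : (1 : ℝ) ≤ n := by exact_mod_cast i.pos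
    nlinarith [h1 i, le_abs_self a, abs_nonneg a, abs_nonneg c]

theorem exists_isCoveringScale (g : SLR n) : ∃ t, IsCoveringScale (latticeOf g) t := by
  set C := ∑ i, ∑ j, |(g : Matrix (Fin n) (Fin n) ℝ) i j|
  have hC : 0 ≤ C := Finset.sum_nonneg fun i _ => Finset.sum_nonneg fun j _ => abs_nonneg _
  refine ⟨n * (2 * C) + 1, by positivity, fun x => ?_⟩
  set z : Fin n → ℝ := fun i => x i - C
  set y := ((g⁻¹ : SLR n) : Matrix (Fin n) (Fin n) ℝ).mulVec z
  set l := (g : Matrix (Fin n) (Fin n) ℝ).mulVec fun i => ((⌊y i⌋ : ℤ) : ℝ)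
  have hd : ∀ i, |z i - l i| ≤ C := by
    intro i
    have h := abs_mulVec_le (g : Matrix (Fin n) (Fin n) ℝ) (x := fun i => Int.fract (y i)) (C := 1)
      (fun i => by rw [abs_of_nonneg (Int.fract_nonneg _)]; exact (Int.fract_lt_one _).le) i
    have e : (g : Matrix (Fin n) (Fin n) ℝ).mulVec (fun i => Int.fract (y i)) = z - l := by
      have : (fun i => Int.fract (y i)) = y - fun i => ((⌊y i⌋ : ℤ) : ℝ) := rfl
      rw [this, Matrix.mulVec_sub, mulVec_inv_mulVec]
    rw [e, mul_one] at h
    exact h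
  refine ⟨l, ⟨_, rfl⟩, fun i => ?_, ?_⟩
  · have := (abs_le.1 (hd i)).1
    simp only [z] at this
    linarith
  · calc ∑ i, (x i - l i) ≤ ∑ _i : Fin n, (2 * C) := Finset.sum_le_sum fun i _ => by
          have := (abs_le.1 (hd i)).2
          simp only [z] at this
          linarith
      _ ≤ _ := by simp

theorem exists_isCoveringScale_lt {g : SLR n} {R : ℝ}
    (h : covRad n (simplexStd n) (latticeOf g) < R) :
    ∃ t < R, IsCoveringScale (latticeOf g) t := by
  rw [covRad_simplexStd_eq] at h
  obtain ⟨t, ht, htR⟩ := exists_lt_of_csInf_lt (exists_isCoveringScale g) h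
  exact ⟨t, htR, ht⟩

theorem covRad_simplexStd_pos (hn : 0 < n) (g : SLR n) :
    0 < covRad n (simplexStd n) (latticeOf g) := by
  obtain ⟨r, hr0, hr⟩ : ∃ r > 0, ∀ l ∈ latticeOf g, (∀ i, |l i| ≤ r) → l = 0 := by
    have hfin := finite_latticeOf_inter_bounded g 1
    have hev : ∀ᶠ r in 𝓝[>] (0 : ℝ), ∀ l ∈ {l ∈ latticeOf g | ∀ i, |l i| ≤ 1},
        (∀ i, |l i| ≤ r) → l = 0 := by
      refine (Filter.eventually_all_finite hfin).2 fun l _ => ?_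
      by_cases hl : l = 0
      · exact Eventually.of_forall fun _ _ => hl
      · obtain ⟨i, hi⟩ := Function.ne_iff.1 hl
        filter_upwards [nhdsWithin_le_nhds (Iio_mem_nhds (abs_pos.2 hi))] with r hr h
        exact absurd (h i) (not_le.2 hr)
    obtain ⟨r, hr, hr0, hr1⟩ := (hev.and (Ioc_mem_nhdsGT one_pos)).exists
    exact ⟨r, hr0, fun l hl h => hr l ⟨hl, fun i => (h i).trans hr1⟩ h⟩
  refine lt_of_lt_of_le (half_pos hr0) ?_
  rw [covRad_simplexStd_eq]
  refine le_csInf (exists_isCoveringScale g) fun t ht => ?_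
  by_contra! htr
  obtain ⟨l, hl, h1, h2⟩ := ht.2 fun _ => -(r / 2)
  have h3 : ∀ i, |l i| ≤ r := fun i => by
    have h4 : -(r / 2) - l i ≤ ∑ j, (-(r / 2) - l j) :=
      Finset.single_le_sum (f := fun j => -(r / 2) - l j)
        (fun j _ => by linarith [h1 j]) (Finset.mem_univ i)
    have := h1 i
    exact abs_le.2 ⟨by linarith, by linarith⟩
  have h5 := h1 ⟨0, hn⟩
  rw [hr l hl h3] at h5
  simp only [Pi.zero_apply] at h5
  linarith

/-- The nonnegative points strictly above no lattice point of positive coordinate sum. -/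
def uncoveredRegion (L : Set (Fin n → ℝ)) : Set (Fin n → ℝ) :=
  {x | (∀ i, 0 ≤ x i) ∧ ∀ l ∈ L, (∀ i, l i < x i) → ∑ i, l i ≤ 0}

theorem isClosed_uncoveredRegion (L : Set (Fin n → ℝ)) : IsClosed (uncoveredRegion L) := by
  have : uncoveredRegion L = (⋂ i, {x | 0 ≤ x i}) ∩
      ⋂ l ∈ {l ∈ L | 0 < ∑ i, l i}, (⋂ i, {x : Fin n → ℝ | l i < x i})ᶜ := by
    ext x
    simp only [uncoveredRegion, mem_ofPred_eq, mem_inter_iff, mem_iInter, mem_compl_iff, and_imp]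
    refine and_congr_right fun _ => forall₂_congr fun l _ => ?_
    rw [← not_lt]
    tauto
  rw [this]
  refine (isClosed_iInter fun i => isClosed_le continuous_const (continuous_apply i)).inter
    (isClosed_biInter fun _ _ => IsOpen.isClosed_compl ?_)
  exact isOpen_iInter_of_finite fun i => isOpen_lt continuous_const (continuous_apply i)

theorem sum_le_covRad_of_mem_uncoveredRegion {g : SLR n} {x : Fin n → ℝ}
    (hx : x ∈ uncoveredRegion (latticeOf g)) :
    ∑ i, x i ≤ covRad n (simplexStd n) (latticeOf g) := by
  rw [covRad_simplexStd_eq]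
  refine le_csInf (exists_isCoveringScale g) fun t ht => ?_
  have key : ∀ ε > 0, ∑ i, x i ≤ t + n * ε := by
    intro ε hε
    obtain ⟨l, hl, h1, h2⟩ := ht.2 fun i => x i - ε
    have h3 := hx.2 l hl fun i => (h1 i).trans_lt (by linarith)
    simp only [Finset.sum_sub_distrib, Finset.sum_const, Finset.card_univ, Fintype.card_fin,
      nsmul_eq_mul] at h2
    linarith
  refine ge_of_tendsto (x := 𝓝[>] (0 : ℝ)) (f := fun ε => t + n * ε) ?_
    (by filter_upwards [self_mem_nhdsWithin] with ε hε using key ε hε)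
  refine tendsto_nhdsWithin_of_tendsto_nhds ?_
  have : ContinuousAt (fun ε : ℝ => t + n * ε) 0 := by fun_prop
  simpa [ContinuousAt] using this

theorem isCompact_uncoveredRegion (g : SLR n) :
    IsCompact (uncoveredRegion (latticeOf g)) := by
  refine (isCompact_Icc (a := (0 : Fin n → ℝ))
    (b := fun _ => covRad n (simplexStd n) (latticeOf g))).of_isClosed_subset
    (isClosed_uncoveredRegion _) fun x hx => ⟨hx.1, fun i => ?_⟩
  exact (Finset.single_le_sum (f := x) (fun j _ => hx.1 j) (Finset.mem_univ i)).trans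
    (sum_le_covRad_of_mem_uncoveredRegion hx)

theorem zero_mem_uncoveredRegion (L : Set (Fin n → ℝ)) : 0 ∈ uncoveredRegion L :=
  ⟨fun _ => le_rfl, fun _ _ h => Finset.sum_nonpos fun i _ => (h i).le⟩

/-- Every point is a lattice translate of a point of the uncovered region. -/
theorem exists_sub_mem_uncoveredRegion (g : SLR n) (y : Fin n → ℝ) :
    ∃ l ∈ latticeOf g, y - l ∈ uncoveredRegion (latticeOf g) := by
  obtain ⟨t, ht⟩ := exists_isCoveringScale g
  obtain ⟨l₁, hl₁, h1, -⟩ := ht.2 y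
  obtain ⟨a, ha⟩ : ∃ a, ∀ i, y i ≤ a := by
    obtain ⟨a, ha⟩ := (Set.finite_range y).bddAbove
    exact ⟨a, fun i => ha ⟨i, rfl⟩⟩
  have hfin : {l ∈ latticeOf g | (∀ i, l i ≤ y i) ∧ ∑ i, l₁ i ≤ ∑ i, l i}.Finite :=
    (finite_latticeOf_le_sum g a (∑ i, l₁ i)).subset
      fun _ hl => ⟨hl.1, fun i => (hl.2.1 i).trans (ha i), hl.2.2⟩
  obtain ⟨l, ⟨hl, hly, hl₁l⟩, hmax⟩ :=
    Set.exists_max_image _ (fun l : Fin n → ℝ => ∑ i, l i) hfin ⟨l₁, hl₁, h1, le_rfl⟩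
  refine ⟨l, hl, fun i => sub_nonneg.2 (hly i), fun m hm hmy => ?_⟩
  by_contra! hpos
  have hsum : ∑ i, (m + l) i = ∑ i, m i + ∑ i, l i := by simp [Finset.sum_add_distrib]
  have := hmax (m + l) ⟨add_mem_latticeOf hm hl, fun i => ?_, by linarith⟩
  · linarith
  · have := hmy i
    simp only [Pi.sub_apply] at this
    simp only [Pi.add_apply]
    linarith

theorem exists_mem_uncoveredRegion_sum_eq_covRad (hn : 0 < n) (g : SLR n) :
    ∃ x ∈ uncoveredRegion (latticeOf g),
      (∀ y ∈ uncoveredRegion (latticeOf g), ∑ i, y i ≤ ∑ i, x i) ∧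
      ∑ i, x i = covRad n (simplexStd n) (latticeOf g) := by
  obtain ⟨x, hx, hmax⟩ := (isCompact_uncoveredRegion g).exists_isMaxOn
    ⟨0, zero_mem_uncoveredRegion _⟩ (f := fun x => ∑ i, x i) (by fun_prop)
  refine ⟨x, hx, hmax, (sum_le_covRad_of_mem_uncoveredRegion hx).antisymm ?_⟩
  have hpos := covRad_simplexStd_pos hn g
  have key : ∀ t, 0 < t → ∑ i, x i ≤ t → covRad n (simplexStd n) (latticeOf g) ≤ t := by
    refine fun t ht hxt => covRad_le_of_isCoveringScale ⟨ht, fun y => ?_⟩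
    obtain ⟨l, hl, hyl⟩ := exists_sub_mem_uncoveredRegion g y
    exact ⟨l, hl, fun i => sub_nonneg.1 (hyl.1 i), (hmax hyl).trans hxt⟩
  by_contra! hlt
  have h1 := key (max (∑ i, x i) (covRad n (simplexStd n) (latticeOf g) / 2))
    (lt_max_of_lt_right (half_pos hpos)) (le_max_left _ _)
  rcases le_max_iff.1 h1 with h | h <;> linarith

/-- The covering radius is a trace `tr (g V)` with `V` an integer matrix. -/
theorem exists_int_trace_eq_covRad (hn : 0 < n) (g : SLR n) :
    ∃ V : Matrix (Fin n) (Fin n) ℤ,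
      ((g : Matrix (Fin n) (Fin n) ℝ) * V.map (Int.cast : ℤ → ℝ)).trace =
        covRad n (simplexStd n) (latticeOf g) := by
  obtain ⟨x, hx, hmax, hsum⟩ := exists_mem_uncoveredRegion_sum_eq_covRad hn g
  have key : ∀ i, ∃ l ∈ latticeOf g, l i = x i := by
    intro i
    obtain ⟨a, ha⟩ : ∃ a, ∀ i, x i + 1 ≤ a := by
      obtain ⟨a, ha⟩ := (Set.finite_range fun i => x i + 1).bddAbove
      exact ⟨a, fun i => ha ⟨i, rfl⟩⟩
    set F := {l ∈ latticeOf g | (∀ i, l i ≤ a) ∧ 0 ≤ ∑ i, l i}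
    have hF : F.Finite := finite_latticeOf_le_sum g a 0
    have hex : ∀ ε > 0, ε ≤ 1 → ∃ l ∈ F, x i ≤ l i ∧ l i < x i + ε := by
      intro ε hε hε1
      have hnot : x + Pi.single i ε ∉ uncoveredRegion (latticeOf g) := fun h => by
        have := hmax _ h
        simp [Finset.sum_add_distrib] at this
        linarith
      have h0 : ∀ j, 0 ≤ (x + Pi.single i ε : Fin n → ℝ) j := fun j =>
        by
        have h2 : (0 : Fin n → ℝ) ≤ Pi.single i ε := Pi.single_nonneg.2 hε.le
        exact add_nonneg (hx.1 j) (h2 j)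
      simp only [uncoveredRegion, mem_ofPred_eq, not_and, not_forall, not_le] at hnot
      obtain ⟨l, hl, hlx, hlpos⟩ := hnot h0
      have hne : ∀ j, j ≠ i → l j < x j := fun j hj => by simpa [hj] using hlx j
      have hi : l i < x i + ε := by simpa using hlx i
      refine ⟨l, ⟨hl, fun j => ?_, hlpos.le⟩, ?_, hi⟩
      · by_cases hj : j = i
        · subst hj; linarith [ha j]
        · linarith [hne j hj, ha j]
      · by_contra! hlt
        refine absurd (hx.2 l hl fun j => ?_) (not_le.2 hlpos)
        by_cases hj : j = i
        · exact hj ▸ hlt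
        · exact hne j hj
    by_contra! hcon
    have hev : ∀ᶠ ε in 𝓝[>] (0 : ℝ), ∀ l ∈ F, ¬ (x i ≤ l i ∧ l i < x i + ε) := by
      refine (Filter.eventually_all_finite hF).2 fun l hl => ?_
      rcases (hcon l hl.1).lt_or_gt with h | h
      · exact Eventually.of_forall fun ε hh => absurd hh.1 (not_le.2 h)
      · filter_upwards [nhdsWithin_le_nhds (Iio_mem_nhds (sub_pos.2 h))] with ε hε hh
        have hε' : ε < l i - x i := hε
        linarith [hh.2]
    obtain ⟨ε, h, hε0, hε1⟩ := (hev.and (Ioc_mem_nhdsGT one_pos)).exists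
    obtain ⟨l, hl, hh⟩ := hex ε hε0 hε1
    exact h l hl hh
  choose l hl hlx using key
  choose v hv using fun i => mem_latticeOf_iff.1 (hl i)
  refine ⟨Matrix.of fun j i => v i j, ?_⟩
  rw [← hsum, Matrix.trace]
  refine Finset.sum_congr rfl fun i _ => ?_
  rw [← hlx i, hv i]
  simp [Matrix.mul_apply, Matrix.mulVec, dotProduct]

end CoveringRadius

section UnimodularLattices

variable {n : ℕ}

instance : IsTopologicalGroup (SLR n) :=
  Matrix.SpecialLinearGroup.topologicalGroup

instance : BorelSpace (XQuot n) := ⟨rfl⟩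

theorem isClosedEmbedding_coe_SLR :
    IsClosedEmbedding ((↑) : SLR n → Matrix (Fin n) (Fin n) ℝ) :=
  Matrix.SpecialLinearGroup.isClosedEmbedding_val

instance : SigmaCompactSpace (SLR n) :=
  have : SigmaCompactSpace (Matrix (Fin n) (Fin n) ℝ) :=
    inferInstanceAs (SigmaCompactSpace (Fin n → Fin n → ℝ))
  isClosedEmbedding_coe_SLR.sigmaCompactSpace

theorem isClosed_SLZsub : IsClosed (SLZsub n : Set (SLR n)) := by
  have h : IsClosedEmbedding (Int.castRingHom ℝ) := Int.isClosedEmbedding_coe_real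
  have := h.specialLinearGroup_map (n := Fin n)
  exact this.isClosed_range

theorem isClosed_mk_image_of_isCompact {K : Set (SLR n)} (hK : IsCompact K) :
    IsClosed (QuotientGroup.mk '' K : Set (XQuot n)) := by
  rw [← (QuotientGroup.isQuotientMap_mk (SLZsub n)).isClosed_preimage,
    QuotientGroup.preimage_image_mk_eq_mul]
  exact isClosed_SLZsub.mul_left_of_isCompact hK

theorem measurableSet_mk_image_of_isClosed {F : Set (SLR n)} (hF : IsClosed F) :
    MeasurableSet (QuotientGroup.mk '' F : Set (XQuot n)) := by
  have : F = ⋃ k, F ∩ compactCovering (SLR n) k := by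
    rw [← inter_iUnion, iUnion_compactCovering, inter_univ]
  rw [this, image_iUnion]
  exact MeasurableSet.iUnion fun k =>
    (isClosed_mk_image_of_isCompact ((isCompact_compactCovering _ k).inter_left hF)).measurableSet

/-- If almost every orbit under a curve in the group avoids a measurable set for almost every
time, then the set is null for every invariant measure. -/
theorem measure_eq_zero_of_curve {μ : Measure (XQuot n)} [IsProbabilityMeasure μ]
    (hinv : ∀ g : SLR n, Measure.map (fun x => g • x) μ = μ) {B : Set (XQuot n)}
    (hB : MeasurableSet B) {h : ℝ → SLR n} (hh : Continuous h)
    (hae : ∀ᵐ x ∂μ, ∀ᵐ s : ℝ, h s • x ∉ B) : μ B = 0 := by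
  have hmeas : MeasurableSet {p : XQuot n × ℝ | h p.2 • p.1 ∉ B} := by
    have hc : Continuous fun p : XQuot n × ℝ => h p.2 • p.1 :=
      (hh.comp continuous_snd).smul continuous_fst
    exact hc.measurable hB.compl
  rw [Measure.ae_ae_comm hmeas] at hae
  obtain ⟨s, hs⟩ := hae.exists
  have hc : Continuous fun x : XQuot n => h s • x := continuous_const_smul _
  rw [← hinv (h s), Measure.map_apply hc.measurable hB]
  exact measure_eq_zero_iff_ae_notMem.2 hs

theorem mk_mem_mk_image_iff {S : Set (SLR n)} (hS : ∀ g ∈ S, ∀ γ ∈ SLZsub n, g * γ ∈ S)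
    {g : SLR n} : (QuotientGroup.mk g : XQuot n) ∈ (QuotientGroup.mk '' S : Set (XQuot n)) ↔
      g ∈ S := by
  refine ⟨?_, fun h => ⟨g, h, rfl⟩⟩
  rintro ⟨g', hg', e⟩
  simpa using hS g' hg' _ (QuotientGroup.eq.1 e)

/-- Nullity criterion for the image of a right invariant countable union of closed sets. -/
theorem measure_mk_image_iUnion_eq_zero {μ : Measure (XQuot n)} [IsProbabilityMeasure μ]
    (hinv : ∀ g : SLR n, Measure.map (fun x => g • x) μ = μ) {ι : Type*} [Countable ι]
    {S : ι → Set (SLR n)} (hclosed : ∀ i, IsClosed (S i))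
    (hS : ∀ g ∈ ⋃ i, S i, ∀ γ ∈ SLZsub n, g * γ ∈ ⋃ i, S i) {h : ℝ → SLR n} (hh : Continuous h)
    (hae : ∀ᵐ x ∂μ, ∀ g : SLR n, (QuotientGroup.mk g : XQuot n) = x →
      ∀ i, {s | h s * g ∈ S i}.Countable) :
    μ (QuotientGroup.mk '' ⋃ i, S i) = 0 := by
  refine measure_eq_zero_of_curve hinv ?_ hh ?_
  · rw [image_iUnion]
    exact MeasurableSet.iUnion fun i => measurableSet_mk_image_of_isClosed (hclosed i)
  · filter_upwards [hae] with x hx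
    obtain ⟨g, rfl⟩ := QuotientGroup.mk_surjective x
    have hc : {s | h s * g ∈ ⋃ i, S i}.Countable := by
      simp only [mem_iUnion, ofPred_exists]
      exact countable_iUnion (hx g rfl)
    filter_upwards [hc.ae_notMem volume] with s hs hmem
    exact hs ((mk_mem_mk_image_iff hS).1 hmem)

theorem exists_coe_eq_of_mem_SLZsub {γ : SLR n} (hγ : γ ∈ SLZsub n) :
    ∃ A : Matrix.SpecialLinearGroup (Fin n) ℤ,
      (γ : Matrix (Fin n) (Fin n) ℝ) = (A : Matrix (Fin n) (Fin n) ℤ).map (Int.cast : ℤ → ℝ) := by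
  obtain ⟨A, rfl⟩ := hγ
  exact ⟨A, rfl⟩

/-- The identity matrix with row `j` replaced by distinct powers of `s`, the diagonal one
being `1`. -/
def momentShear (j : Fin n) (s : ℝ) : SLR n :=
  ⟨(1 : Matrix (Fin n) (Fin n) ℝ).updateRow j fun k => s ^ (if k = j then 0 else (k : ℕ) + 1), by
    rw [← Matrix.det_transpose, ← Matrix.updateCol_transpose, Matrix.transpose_one,
      ← Matrix.cramer_apply, Matrix.cramer_one]
    simp⟩

theorem continuous_momentShear (j : Fin n) : Continuous (momentShear j) := by
  refine continuous_induced_rng.2 ?_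
  exact continuous_const.matrix_updateRow j (by fun_prop)

theorem momentShear_mulVec_self (j : Fin n) (s : ℝ) (w : Fin n → ℝ) :
    ((momentShear j s : SLR n) : Matrix (Fin n) (Fin n) ℝ).mulVec w j =
      ∑ k, s ^ (if k = j then 0 else (k : ℕ) + 1) * w k := by
  simp [momentShear, Matrix.mulVec, dotProduct]

theorem countable_setOf_momentShear_mulVec_eq_zero (j : Fin n) {w : Fin n → ℝ} (hw : w ≠ 0) :
    {s | ((momentShear j s : SLR n) : Matrix (Fin n) (Fin n) ℝ).mulVec w j = 0}.Countable := by
  let e : Fin n → ℕ := fun k => if k = j then 0 else (k : ℕ) + 1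
  have he : Function.Injective e := by
    intro a b hab
    simp only [e] at hab
    split_ifs at hab with h1 h2
    · exact h1.trans h2.symm
    · exact Fin.ext (by omega)
  let P : Polynomial ℝ := ∑ k, Polynomial.monomial (e k) (w k)
  have hP : P ≠ 0 := by
    obtain ⟨k, hk⟩ := Function.ne_iff.1 hw
    intro h0
    apply hk
    have := congrArg (fun p => Polynomial.coeff p (e k)) h0
    simpa [P, Polynomial.finsetSum_coeff, Polynomial.coeff_monomial, he.eq_iff] using this
  refine (P.finite_setOfPred_isRoot hP).countable.mono fun s hs => ?_
  rw [mem_ofPred_eq, momentShear_mulVec_self] at hs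
  simp only [mem_ofPred_eq, Polynomial.IsRoot.def, P, Polynomial.eval_finsetSum,
    Polynomial.eval_monomial]
  rw [← hs]
  exact Finset.sum_congr rfl fun k _ => mul_comm _ _

theorem intCast_vec_ne_zero {v : Fin n → ℤ} (hv : v ≠ 0) : (fun i => (v i : ℝ)) ≠ 0 := by
  obtain ⟨i, hi⟩ := Function.ne_iff.1 hv
  exact Function.ne_iff.2 ⟨i, by simpa using hi⟩

theorem mulVec_ne_zero (g : SLR n) {w : Fin n → ℝ} (hw : w ≠ 0) :
    (g : Matrix (Fin n) (Fin n) ℝ).mulVec w ≠ 0 := fun h => hw <| by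
  rw [← inv_mulVec_mulVec g w, h, Matrix.mulVec_zero]

theorem SLZ_mulVec_ne_zero (A : Matrix.SpecialLinearGroup (Fin n) ℤ) {v : Fin n → ℤ}
    (hv : v ≠ 0) : (A : Matrix (Fin n) (Fin n) ℤ).mulVec v ≠ 0 := fun h => hv <| by
  have := congrArg ((A⁻¹ : Matrix.SpecialLinearGroup (Fin n) ℤ) : Matrix (Fin n) (Fin n) ℤ).mulVec h
  rwa [Matrix.mulVec_mulVec, ← Matrix.SpecialLinearGroup.coe_mul, inv_mul_cancel,
    Matrix.SpecialLinearGroup.coe_one, Matrix.one_mulVec, Matrix.mulVec_zero] at this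

theorem map_intCast_mulVec (A : Matrix (Fin n) (Fin n) ℤ) (v : Fin n → ℤ) :
    (A.map (Int.cast : ℤ → ℝ)).mulVec (fun i => (v i : ℝ)) = fun i => ((A.mulVec v i : ℤ) : ℝ) := by
  ext i
  simp [Matrix.mulVec, dotProduct]

/-- Almost every unimodular lattice has no nonzero vector with vanishing `j`-th coordinate. -/
theorem measure_exists_coord_eq_zero {μ : Measure (XQuot n)} [IsProbabilityMeasure μ]
    (hinv : ∀ g : SLR n, Measure.map (fun x => g • x) μ = μ) (j : Fin n) :
    μ (QuotientGroup.mk '' ⋃ v : {v : Fin n → ℤ // v ≠ 0}, {g : SLR n |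
      (g : Matrix (Fin n) (Fin n) ℝ).mulVec (fun i => (v.1 i : ℝ)) j = 0}) = 0 := by
  refine measure_mk_image_iUnion_eq_zero hinv (fun v => ?_) ?_ (continuous_momentShear j)
    (Eventually.of_forall fun x g _ v => ?_)
  · refine isClosed_eq ?_ continuous_const
    exact (continuous_apply j).comp
      (isClosedEmbedding_coe_SLR.continuous.matrix_mulVec continuous_const)
  · intro g hg γ hγ
    obtain ⟨v, hv⟩ := mem_iUnion.1 hg
    obtain ⟨A, hA⟩ := exists_coe_eq_of_mem_SLZsub (inv_mem hγ)
    refine mem_iUnion.2 ⟨⟨_, SLZ_mulVec_ne_zero A v.2⟩, ?_⟩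
    rw [mem_ofPred_eq, ← map_intCast_mulVec, ← hA, Matrix.mulVec_mulVec,
      ← Matrix.SpecialLinearGroup.coe_mul, mul_inv_cancel_right]
    exact hv
  · have := countable_setOf_momentShear_mulVec_eq_zero j
      (mulVec_ne_zero g (intCast_vec_ne_zero v.2))
    simpa only [mem_ofPred_eq, Matrix.SpecialLinearGroup.coe_mul, ← Matrix.mulVec_mulVec] using this

/-- The one-parameter group of elementary transvections. -/
def elemShear {c k : Fin n} (hck : c ≠ k) (s : ℝ) : SLR n :=
  ⟨Matrix.transvection c k s, Matrix.det_transvection_of_ne c k hck s⟩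

theorem continuous_elemShear {c k : Fin n} (hck : c ≠ k) : Continuous (elemShear hck) := by
  refine continuous_induced_rng.2 ?_
  change Continuous fun s => 1 + Matrix.single c k s
  exact continuous_const.add (continuous_matrix fun i j => by
    simp only [Matrix.single_apply]
    split_ifs <;> fun_prop)

theorem trace_elemShear_mul {c k : Fin n} (hck : c ≠ k) (s : ℝ) (M : Matrix (Fin n) (Fin n) ℝ) :
    (((elemShear hck s : SLR n) : Matrix (Fin n) (Fin n) ℝ) * M).trace = M.trace + s * M k c := by
  change (Matrix.transvection c k s * M).trace = _
  rw [Matrix.transvection, add_mul, one_mul, Matrix.trace_add, Matrix.trace_single_mul,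
    smul_eq_mul]

/-- For fixed `c` and `R`, almost no unimodular lattice has an integer matrix `V` with nonzero
column `c` and `tr (g V) = R`. -/
theorem measure_exists_trace_eq {μ : Measure (XQuot n)} [IsProbabilityMeasure μ]
    (hinv : ∀ g : SLR n, Measure.map (fun x => g • x) μ = μ) {c k : Fin n} (hck : c ≠ k) (R : ℝ) :
    μ (QuotientGroup.mk '' ⋃ V : {V : Matrix (Fin n) (Fin n) ℤ // V.col c ≠ 0}, {g : SLR n |
      ((g : Matrix (Fin n) (Fin n) ℝ) * V.1.map (Int.cast : ℤ → ℝ)).trace = R}) = 0 := by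
  have : Countable (Matrix (Fin n) (Fin n) ℤ) := inferInstanceAs (Countable (Fin n → Fin n → ℤ))
  refine measure_mk_image_iUnion_eq_zero hinv (fun V => ?_) ?_ (continuous_elemShear hck) ?_
  · exact isClosed_eq ((isClosedEmbedding_coe_SLR.continuous.matrix_mul
      continuous_const).matrix_trace) continuous_const
  · intro g hg γ hγ
    obtain ⟨V, hV⟩ := mem_iUnion.1 hg
    obtain ⟨A, hA⟩ := exists_coe_eq_of_mem_SLZsub (inv_mem hγ)
    refine mem_iUnion.2 ⟨⟨A * V.1, SLZ_mulVec_ne_zero A V.2⟩, ?_⟩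
    have e : (A * V.1 : Matrix (Fin n) (Fin n) ℤ).map (Int.cast : ℤ → ℝ) =
        (A : Matrix (Fin n) (Fin n) ℤ).map (Int.cast : ℤ → ℝ) * V.1.map (Int.cast : ℤ → ℝ) :=
      Matrix.map_mul (f := Int.castRingHom ℝ)
    rw [mem_ofPred_eq, e, ← hA, ← Matrix.mul_assoc,
      ← Matrix.SpecialLinearGroup.coe_mul, mul_inv_cancel_right]
    exact hV
  · filter_upwards [measure_eq_zero_iff_ae_notMem.1 (measure_exists_coord_eq_zero hinv k)]
      with x hx g hg V
    have hne : ((g : Matrix (Fin n) (Fin n) ℝ) * V.1.map (Int.cast : ℤ → ℝ)) k c ≠ 0 :=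
      fun h0 => hx ⟨g, mem_iUnion.2 ⟨⟨V.1.col c, V.2⟩, h0⟩, hg⟩
    refine Set.Subsingleton.countable fun s hs t ht => ?_
    rw [mem_ofPred_eq, Matrix.SpecialLinearGroup.coe_mul, Matrix.mul_assoc,
      trace_elemShear_mul] at hs ht
    exact mul_right_cancel₀ hne (add_left_cancel (hs.trans ht.symm))

theorem measure_covRad_level_set (hn : 2 ≤ n) {μ : Measure (XQuot n)} [IsProbabilityMeasure μ]
    (hinv : ∀ g : SLR n, Measure.map (fun x => g • x) μ = μ) (R : ℝ) :
    μ (QuotientGroup.mk '' {g : SLR n | covRad n (simplexStd n) (latticeOf g) = R}) = 0 := by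
  have : Nontrivial (Fin n) := Fin.nontrivial_iff_two_le.2 hn
  have hnull : μ (⋃ c : Fin n, QuotientGroup.mk '' ⋃ V : {V : Matrix (Fin n) (Fin n) ℤ //
      V.col c ≠ 0}, {g : SLR n |
      ((g : Matrix (Fin n) (Fin n) ℝ) * V.1.map (Int.cast : ℤ → ℝ)).trace = R}) = 0 :=
    measure_iUnion_null fun c => by
      obtain ⟨k, hk⟩ := exists_ne c
      exact measure_exists_trace_eq hinv hk.symm R
  refine measure_mono_null ?_ hnull
  rintro _ ⟨g, hg, rfl⟩
  obtain ⟨V, hV⟩ := exists_int_trace_eq_covRad (by omega) g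
  obtain ⟨c, hc⟩ : ∃ c, V.col c ≠ 0 := by
    by_contra! h0
    have : V = 0 := by
      ext i j
      exact congrFun (h0 j) i
    have hpos := covRad_simplexStd_pos (by omega) g
    simp [← hV, this] at hpos
  exact mem_iUnion.2 ⟨c, g, mem_iUnion.2 ⟨⟨V, hc⟩, hV.trans hg⟩, rfl⟩

theorem latticeOf_mul_subset {g γ : SLR n} (hγ : γ ∈ SLZsub n) :
    latticeOf (g * γ) ⊆ latticeOf g := by
  rintro _ ⟨v, rfl⟩
  obtain ⟨A, hA⟩ := exists_coe_eq_of_mem_SLZsub hγ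
  refine ⟨(A : Matrix (Fin n) (Fin n) ℤ).mulVec v, ?_⟩
  rw [← map_intCast_mulVec, ← hA, Matrix.mulVec_mulVec, Matrix.SpecialLinearGroup.coe_mul]

theorem latticeOf_mul {g γ : SLR n} (hγ : γ ∈ SLZsub n) : latticeOf (g * γ) = latticeOf g := by
  refine (latticeOf_mul_subset hγ).antisymm ?_
  simpa using latticeOf_mul_subset (g := g * γ) (inv_mem hγ)

/-- The covering radius of the standard simplex as a function on the space of lattices. -/
def covRadQuot (n : ℕ) : XQuot n → ℝ :=
  Quotient.lift (fun g : SLR n => covRad n (simplexStd n) (latticeOf g)) fun g g' h => by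
    have h' := QuotientGroup.leftRel_apply.1 h
    have : g' = g * (g⁻¹ * g') := by group
    rw [this, latticeOf_mul h']

theorem mk_image_covRad (s : Set ℝ) :
    (QuotientGroup.mk '' {g : SLR n | covRad n (simplexStd n) (latticeOf g) ∈ s} :
      Set (XQuot n)) = covRadQuot n ⁻¹' s := by
  have : {g : SLR n | covRad n (simplexStd n) (latticeOf g) ∈ s} =
      QuotientGroup.mk ⁻¹' (covRadQuot n ⁻¹' s) := rfl
  rw [this, image_preimage_eq _ QuotientGroup.mk_surjective]

theorem isCoveringScale_mul {g h : SLR n} {t t' ε : ℝ} (ht : IsCoveringScale (latticeOf g) t)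
    (hε : 0 ≤ ε) (hclose : ∀ i j, |((h : Matrix (Fin n) (Fin n) ℝ) - 1) i j| ≤ ε)
    (htt' : t + 2 * n * (ε * t) ≤ t') : IsCoveringScale (latticeOf (h * g)) t' := by
  have ht0 := ht.1
  have hpos : 0 ≤ 2 * n * (ε * t) := by positivity
  refine ⟨by linarith, fun x => ?_⟩
  obtain ⟨l, hl, h1, h2⟩ := ht.2 (((h⁻¹ : SLR n) : Matrix (Fin n) (Fin n) ℝ).mulVec
    fun i => x i - ε * t)
  set y := ((h⁻¹ : SLR n) : Matrix (Fin n) (Fin n) ℝ).mulVec fun i => x i - ε * t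
  have hy : (h : Matrix (Fin n) (Fin n) ℝ).mulVec y = fun i => x i - ε * t := mulVec_inv_mulVec h _
  have hd : ∀ i, |((h : Matrix (Fin n) (Fin n) ℝ) - 1).mulVec (y - l) i| ≤ ε * t := by
    intro i
    calc |((h : Matrix (Fin n) (Fin n) ℝ) - 1).mulVec (y - l) i|
        ≤ ∑ j, |((h : Matrix (Fin n) (Fin n) ℝ) - 1) i j * (y - l) j| := by
          rw [Matrix.mulVec, dotProduct]
          exact Finset.abs_sum_le_sum_abs _ _
      _ ≤ ∑ j, ε * (y j - l j) := Finset.sum_le_sum fun j _ => by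
          rw [abs_mul, Pi.sub_apply, abs_of_nonneg (sub_nonneg.2 (h1 j))]
          exact mul_le_mul_of_nonneg_right (hclose i j) (sub_nonneg.2 (h1 j))
      _ ≤ ε * t := by
          rw [← Finset.mul_sum]
          exact mul_le_mul_of_nonneg_left h2 hε
  have hxl : ∀ i, x i - (h : Matrix (Fin n) (Fin n) ℝ).mulVec l i =
      ((h : Matrix (Fin n) (Fin n) ℝ) - 1).mulVec (y - l) i + (y i - l i) + ε * t := by
    intro i
    rw [Matrix.sub_mulVec, Matrix.one_mulVec, Matrix.mulVec_sub, hy]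
    simp only [Pi.sub_apply]
    ring
  refine ⟨(h : Matrix (Fin n) (Fin n) ℝ).mulVec l, ?_, fun i => ?_, ?_⟩
  · obtain ⟨v, rfl⟩ := hl
    exact ⟨v, by rw [Matrix.mulVec_mulVec, Matrix.SpecialLinearGroup.coe_mul]⟩
  · linarith [hxl i, (abs_le.1 (hd i)).1, h1 i]
  · calc ∑ i, (x i - (h : Matrix (Fin n) (Fin n) ℝ).mulVec l i)
        ≤ ∑ i, ((y i - l i) + 2 * (ε * t)) := Finset.sum_le_sum fun i _ => by
          linarith [hxl i, (abs_le.1 (hd i)).2]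
      _ ≤ t + 2 * n * (ε * t) := by
          rw [Finset.sum_add_distrib, Finset.sum_const, Finset.card_univ, Fintype.card_fin,
            nsmul_eq_mul]
          linarith
      _ ≤ t' := htt'

theorem isOpen_setOf_covRad_lt (R : ℝ) :
    IsOpen {g : SLR n | covRad n (simplexStd n) (latticeOf g) < R} := by
  refine isOpen_iff_mem_nhds.2 fun g₀ hg₀ => ?_
  obtain ⟨t, htR, ht⟩ := exists_isCoveringScale_lt hg₀
  have ht0 := ht.1
  obtain ⟨ε, hε, hεR⟩ : ∃ ε > 0, t + 2 * n * (ε * t) < R := by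
    have hc : ContinuousAt (fun ε : ℝ => t + 2 * n * (ε * t)) 0 := by fun_prop
    have hev : ∀ᶠ ε in 𝓝[>] (0 : ℝ), t + 2 * n * (ε * t) < R :=
      nhdsWithin_le_nhds (hc.eventually_lt continuousAt_const (by simpa using htR))
    obtain ⟨ε, h1, h2⟩ := (hev.and self_mem_nhdsWithin).exists
    exact ⟨ε, h2, h1⟩
  have hev : ∀ᶠ g in 𝓝 g₀, ∀ i j,
      |(((g * g₀⁻¹ : SLR n) : Matrix (Fin n) (Fin n) ℝ) - 1) i j| < ε := by
    refine eventually_all.2 fun i => eventually_all.2 fun j => ?_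
    have hc : Continuous fun g : SLR n =>
        |(((g * g₀⁻¹ : SLR n) : Matrix (Fin n) (Fin n) ℝ) - 1) i j| := by
      refine continuous_abs.comp (Continuous.matrix_elem ?_ i j)
      exact (isClosedEmbedding_coe_SLR.continuous.comp
        (continuous_mul_const g₀⁻¹)).sub continuous_const
    exact hc.continuousAt.eventually_lt continuousAt_const (by simpa using hε)
  filter_upwards [hev] with g hg
  have := isCoveringScale_mul ht hε.le (fun i j => (hg i j).le) le_rfl
  rw [inv_mul_cancel_right] at this
  exact (covRad_le_of_isCoveringScale this).trans_lt hεR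

theorem measurable_covRadQuot : Measurable (covRadQuot n) :=
  measurable_of_Iio fun R => IsOpen.measurableSet <|
    (QuotientGroup.isQuotientMap_mk (SLZsub n)).isOpen_preimage.1 (isOpen_setOf_covRad_lt R)

end UnimodularLattices

/-- The distribution function of an atomless probability measure on the line is continuous. -/
theorem continuous_measureReal_Iic (ν : Measure ℝ) [IsProbabilityMeasure ν] [NullSingletonClass ν] :
    Continuous fun R => ν.real (Iic R) := by
  simp_rw [← ProbabilityTheory.cdf_eq_real]
  refine continuous_iff_continuousAt.2 fun R => ?_
  have h0 : (ProbabilityTheory.cdf ν).measure {R} = 0 := by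
    rw [ProbabilityTheory.measure_cdf, measure_singleton]
  rw [StieltjesFunction.measure_singleton, ENNReal.ofReal_eq_zero, sub_nonpos] at h0
  rw [(ProbabilityTheory.monotone_cdf ν).continuousAt_iff_leftLim_eq_rightLim,
    StieltjesFunction.rightLim_eq]
  exact ((ProbabilityTheory.monotone_cdf ν).leftLim_le le_rfl).antisymm h0

/-- Level sets of the covering-radius function have Haar measure zero, and
consequently the limit distribution function `R ↦ μ(E_R)` is continuous. -/
theorem level_sets_null_and_distribution_continuous (n : ℕ) (hn : 2 ≤ n)
    (μ : Measure (XQuot n)) (hprob : IsProbabilityMeasure μ)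
    (hinv : ∀ g : SLR n, Measure.map (fun x => g • x) μ = μ) :
    (∀ R : ℝ, 0 < R →
      μ (QuotientGroup.mk '' {g : SLR n | covRad n (simplexStd n) (latticeOf g) = R}) = 0) ∧
    Continuous fun R : ℝ =>
      (μ (QuotientGroup.mk ''
        {g : SLR n | covRad n (simplexStd n) (latticeOf g) ≤ R})).toReal := by
  have key := fun R : ℝ => measure_covRad_level_set hn hinv R
  refine ⟨fun R _ => key R, ?_⟩
  have : IsProbabilityMeasure (μ.map (covRadQuot n)) :=
    Measure.isProbabilityMeasure_map measurable_covRadQuot.aemeasurable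
  have : NullSingletonClass (μ.map (covRadQuot n)) := ⟨fun R => by
    rw [Measure.map_apply measurable_covRadQuot (measurableSet_singleton R), ← mk_image_covRad]
    exact key R⟩
  convert continuous_measureReal_Iic (μ.map (covRadQuot n)) using 2 with R
  rw [map_measureReal_apply measurable_covRadQuot measurableSet_Iic, ← mk_image_covRad]
  rfl
end
end

section
/- For every integer n ≥ 2 and every real R ≥ 0, the set E_R = {⟦g⟧ ∈ X : Q(Δ_n, g·ℤ^n) ≤ R} is a compact subset of the quotient topological space X = SL_n(ℝ)/SL_n(ℤ); that is, the covering-radius function Q₀ is a proper function on the space of unimodular lattices. -/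
noncomputable section

open MeasureTheory Matrix Pointwise

/-- Integer matrices with the same nonzero determinant `d` that agree modulo `d` differ by
left multiplication by an element of `SL_n(ℤ)`. -/
theorem exists_eq_specialLinear_mul {n : ℕ} {N H : Matrix (Fin n) (Fin n) ℤ}
    (hd : N.det = H.det) (h0 : H.det ≠ 0) (hdvd : ∀ i j, H.det ∣ N i j - H i j) :
    ∃ γ : Matrix.SpecialLinearGroup (Fin n) ℤ, N = (γ : Matrix (Fin n) (Fin n) ℤ) * H := by
  choose E hE using hdvd
  have hN : N = (1 + Matrix.of E * H.adjugate) * H := by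
    rw [add_mul, mul_assoc, Matrix.adjugate_mul, one_mul]
    ext i j
    have := hE i j
    simp only [Matrix.add_apply, Matrix.mul_smul, Matrix.smul_apply, mul_one, Matrix.of_apply,
      smul_eq_mul]
    linarith
  refine ⟨⟨1 + Matrix.of E * H.adjugate, ?_⟩, hN⟩
  have h := congrArg Matrix.det hN
  rw [Matrix.det_mul, hd] at h
  exact (mul_eq_right₀ h0).mp h.symm

/-- Up to left multiplication by `SL_n(ℤ)` there are finitely many integer matrices of nonzero
determinant bounded by `D`. -/
theorem exists_finite_reps (n : ℕ) (D : ℤ) :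
    ∃ T : Set (Matrix (Fin n) (Fin n) ℤ), T.Finite ∧ (∀ H ∈ T, H.det ≠ 0) ∧
      ∀ N : Matrix (Fin n) (Fin n) ℤ, N.det ≠ 0 → |N.det| ≤ D →
        ∃ H ∈ T, ∃ γ : Matrix.SpecialLinearGroup (Fin n) ℤ,
          N = (γ : Matrix (Fin n) (Fin n) ℤ) * H := by
  let s : Set (Matrix (Fin n) (Fin n) ℤ) := {N | N.det ≠ 0 ∧ |N.det| ≤ D}
  let f : Matrix (Fin n) (Fin n) ℤ → ℤ × (Fin n → Fin n → ℤ) :=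
    fun N => (N.det, fun i j => N i j % N.det)
  have hfin : (f '' s).Finite := by
    refine ((Set.finite_Icc (-D) D).prod (Set.finite_Icc (fun _ _ => 0 : Fin n → Fin n → ℤ)
      (fun _ _ => D))).subset ?_
    rintro _ ⟨N, ⟨h0, hD⟩, rfl⟩
    exact ⟨abs_le.mp hD, fun i j => Int.emod_nonneg _ h0,
      fun i j => (Int.emod_lt_abs _ h0).le.trans hD⟩
  obtain ⟨T, hTs, hT⟩ := Set.exists_subset_bijOn s f
  refine ⟨T, hT.finite_iff_finite.mpr hfin, fun H hH => (hTs hH).1, fun N h0 hD => ?_⟩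
  obtain ⟨H, hH, hHN⟩ := hT.surjOn ⟨N, ⟨h0, hD⟩, rfl⟩
  have hdet : H.det = N.det := congrArg Prod.fst hHN
  refine ⟨H, hH, exists_eq_specialLinear_mul hdet.symm (hTs hH).1 fun i j => ?_⟩
  have h : H i j % H.det = N i j % N.det := congrFun (congrFun (congrArg Prod.snd hHN) i) j
  rw [← hdet] at h
  exact (show H i j ≡ N i j [ZMOD H.det] from h).dvd

theorem isClosedEmbedding_coe_SLR_s5 (n : ℕ) :
    Topology.IsClosedEmbedding (fun g : SLR n => (g : Matrix (Fin n) (Fin n) ℝ)) := by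
  refine ⟨⟨⟨rfl⟩, Subtype.val_injective⟩, ?_⟩
  have : Set.range (fun g : SLR n => (g : Matrix (Fin n) (Fin n) ℝ)) = {M | M.det = 1} :=
    Subtype.range_coe
  rw [this]
  exact isClosed_eq continuous_id.matrix_det continuous_const

theorem simplexStd_le_one {n : ℕ} {k : Fin n → ℝ} (hk : k ∈ simplexStd n) (i : Fin n) :
    k i ≤ 1 :=
  (Finset.single_le_sum (fun j _ => hk.1 j) (Finset.mem_univ i)).trans hk.2

theorem isCompact_simplexStd (n : ℕ) : IsCompact (simplexStd n) := by
  have hclosed : IsClosed (simplexStd n) := by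
    simp only [simplexStd, Set.ofPred_and, Set.ofPred_forall]
    exact (isClosed_iInter fun i => isClosed_le continuous_const (continuous_apply i)).inter
      (isClosed_le (continuous_finsetSum _ fun i _ => continuous_apply i) continuous_const)
  exact (isCompact_Icc (a := (0 : Fin n → ℝ)) (b := 1)).of_isClosed_subset hclosed
    fun x hx => ⟨hx.1, simplexStd_le_one hx⟩

/-- `t • Δ_n + L` is all of `ℝ^n`. -/
def SimplexCovers (n : ℕ) (L : Set (Fin n → ℝ)) (t : ℝ) : Prop :=
  ∀ x : Fin n → ℝ, ∃ k ∈ simplexStd n, ∃ l ∈ L, x = t • k + l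

theorem SimplexCovers.mono {n : ℕ} {L : Set (Fin n → ℝ)} {s t : ℝ} (hs : 0 < s) (hst : s ≤ t)
    (h : SimplexCovers n L s) : SimplexCovers n L t := by
  intro x
  obtain ⟨k, hk, l, hl, rfl⟩ := h x
  have ht : 0 < t := hs.trans_le hst
  have hq : 0 ≤ s / t := by positivity
  refine ⟨(s / t) • k, ⟨fun i => mul_nonneg hq (hk.1 i), ?_⟩, l, hl, ?_⟩
  · simp only [Pi.smul_apply, smul_eq_mul, ← Finset.mul_sum]
    exact mul_le_one₀ ((div_le_one ht).mpr hst) (Finset.sum_nonneg fun i _ => hk.1 i) hk.2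
  · rw [smul_smul, mul_div_cancel₀ _ ht.ne']

theorem SLR_mulVec_inv {n : ℕ} (g : SLR n) (x : Fin n → ℝ) :
    (g : Matrix (Fin n) (Fin n) ℝ) *ᵥ ((g : Matrix (Fin n) (Fin n) ℝ).adjugate *ᵥ x) = x := by
  rw [Matrix.mulVec_mulVec, Matrix.mul_adjugate, g.det_coe, one_smul, Matrix.one_mulVec]

theorem SLR_inv_mulVec {n : ℕ} (g : SLR n) (x : Fin n → ℝ) :
    (g : Matrix (Fin n) (Fin n) ℝ).adjugate *ᵥ ((g : Matrix (Fin n) (Fin n) ℝ) *ᵥ x) = x := by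
  rw [Matrix.mulVec_mulVec, Matrix.adjugate_mul, g.det_coe, one_smul, Matrix.one_mulVec]

theorem exists_simplexCovers {n : ℕ} (g : SLR n) :
    ∃ t, 0 < t ∧ SimplexCovers n (latticeOf g) t := by
  set M : Matrix (Fin n) (Fin n) ℝ := (g : Matrix (Fin n) (Fin n) ℝ)
  set B : ℝ := ∑ i, ∑ j, |M i j|
  have hB0 : 0 ≤ B := Finset.sum_nonneg fun i _ => Finset.sum_nonneg fun j _ => abs_nonneg _
  have ht : 0 < n * (2 * B) + 1 := by positivity
  refine ⟨n * (2 * B) + 1, ht, fun x => ?_⟩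
  set t := n * (2 * B) + 1
  set y : Fin n → ℝ := M.adjugate *ᵥ (x - fun _ => B)
  set w : Fin n → ℝ := fun i => Int.fract (y i) with hw
  have hyx : M *ᵥ y = x - fun _ => B := SLR_mulVec_inv g _
  have hdecomp : y = w + fun i => ((⌊y i⌋ : ℤ) : ℝ) := by
    ext i
    simp [hw]
  have hbound : ∀ i, |(M *ᵥ w) i| ≤ B := by
    intro i
    calc |∑ j, M i j * w j| ≤ ∑ j, |M i j * w j| := Finset.abs_sum_le_sum_abs _ _
      _ ≤ ∑ j, |M i j| := Finset.sum_le_sum fun j _ => by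
          rw [abs_mul, abs_of_nonneg (Int.fract_nonneg (y j))]
          exact mul_le_of_le_one_right (abs_nonneg _) (Int.fract_lt_one (y j)).le
      _ ≤ B := Finset.single_le_sum (f := fun i => ∑ j, |M i j|)
          (fun i _ => Finset.sum_nonneg fun j _ => abs_nonneg _) (Finset.mem_univ i)
  refine ⟨t⁻¹ • ((fun _ => B) + M *ᵥ w), ⟨fun i => ?_, ?_⟩, M *ᵥ fun i => ((⌊y i⌋ : ℤ) : ℝ),
    ⟨fun i => ⌊y i⌋, rfl⟩, ?_⟩
  · have := (abs_le.mp (hbound i)).1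
    exact mul_nonneg (by positivity) (by simp only [Pi.add_apply]; linarith)
  · simp only [Pi.smul_apply, smul_eq_mul, ← Finset.mul_sum]
    rw [inv_mul_le_iff₀ ht, mul_one]
    calc ∑ i, ((fun _ => B : Fin n → ℝ) + M *ᵥ w) i ≤ ∑ _i : Fin n, 2 * B :=
          Finset.sum_le_sum fun i _ => by
            have := (abs_le.mp (hbound i)).2
            simp only [Pi.add_apply]
            linarith
      _ ≤ t := by simp [t]
  · rw [smul_smul, mul_inv_cancel₀ ht.ne', one_smul, add_assoc, ← Matrix.mulVec_add, ← hdecomp,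
      hyx]
    abel

theorem covRad_le_iff {n : ℕ} (g : SLR n) {R : ℝ} (hR : 0 ≤ R) :
    covRad n (simplexStd n) (latticeOf g) ≤ R ↔
      ∀ t, R < t → SimplexCovers n (latticeOf g) t := by
  constructor
  · intro h t ht
    obtain ⟨s, ⟨hs0, hs⟩, hst⟩ :=
      exists_lt_of_csInf_lt (exists_simplexCovers g) (h.trans_lt ht)
    exact SimplexCovers.mono hs0 hst.le hs
  · intro h
    refine le_of_forall_gt_imp_ge_of_dense fun t ht => ?_
    exact csInf_le ⟨0, fun s hs => hs.1.le⟩ ⟨hR.trans_lt ht, h t ht⟩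

theorem isClosed_setOf_simplexCovers (n : ℕ) (t : ℝ) :
    IsClosed {g : SLR n | SimplexCovers n (latticeOf g) t} := by
  have hcoe : Continuous (fun g : SLR n => (g : Matrix (Fin n) (Fin n) ℝ)) :=
    (isClosedEmbedding_coe_SLR_s5 n).continuous
  simp only [SimplexCovers, Set.ofPred_forall]
  refine isClosed_iInter fun x => ?_
  have : CompactSpace (simplexStd n) := isCompact_iff_compactSpace.mp (isCompact_simplexStd n)
  let C : Set (SLR n × simplexStd n) := {p | ∀ i,
    ((p.1 : Matrix (Fin n) (Fin n) ℝ).adjugate *ᵥ (x - t • (p.2 : Fin n → ℝ))) i ∈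
      Set.range ((↑) : ℤ → ℝ)}
  have hC : IsClosed C := by
    simp only [C, Set.ofPred_forall]
    refine isClosed_iInter fun i => Int.isClosedEmbedding_coe_real.isClosed_range.preimage ?_
    exact (continuous_apply i).comp ((hcoe.comp continuous_fst).matrix_adjugate.matrix_mulVec
      (continuous_const.sub ((continuous_subtype_val.comp continuous_snd).const_smul t)))
  convert isClosedMap_fst_of_compactSpace C hC using 1
  ext g
  constructor
  · rintro ⟨k, hk, l, ⟨v, rfl⟩, hx⟩
    refine ⟨(g, ⟨k, hk⟩), fun i => ⟨v i, ?_⟩, rfl⟩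
    simp only [hx, add_sub_cancel_left, SLR_inv_mulVec]
  · rintro ⟨⟨g', k⟩, hp, rfl⟩
    choose v hv using hp
    refine ⟨k, k.2, _, ⟨v, rfl⟩, ?_⟩
    simp only [hv]
    rw [SLR_mulVec_inv]
    abel

theorem latticeOf_mul_map {n : ℕ} (g : SLR n) (γ : Matrix.SpecialLinearGroup (Fin n) ℤ) :
    latticeOf (g * Matrix.SpecialLinearGroup.map (Int.castRingHom ℝ) γ) ⊆ latticeOf g := by
  rintro _ ⟨v, rfl⟩
  refine ⟨(γ : Matrix (Fin n) (Fin n) ℤ) *ᵥ v, ?_⟩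
  rw [Matrix.SpecialLinearGroup.coe_mul, ← Matrix.mulVec_mulVec]
  congr 1
  ext i
  simp [Matrix.mulVec, dotProduct]

theorem latticeOf_mul_map_eq {n : ℕ} (g : SLR n) (γ : Matrix.SpecialLinearGroup (Fin n) ℤ) :
    latticeOf (g * Matrix.SpecialLinearGroup.map (Int.castRingHom ℝ) γ) = latticeOf g := by
  refine (latticeOf_mul_map g γ).antisymm ?_
  have := latticeOf_mul_map (g * Matrix.SpecialLinearGroup.map (Int.castRingHom ℝ) γ) γ⁻¹
  rwa [map_inv, mul_inv_cancel_right] at this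

/-- A lattice covered by a simplex of size `ρ` has a full-rank sublattice whose basis vectors have
entries bounded by `(n + 1) * ρ + 1`. -/
theorem SimplexCovers.exists_bounded_sublattice {n : ℕ} {g : SLR n} {ρ : ℝ} (hρ : 0 < ρ)
    (h : SimplexCovers n (latticeOf g) ρ) :
    ∃ N : Matrix (Fin n) (Fin n) ℤ, N.det ≠ 0 ∧
      ∀ i j, |((g : Matrix (Fin n) (Fin n) ℝ) * N.map (Int.cast : ℤ → ℝ)) i j|
        ≤ (n + 1) * ρ + 1 := by
  set m : ℝ := (n + 1) * ρ + 1 with hm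
  have hnρ : 0 ≤ n * ρ := by positivity
  choose k hk l hl hx using fun j : Fin n => h (Pi.single j m)
  choose v hv using hl
  set N : Matrix (Fin n) (Fin n) ℤ := Matrix.of fun i j => v j i
  set A := (g : Matrix (Fin n) (Fin n) ℝ) * N.map (Int.cast : ℤ → ℝ) with hA
  have hAij : ∀ i j, A i j = (Pi.single j m : Fin n → ℝ) i - ρ * k j i := by
    intro i j
    have h1 : A i j = l j i := by
      rw [hv j]
      rfl
    rw [h1, hx j]
    simp
  have hk0 : ∀ i j, 0 ≤ ρ * k j i := fun i j => mul_nonneg hρ.le ((hk j).1 i)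
  have hk1 : ∀ i j, ρ * k j i ≤ ρ :=
    fun i j => mul_le_of_le_one_right hρ.le (simplexStd_le_one (hk j) i)
  have hdet : A.det ≠ 0 := by
    refine det_ne_zero_of_sum_row_lt_diag fun i => ?_
    calc ∑ j ∈ Finset.univ.erase i, ‖A i j‖ ≤ ∑ j ∈ Finset.univ.erase i, ρ := by
          refine Finset.sum_le_sum fun j hj => ?_
          rw [hAij, Pi.single_eq_of_ne (Finset.ne_of_mem_erase hj).symm, zero_sub, norm_neg,
            Real.norm_eq_abs, abs_of_nonneg (hk0 i j)]
          exact hk1 i j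
      _ ≤ ∑ j : Fin n, ρ :=
          Finset.sum_le_sum_of_subset_of_nonneg (Finset.erase_subset _ _) fun _ _ _ => hρ.le
      _ = n * ρ := by simp
      _ < ‖A i i‖ := by
          refine lt_of_lt_of_le ?_ (le_abs_self _)
          rw [hAij, Pi.single_eq_same]
          linarith [hk1 i i]
  refine ⟨N, fun h0 => hdet ?_, fun i j => ?_⟩
  · rw [hA, Matrix.det_mul, g.det_coe, one_mul]
    have := (Int.castRingHom ℝ).map_det N
    rw [h0, map_zero] at this
    exact this.symm
  · change |A i j| ≤ m
    rw [hAij, abs_le]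
    rcases eq_or_ne i j with rfl | hij
    · rw [Pi.single_eq_same]
      constructor <;> linarith [hk0 i i, hk1 i i]
    · rw [Pi.single_eq_of_ne hij]
      constructor <;> linarith [hk0 i j, hk1 i j]

/-- The lattices covered by a simplex of size `ρ` are all represented in one compact set. -/
theorem exists_isCompact_of_simplexCovers (n : ℕ) {ρ : ℝ} (hρ : 0 < ρ) :
    ∃ K : Set (SLR n), IsCompact K ∧ ∀ g : SLR n, SimplexCovers n (latticeOf g) ρ →
      ∃ γ : Matrix.SpecialLinearGroup (Fin n) ℤ,
        g * Matrix.SpecialLinearGroup.map (Int.castRingHom ℝ) γ ∈ K := by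
  set m : ℝ := (n + 1) * ρ + 1 with hm
  obtain ⟨T, hTfin, hT0, hT⟩ := exists_finite_reps n ⌊(n.factorial : ℝ) * m ^ n⌋
  let box : Set (Matrix (Fin n) (Fin n) ℝ) :=
    Set.univ.pi fun _ => Set.univ.pi fun _ => Set.Icc (-m) m
  have hbox : IsCompact box :=
    isCompact_univ_pi fun _ => isCompact_univ_pi fun _ => isCompact_Icc
  have hU : IsCompact (⋃ H ∈ T, (fun A => A * (H.map (Int.cast : ℤ → ℝ))⁻¹) '' box) :=
    hTfin.isCompact_biUnion fun H _ => hbox.image (continuous_id.matrix_mul continuous_const)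
  refine ⟨_, (isClosedEmbedding_coe_SLR_s5 n).isCompact_preimage hU, fun g hg => ?_⟩
  have hcast : ∀ N : Matrix (Fin n) (Fin n) ℤ,
      (N.map (Int.cast : ℤ → ℝ)).det = (N.det : ℝ) :=
    fun N => ((Int.castRingHom ℝ).map_det N).symm
  obtain ⟨N, hN0, hN⟩ := hg.exists_bounded_sublattice hρ
  have hdet : |N.det| ≤ ⌊(n.factorial : ℝ) * m ^ n⌋ := by
    rw [Int.le_floor, Int.cast_abs, ← hcast, ← one_mul (Matrix.det _), ← g.det_coe,
      ← Matrix.det_mul]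
    simpa using Matrix.det_le (abv := (AbsoluteValue.abs : AbsoluteValue ℝ ℝ)) hN
  obtain ⟨H, hH, γ, rfl⟩ := hT N hN0 hdet
  refine ⟨γ, Set.mem_biUnion hH ⟨_, fun i _ j _ => abs_le.mp (hN i j), ?_⟩⟩
  have hunit : IsUnit (H.map (Int.cast : ℤ → ℝ)).det := by
    rw [hcast]
    exact (Int.cast_ne_zero.mpr (hT0 H hH)).isUnit
  have hmap : (((γ : Matrix (Fin n) (Fin n) ℤ) * H).map (Int.cast : ℤ → ℝ)) =
      (γ : Matrix (Fin n) (Fin n) ℤ).map (Int.cast : ℤ → ℝ) * H.map (Int.cast : ℤ → ℝ) :=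
    Matrix.map_mul (f := Int.castRingHom ℝ)
  simp only [hmap, ← mul_assoc]
  rw [Matrix.mul_nonsing_inv_cancel_right _ _ hunit]
  rfl

/-- For every `R ≥ 0` the set `E_R = {L : Q₀(L) ≤ R}` is compact in
`X = SL_n(ℝ)/SL_n(ℤ)`, i.e. `Q₀` is proper. -/
theorem ER_isCompact (n : ℕ) (hn : 2 ≤ n) (R : ℝ) (hR : 0 ≤ R) :
    IsCompact
      (QuotientGroup.mk '' {g : SLR n | covRad n (simplexStd n) (latticeOf g) ≤ R} :
        Set (XQuot n)) := by
  have hset : {g : SLR n | covRad n (simplexStd n) (latticeOf g) ≤ R} =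
      ⋂ t, ⋂ (_ : R < t), {g : SLR n | SimplexCovers n (latticeOf g) t} := by
    ext g
    simp [covRad_le_iff g hR]
  have hclosed : IsClosed {g : SLR n | covRad n (simplexStd n) (latticeOf g) ≤ R} := by
    rw [hset]
    exact isClosed_iInter fun t => isClosed_iInter fun _ => isClosed_setOf_simplexCovers n t
  obtain ⟨K, hK, hcov⟩ := exists_isCompact_of_simplexCovers n (ρ := R + 1) (by linarith)
  convert (hK.inter_right hclosed).image
    (QuotientGroup.continuous_mk : Continuous (QuotientGroup.mk : SLR n → XQuot n)) using 1
  refine Set.Subset.antisymm ?_ (Set.image_mono Set.inter_subset_right)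
  rintro _ ⟨g, hg, rfl⟩
  obtain ⟨γ, hγ⟩ := hcov g ((covRad_le_iff g hR).mp hg (R + 1) (by linarith))
  refine ⟨_, ⟨hγ, ?_⟩, QuotientGroup.mk_mul_of_mem g ⟨γ, rfl⟩⟩
  rwa [Set.mem_ofPred_eq, latticeOf_mul_map_eq]
end
end

section
/- (Kannan–Lovász transference bounds, part (i).) Let n ≥ 1, let K ⊆ ℝ^n be a convex body (a compact convex set with nonempty interior), and let L be a lattice in ℝ^n. Then λ_n(K−K, L) ≤ Q(K, L) ≤ Σ_{i=1}^n λ_i(K−K, L), where K−K = {k₁ − k₂ : k₁, k₂ ∈ K} is the difference body (a centrally symmetric convex body). -/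
noncomputable section

open MeasureTheory Matrix Pointwise

/-- A lattice in `ℝ^n`: a subgroup of the form `B·ℤ^n` with `B` invertible. -/
def IsLattice (n : ℕ) (L : Set (Fin n → ℝ)) : Prop :=
  ∃ B : Matrix (Fin n) (Fin n) ℝ, IsUnit B.det ∧ L = matLattice B

/-- The `i`-th successive minimum `λ_i(K, L)` of a (centrally symmetric convex
body) `K` with respect to a lattice `L`. -/
def succMin (n : ℕ) (i : ℕ) (K L : Set (Fin n → ℝ)) : ℝ :=
  sInf {t : ℝ | 0 < t ∧ i ≤ Module.finrank ℝ ↥(Submodule.span ℝ (t • K ∩ L))}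

theorem IsLattice.exists_addSubgroup {n : ℕ} {L : Set (Fin n → ℝ)} (hL : IsLattice n L) :
    ∃ S : AddSubgroup (Fin n → ℝ), (S : Set (Fin n → ℝ)) = L := by
  obtain ⟨B, -, rfl⟩ := hL
  refine ⟨{ carrier := matLattice B, add_mem' := ?_, zero_mem' := ?_, neg_mem' := ?_ }, rfl⟩
  · rintro _ _ ⟨v, rfl⟩ ⟨w, rfl⟩
    refine ⟨v + w, ?_⟩
    rw [← Matrix.mulVec_add]
    congr 1
    ext i
    simp
  · refine ⟨0, ?_⟩
    have : (fun i => (((0 : Fin n → ℤ) i : ℤ) : ℝ)) = 0 := by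
      ext i
      simp
    rw [this, Matrix.mulVec_zero]
  · rintro _ ⟨v, rfl⟩
    refine ⟨-v, ?_⟩
    rw [← Matrix.mulVec_neg]
    congr 1
    ext i
    simp

theorem IsLattice.exists_finite_span_eq_top {n : ℕ} {L : Set (Fin n → ℝ)} (hL : IsLattice n L) :
    ∃ s ⊆ L, s.Finite ∧ Submodule.span ℝ s = ⊤ := by
  obtain ⟨B, hB, rfl⟩ := hL
  refine ⟨Set.range B.col, ?_, Set.finite_range _, ?_⟩
  · rintro _ ⟨j, rfl⟩
    refine ⟨Pi.single j 1, ?_⟩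
    have : (fun i => ((Pi.single j 1 : Fin n → ℤ) i : ℝ)) = Pi.single j 1 := by
      ext i
      by_cases h : i = j
      · subst h
        simp
      · simp [h]
    rw [this, Matrix.mulVec_single_one]
  · rw [← Matrix.range_mulVecLin, LinearMap.range_eq_top]
    exact Matrix.mulVec_surjective_iff_isUnit.mpr ((Matrix.isUnit_iff_isUnit_det B).mpr hB)

/-- Every subset of a lattice is closed. -/
theorem IsLattice.isClosed_of_subset {n : ℕ} {L : Set (Fin n → ℝ)} (hL : IsLattice n L)
    {S : Set (Fin n → ℝ)} (hS : S ⊆ L) : IsClosed S := by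
  obtain ⟨B, hB, rfl⟩ := hL
  have hinj : Function.Injective B.mulVecLin :=
    Matrix.mulVec_injective_iff_isUnit.mpr ((Matrix.isUnit_iff_isUnit_det B).mpr hB)
  have hemb : Topology.IsClosedEmbedding fun v : Fin n → ℤ => B.mulVec fun i => (v i : ℝ) :=
    (LinearMap.isClosedEmbedding_of_injective (LinearMap.ker_eq_bot.mpr hinj)).comp
      (Topology.IsClosedEmbedding.piMap fun _ => Int.isClosedEmbedding_coe_real)
  have hrange : S ⊆ Set.range fun v : Fin n → ℤ => B.mulVec fun i => (v i : ℝ) := by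
    intro x hx
    obtain ⟨v, hv⟩ := hS hx
    exact ⟨v, hv.symm⟩
  rw [← Set.image_preimage_eq_of_subset hrange]
  exact hemb.isClosedMap _ (isClosed_discrete _)

theorem sub_self_mem_nhds_zero {E : Type*} [AddGroup E] [TopologicalSpace E]
    [ContinuousAdd E] {K : Set E} (hK : (interior K).Nonempty) : K - K ∈ nhds 0 := by
  obtain ⟨x, hx⟩ := hK
  have hmem : (fun y => y + x) ⁻¹' K ∈ nhds (0 : E) := by
    refine (continuous_add_const x).continuousAt.preimage_mem_nhds ?_
    simpa using mem_interior_iff_mem_nhds.mp hx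
  filter_upwards [hmem] with y hy
  exact ⟨y + x, hy, x, interior_subset hx, add_sub_cancel_right y x⟩

theorem IsLattice.exists_span_smul_inter_eq_top {n : ℕ} {L : Set (Fin n → ℝ)}
    (hL : IsLattice n L) {C : Set (Fin n → ℝ)} (hC : C ∈ nhds 0) :
    ∃ t : ℝ, 0 < t ∧ Submodule.span ℝ (t • C ∩ L) = ⊤ := by
  obtain ⟨s, hsL, hsfin, hspan⟩ := hL.exists_finite_span_eq_top
  obtain ⟨r, hr, hsub⟩ :=
    ((absorbent_nhds_zero (𝕜 := ℝ) hC).absorbs_finite hsfin).exists_pos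
  refine ⟨r, hr, top_unique (hspan ▸ Submodule.span_mono (Set.subset_inter ?_ hsL))⟩
  exact hsub r (le_abs_self r)

/-- A connectedness argument: translates of `tK` by lattice points in and outside the span of
`t(K - K) ∩ L` do not meet, yet they cover the whole space. -/
theorem IsLattice.span_smul_sub_inter_eq_top {n : ℕ} {L K : Set (Fin n → ℝ)}
    (hL : IsLattice n L) (hK : IsCompact K) (hKne : K.Nonempty) {t : ℝ}
    (hcov : ∀ x : Fin n → ℝ, ∃ k ∈ K, ∃ l ∈ L, x = t • k + l) :
    Submodule.span ℝ (t • (K - K) ∩ L) = ⊤ := by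
  set H := Submodule.span ℝ (t • (K - K) ∩ L)
  obtain ⟨S, rfl⟩ := hL.exists_addSubgroup
  have hclosed (T : Set (Fin n → ℝ)) (hT : T ⊆ S) : IsClosed (t • K + T) :=
    (hL.isClosed_of_subset hT).add_left_of_isCompact (hK.smul t)
  have hcompl : (t • K + (S ∩ H : Set (Fin n → ℝ)))ᶜ = t • K + (S \ H : Set (Fin n → ℝ)) := by
    ext x
    constructor
    · intro hx
      obtain ⟨k, hk, l, hl, rfl⟩ := hcov x
      exact Set.add_mem_add (Set.smul_mem_smul_set hk)
        ⟨hl, fun hlH => hx (Set.add_mem_add (Set.smul_mem_smul_set hk) ⟨hl, hlH⟩)⟩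
    · rintro ⟨_, ⟨k, hk, rfl⟩, l, ⟨hl, hlH⟩, rfl⟩ ⟨_, ⟨k', hk', rfl⟩, l', ⟨hl', hlH'⟩, h⟩
      have hdiff : l - l' = t • (k' - k) := by
        simp only at h
        rw [smul_sub, sub_eq_sub_iff_add_eq_add, add_comm, ← h, add_comm]
      have hmem : l - l' ∈ H := Submodule.subset_span
        ⟨hdiff ▸ Set.smul_mem_smul_set (Set.sub_mem_sub hk' hk), S.sub_mem hl hl'⟩
      exact hlH (by simpa using H.add_mem hmem hlH')
  have hclopen : IsClopen (t • K + (S ∩ H : Set (Fin n → ℝ))) :=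
    ⟨hclosed _ Set.inter_subset_left,
      isClosed_compl_iff.mp (hcompl ▸ hclosed _ Set.sdiff_subset)⟩
  obtain ⟨k, hk⟩ := hKne
  rcases isClopen_iff.mp hclopen with hempty | huniv
  · have : t • k + 0 ∈ t • K + (S ∩ H : Set (Fin n → ℝ)) :=
      Set.add_mem_add (Set.smul_mem_smul_set hk) ⟨S.zero_mem, H.zero_mem⟩
    simp [hempty] at this
  · obtain ⟨s, hsS, -, hspan⟩ := hL.exists_finite_span_eq_top
    rw [huniv, Set.compl_univ] at hcompl
    rw [eq_top_iff, ← hspan, Submodule.span_le]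
    intro l hl
    by_contra hlH
    have : t • k + l ∈ t • K + (S \ H : Set (Fin n → ℝ)) :=
      Set.add_mem_add (Set.smul_mem_smul_set hk) ⟨hsS hl, hlH⟩
    simp [← hcompl] at this

/-- Greedy choice of linearly independent representatives from sets whose spans have
increasing dimensions. -/
theorem exists_linearIndependent_of_lt_finrank_span {E : Type*} [AddCommGroup E] [Module ℝ E]
    {m : ℕ} (A : Fin m → Set E)
    (hA : ∀ i : Fin m, (i : ℕ) < Module.finrank ℝ (Submodule.span ℝ (A i))) :
    ∃ v : Fin m → E, LinearIndependent ℝ v ∧ ∀ i, v i ∈ A i := by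
  induction m with
  | zero => exact ⟨Fin.elim0, linearIndependent_empty_type, fun i => i.elim0⟩
  | succ m ih =>
    obtain ⟨v, hv, hvA⟩ := ih (fun i => A i.castSucc) fun i => hA i.castSucc
    obtain ⟨x, hxA, hx⟩ : ∃ x ∈ A (Fin.last m), x ∉ Submodule.span ℝ (Set.range v) := by
      by_contra! h
      have hle : Module.finrank ℝ (Submodule.span ℝ (A (Fin.last m))) ≤ m := by
        have := FiniteDimensional.span_of_finite ℝ (Set.finite_range v)
        calc _ ≤ Module.finrank ℝ (Submodule.span ℝ (Set.range v)) :=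
              Submodule.finrank_mono (Submodule.span_le.mpr h)
          _ ≤ m := (finrank_range_le_card v).trans_eq (Fintype.card_fin m)
      exact absurd (hA (Fin.last m)) (by simpa using hle)
    refine ⟨Fin.snoc v x, linearIndependent_finSnoc.mpr ⟨hv, hx⟩, fun i => ?_⟩
    induction i using Fin.lastCases with
    | last => simpa using hxA
    | cast i => simpa using hvA i

theorem Convex.sum_smul_mem_sum_smul {E ι : Type*} [AddCommGroup E] [Module ℝ E] {K : Set E}
    (hK : Convex ℝ K) {s : Finset ι} {t : ι → ℝ} (ht : ∀ i ∈ s, 0 ≤ t i)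
    (hpos : 0 < ∑ i ∈ s, t i) {x : ι → E} (hx : ∀ i ∈ s, x i ∈ K) :
    ∃ k ∈ K, ∑ i ∈ s, t i • x i = (∑ i ∈ s, t i) • k :=
  ⟨s.centerMass t x, hK.centerMass_mem ht hpos hx, by
    rw [Finset.centerMass, smul_inv_smul₀ hpos.ne']⟩

/-- If linearly independent lattice vectors `v i` lie in `t i • (K - K)`, then `(∑ t i) • K`
contains a translate of the parallelepiped they span, hence covers space modulo the lattice. -/
theorem IsLattice.cover_of_linearIndependent {n : ℕ} {L K : Set (Fin n → ℝ)}
    (hL : IsLattice n L) (hK : Convex ℝ K) {t : Fin n → ℝ} (ht : ∀ i, 0 ≤ t i)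
    (hpos : 0 < ∑ i, t i) {v : Fin n → Fin n → ℝ} (hv : LinearIndependent ℝ v)
    (hmem : ∀ i, v i ∈ t i • (K - K) ∩ L) (x : Fin n → ℝ) :
    ∃ k ∈ K, ∃ l ∈ L, x = (∑ i, t i) • k + l := by
  obtain ⟨S, rfl⟩ := hL.exists_addSubgroup
  have hdiff (i : Fin n) : ∃ a ∈ K, ∃ b ∈ K, v i = t i • (a - b) := by
    obtain ⟨_, ⟨a, ha, b, hb, rfl⟩, h⟩ := (hmem i).1
    exact ⟨a, ha, b, hb, h.symm⟩
  choose a ha b hb hab using hdiff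
  obtain ⟨c, hc⟩ : ∃ c : Fin n → ℝ, ∑ i, c i • v i = x - ∑ i, t i • b i := by
    rw [← Submodule.mem_span_range_iff_exists_fun,
      hv.span_eq_top_of_card_eq_finrank' (by simp)]
    trivial
  obtain ⟨k, hk, hsum⟩ := hK.sum_smul_mem_sum_smul (s := Finset.univ) (fun i _ => ht i) hpos
    (x := fun i => b i + Int.fract (c i) • (a i - b i))
    fun i _ => hK.add_smul_sub_mem (hb i) (ha i) ⟨Int.fract_nonneg _, (Int.fract_lt_one _).le⟩
  refine ⟨k, hk, ∑ i, ⌊c i⌋ • v i, S.sum_mem fun i _ => S.zsmul_mem (hmem i).2 _, ?_⟩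
  rw [← hsum, ← Finset.sum_add_distrib, ← sub_add_cancel x (∑ i, t i • b i), ← hc,
    ← Finset.sum_add_distrib]
  refine Finset.sum_congr rfl fun i _ => ?_
  rw [smul_add, smul_comm (t i), ← hab, ← Int.cast_smul_eq_zsmul ℝ, add_assoc, ← add_smul,
    Int.fract_add_floor, add_comm]

/-- Kannan–Lovász transference bounds, part (i):
`λ_n(K−K, L) ≤ Q(K, L) ≤ ∑_{i=1}^n λ_i(K−K, L)`. -/
theorem kannan_lovasz_i (n : ℕ) (hn : 1 ≤ n) (K : Set (Fin n → ℝ))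
    (hKcompact : IsCompact K) (hKconvex : Convex ℝ K) (hKint : (interior K).Nonempty)
    (L : Set (Fin n → ℝ)) (hL : IsLattice n L) :
    succMin n n (K - K) L ≤ covRad n K L ∧
      covRad n K L ≤ ∑ i ∈ Finset.Icc 1 n, succMin n i (K - K) L := by
  have hKne : K.Nonempty := hKint.mono interior_subset
  obtain ⟨t₀, ht₀, hspan₀⟩ :=
    hL.exists_span_smul_inter_eq_top (sub_self_mem_nhds_zero hKint)
  have hupper : ∀ ε > 0, ∃ T : ℝ, T ≤ (∑ i ∈ Finset.Icc 1 n, succMin n i (K - K) L) + ε ∧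
      T ∈ {t : ℝ | 0 < t ∧ ∀ x : Fin n → ℝ, ∃ k ∈ K, ∃ l ∈ L, x = t • k + l} := by
    intro ε hε
    have hn' : (0 : ℝ) < n := by exact_mod_cast hn
    have hchoose (i : Fin n) : ∃ t : ℝ, (0 < t ∧
        (i : ℕ) + 1 ≤ Module.finrank ℝ (Submodule.span ℝ (t • (K - K) ∩ L))) ∧
        t < succMin n (i + 1) (K - K) L + ε / n := by
      refine exists_lt_of_csInf_lt (s := {t : ℝ | 0 < t ∧
        (i : ℕ) + 1 ≤ Module.finrank ℝ (Submodule.span ℝ (t • (K - K) ∩ L))})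
        ⟨t₀, ht₀, ?_⟩ (lt_add_of_pos_right _ (div_pos hε hn'))
      rw [hspan₀, finrank_top]
      simp
    choose t ht htlt using hchoose
    obtain ⟨v, hv, hmem⟩ := exists_linearIndependent_of_lt_finrank_span
      (fun i : Fin n => t i • (K - K) ∩ L) fun i => (ht i).2
    have hpos : 0 < ∑ i, t i := Finset.sum_pos (fun i _ => (ht i).1) ⟨⟨0, hn⟩, Finset.mem_univ _⟩
    refine ⟨∑ i, t i, ?_, hpos,
      hL.cover_of_linearIndependent hKconvex (fun i => (ht i).1.le) hpos hv hmem⟩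
    calc ∑ i, t i ≤ ∑ i : Fin n, (succMin n (i + 1) (K - K) L + ε / n) :=
          Finset.sum_le_sum fun i _ => (htlt i).le
      _ = (∑ i ∈ Finset.Icc 1 n, succMin n i (K - K) L) + ε := by
          rw [Finset.sum_add_distrib, Fin.sum_univ_eq_sum_range
            (fun i => succMin n (i + 1) (K - K) L), Finset.range_eq_Ico,
            Finset.sum_Ico_add' (fun i => succMin n i (K - K) L) 0 n 1]
          congr 1
          simp [mul_div_cancel₀ _ hn'.ne']
  constructor
  · obtain ⟨T, -, hT⟩ := hupper 1 one_pos
    refine le_csInf ⟨T, hT⟩ fun t ht => csInf_le ⟨0, fun _ h => h.1.le⟩ ⟨ht.1, ?_⟩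
    rw [hL.span_smul_sub_inter_eq_top hKcompact hKne ht.2, finrank_top]
    simp
  · refine le_of_forall_pos_le_add fun ε hε => ?_
    obtain ⟨T, hTle, hT⟩ := hupper ε hε
    exact (csInf_le ⟨0, fun _ h => h.1.le⟩ hT).trans hTle
end
end

section
/- (Kannan–Lovász transference bounds, part (ii).) For every integer n ≥ 1 there exists a constant C > 0, depending only on n, such that for every convex body K ⊆ ℝ^n (a compact convex set with nonempty interior) and every lattice L in ℝ^n, λ_n(K−K, L) · λ_1((K−K)*, L*) < C, where K−K = {k₁ − k₂ : k₁, k₂ ∈ K} is the difference body, (K−K)* is its polar body, and L* is the dual lattice of L. -/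
noncomputable section

open MeasureTheory Matrix Pointwise

/-- The polar body `K* = {y : x·y ≤ 1 for all x ∈ K}`. -/
def polarBody (n : ℕ) (K : Set (Fin n → ℝ)) : Set (Fin n → ℝ) :=
  {y | ∀ x ∈ K, ∑ i, x i * y i ≤ 1}

/-- The dual lattice `L* = {y : x·y ∈ ℤ for all x ∈ L}`. -/
def dualLattice (n : ℕ) (L : Set (Fin n → ℝ)) : Set (Fin n → ℝ) :=
  {y | ∀ x ∈ L, ∃ m : ℤ, ∑ i, x i * y i = (m : ℝ)}

/-- Given a separated full-rank subgroup of a seminormed space of dimension `n`, there is a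
`ℤ`-generating family with a biorthogonal family of small functionals. -/
theorem exists_biorthogonal_family (n : ℕ) :
    ∃ C : ℝ, 0 < C ∧ ∀ (E : Type) [SeminormedAddCommGroup E] [NormedSpace ℝ E]
      [FiniteDimensional ℝ E], Module.finrank ℝ E = n → ∀ M : AddSubgroup E,
      Submodule.span ℝ (M : Set E) = ⊤ → ∀ r : ℝ, 0 < r → (∀ v ∈ M, v ≠ 0 → r ≤ ‖v‖) →
      ∃ (b : Fin n → E) (d : Fin n → E →ₗ[ℝ] ℝ), (∀ i, b i ∈ M) ∧
        (∀ i j, d i (b j) = if i = j then 1 else 0) ∧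
        (∀ y ∈ M, ∃ m : Fin n → ℤ, y = ∑ i, m i • b i) ∧
        ∀ i v, |d i v| ≤ C / r * ‖v‖ := by
  induction n with
  | zero =>
    refine ⟨1, one_pos, fun E _ _ _ hE M _ r _ _ => ⟨Fin.elim0, Fin.elim0, (Fin.elim0 ·),
      (Fin.elim0 ·), fun y _ => ⟨Fin.elim0, ?_⟩, (Fin.elim0 ·)⟩⟩
    have := Module.finrank_zero_iff.1 hE
    exact Subsingleton.elim _ _
  | succ n ih =>
    obtain ⟨C, hC, ih⟩ := ih
    refine ⟨1 + 4 * C * (n + 1), by positivity, fun E _ _ _ hE M hM r hr hsep => ?_⟩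
    obtain ⟨w, hwM, hw0, m, hm0, hmle, hwm⟩ : ∃ w ∈ M, w ≠ 0 ∧ ∃ m, r ≤ m ∧
        (∀ v ∈ M, v ≠ 0 → m ≤ ‖v‖) ∧ ‖w‖ < 3 / 2 * m := by
      obtain ⟨v, hv, hv0⟩ : ∃ v ∈ M, v ≠ 0 := by
        by_contra! h
        have : Submodule.span ℝ (M : Set E) = ⊥ := Submodule.span_eq_bot.2 h
        have h2 := finrank_bot ℝ E
        rw [← this, hM, finrank_top, hE] at h2
        omega
      let A : Set ℝ := (fun v => ‖v‖) '' {v | v ∈ M ∧ v ≠ 0}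
      have hA : A.Nonempty := ⟨_, v, ⟨hv, hv0⟩, rfl⟩
      have hrA : r ≤ sInf A := le_csInf hA (by rintro _ ⟨v, ⟨hv, hv0⟩, rfl⟩; exact hsep v hv hv0)
      obtain ⟨_, ⟨w, ⟨hw, hw0⟩, rfl⟩, hlt⟩ :=
        exists_lt_of_csInf_lt hA (show sInf A < 3 / 2 * sInf A by linarith)
      refine ⟨w, hw, hw0, sInf A, hrA, fun v hv hv0 => csInf_le ⟨0, ?_⟩ ⟨v, ⟨hv, hv0⟩, rfl⟩, hlt⟩
      rintro _ ⟨v, -, rfl⟩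
      exact norm_nonneg v
    have hwpos : r ≤ ‖w‖ := hsep w hwM hw0
    let W : Submodule ℝ E := Submodule.span ℝ {w}
    have hker : ∀ y ∈ M, ∀ u : E, W.mkQ u = W.mkQ y → ‖u‖ < m / 4 → ∃ k : ℤ, y = k • w := by
      intro y hy u huy hu
      have : y - u ∈ W := by
        rw [← Submodule.ker_mkQ W, LinearMap.mem_ker, map_sub, huy, sub_self]
      obtain ⟨t, ht⟩ := Submodule.mem_span_singleton.1 this
      refine ⟨round t, ?_⟩
      by_contra hne
      have h1 := hmle (y - round t • w) (M.sub_mem hy (M.zsmul_mem hwM _)) (sub_ne_zero.2 hne)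
      have h2 : y - round t • w = u + (t - round t) • w := by
        rw [sub_smul, ht, Int.cast_smul_eq_zsmul]; abel
      have h3 := norm_add_le u ((t - round t) • w)
      rw [norm_smul, Real.norm_eq_abs] at h3
      have h4 := mul_le_mul_of_nonneg_right (abs_sub_round t) (norm_nonneg w)
      rw [h2] at h1
      linarith
    have hdim : Module.finrank ℝ (E ⧸ W) = n := by
      have h1 := W.finrank_quotient_add_finrank
      have h2 : Module.finrank ℝ W = 1 := finrank_span_singleton hw0
      omega
    have hspan : Submodule.span ℝ ((M.map W.mkQ.toAddMonoidHom : AddSubgroup (E ⧸ W)) :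
        Set (E ⧸ W)) = ⊤ := by
      have : ((M.map W.mkQ.toAddMonoidHom : AddSubgroup (E ⧸ W)) : Set (E ⧸ W)) =
        W.mkQ '' (M : Set E) := rfl
      rw [this, Submodule.span_image, hM, Submodule.map_top, Submodule.range_mkQ]
    obtain ⟨b, d, hbM, hdb, hgen, hbd⟩ := ih (E ⧸ W) hdim (M.map W.mkQ.toAddMonoidHom) hspan
      (r / 4) (by positivity) (by
        rintro _ ⟨y, hy, rfl⟩ hy0
        by_contra! hlt
        obtain ⟨u, hu, hun⟩ := Submodule.Quotient.norm_mk_lt (W.mkQ y) (sub_pos.2 hlt)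
        obtain ⟨k, hk⟩ := hker y hy u hu (by
          change _ < ‖W.mkQ y‖ + (r / 4 - ‖W.mkQ y‖) at hun
          linarith)
        apply hy0
        change W.mkQ y = 0
        rw [← LinearMap.mem_ker, Submodule.ker_mkQ, hk]
        exact W.toAddSubgroup.zsmul_mem (Submodule.mem_span_singleton_self w) k)
    obtain ⟨f, hf1, hfw⟩ : ∃ f : E →ₗ[ℝ] ℝ, (∀ v, |f v| ≤ 1 / r * ‖v‖) ∧ f w = 1 := by
      obtain ⟨g, hg, hgw⟩ := exists_dual_vector'' ℝ w
      refine ⟨‖w‖⁻¹ • g.toLinearMap, fun v => ?_, ?_⟩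
      · have h1 : |g v| ≤ ‖v‖ := by
          simpa using g.le_of_opNorm_le hg v
        have h2 : ‖w‖⁻¹ ≤ 1 / r := by
          rw [one_div]; exact inv_anti₀ hr hwpos
        simp only [LinearMap.smul_apply, smul_eq_mul, abs_mul, abs_inv, abs_norm]
        exact mul_le_mul h2 h1 (abs_nonneg _) (by positivity)
      · have : ‖w‖ ≠ 0 := by linarith
        simpa [hgw] using inv_mul_cancel₀ this
    have hmkw : W.mkQ w = 0 := by
      rw [← LinearMap.mem_ker, Submodule.ker_mkQ]; exact Submodule.mem_span_singleton_self w
    have hlift : ∀ i, ∃ c ∈ M, W.mkQ c = b i ∧ |f c| ≤ 1 / 2 := by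
      intro i
      obtain ⟨c, hc, hcb⟩ := hbM i
      refine ⟨c - round (f c) • w, M.sub_mem hc (M.zsmul_mem hwM _), ?_, ?_⟩
      · rw [map_sub, map_zsmul, hmkw, smul_zero, sub_zero]
        exact hcb
      · rw [map_sub, map_zsmul, hfw]
        simpa using abs_sub_round (f c)
    choose c hcM hcb hfc using hlift
    have hD : ∀ i v, |d i (W.mkQ v)| ≤ 4 * C / r * ‖v‖ := by
      intro i v
      refine (hbd i _).trans ?_
      have : C / (r / 4) = 4 * C / r := by field_simp
      rw [this]
      exact mul_le_mul_of_nonneg_left (Submodule.Quotient.norm_mk_le (S := W) v) (by positivity)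
    let f₀ : E →ₗ[ℝ] ℝ := f - ∑ i, f (c i) • (d i ∘ₗ W.mkQ)
    have hf₀ : ∀ v, f₀ v = f v - ∑ i, f (c i) * d i (W.mkQ v) := fun v => by simp [f₀]
    refine ⟨Fin.cons w c, Fin.cons f₀ fun i => d i ∘ₗ W.mkQ, ?_, ?_, ?_, ?_⟩
    · exact Fin.cases hwM hcM
    · refine Fin.cases (Fin.cases ?_ fun j => ?_) fun i => Fin.cases ?_ fun j => ?_
      · simp [hf₀, hfw, hmkw, -Submodule.mkQ_apply]
      · simp [hf₀, hcb, hdb, -Submodule.mkQ_apply, (Fin.succ_ne_zero j).symm]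
      · simp [hmkw, -Submodule.mkQ_apply]
      · simp [hcb, hdb, -Submodule.mkQ_apply]
    · intro y hy
      obtain ⟨a, ha⟩ := hgen (W.mkQ y) ⟨y, hy, rfl⟩
      obtain ⟨k, hk⟩ := hker (y - ∑ i, a i • c i)
        (M.sub_mem hy (M.sum_mem fun i _ => M.zsmul_mem (hcM i) _)) 0 (by
          rw [map_zero, map_sub, map_sum, ha]
          simp only [map_zsmul, hcb, sub_self]) (by rw [norm_zero]; linarith)
      refine ⟨Fin.cons k a, ?_⟩
      rw [Fin.sum_univ_succ]
      simp only [Fin.cons_zero, Fin.cons_succ]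
      rw [← hk, sub_add_cancel]
    · refine Fin.cases (fun v => ?_) fun i v => ?_
      · simp only [Fin.cons_zero]
        rw [hf₀]
        have hterm : ∀ i ∈ Finset.univ, |f (c i) * d i (W.mkQ v)| ≤ 4 * C / r * ‖v‖ := by
          intro i _
          rw [abs_mul]
          have := mul_le_mul (hfc i) (hD i v) (abs_nonneg _) (by norm_num)
          have h0 : 0 ≤ 4 * C / r * ‖v‖ := by positivity
          linarith
        have hsum := (Finset.abs_sum_le_sum_abs _ _).trans (Finset.sum_le_card_nsmul _ _ _ hterm)
        simp only [Finset.card_univ, Fintype.card_fin, nsmul_eq_mul] at hsum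
        have := abs_sub (f v) (∑ i, f (c i) * d i (W.mkQ v))
        have h1 := hf1 v
        have h0 : 0 ≤ 4 * C / r * ‖v‖ := by positivity
        have h2 : (1 + 4 * C * (n + 1)) / r * ‖v‖ =
          1 / r * ‖v‖ + n * (4 * C / r * ‖v‖) + 4 * C / r * ‖v‖ := by ring
        linarith
      · simp only [Fin.cons_succ]
        refine (hD i v).trans ?_
        gcongr
        nlinarith [mul_nonneg hC.le (Nat.cast_nonneg (α := ℝ) n)]

/-- A version of `exists_biorthogonal_family` for a seminorm on a vector space without a fixed
norm, recording only the functionals. -/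
theorem exists_integral_functionals (n : ℕ) :
    ∃ C : ℝ, 0 < C ∧ ∀ (E : Type) [AddCommGroup E] [Module ℝ E] [FiniteDimensional ℝ E],
      Module.finrank ℝ E = n → ∀ (p : Seminorm ℝ E) (M : AddSubgroup E),
      Submodule.span ℝ (M : Set E) = ⊤ → ∀ r : ℝ, 0 < r → (∀ v ∈ M, v ≠ 0 → r ≤ p v) →
      ∃ d : Fin n → E →ₗ[ℝ] ℝ, LinearIndependent ℝ d ∧
        (∀ i, ∀ y ∈ M, ∃ m : ℤ, d i y = m) ∧ ∀ i v, |d i v| ≤ C / r * p v := by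
  obtain ⟨C, hC, h⟩ := exists_biorthogonal_family n
  refine ⟨C, hC, fun E _ _ _ hE p M hM r hr hsep => ?_⟩
  let _ : SeminormedAddCommGroup E := p.toAddGroupSeminorm.toSeminormedAddCommGroup
  let _ : NormedSpace ℝ E := ⟨fun a x => (map_smul_eq_mul p a x).le⟩
  obtain ⟨b, d, -, hdb, hgen, hbd⟩ := h E hE M hM r hr hsep
  refine ⟨d, ?_, fun i y hy => ?_, hbd⟩
  · rw [Fintype.linearIndependent_iff]
    intro g hg j
    simpa [hdb] using LinearMap.congr_fun hg (b j)
  · obtain ⟨m, rfl⟩ := hgen y hy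
    exact ⟨m i, by simp [hdb]⟩

/-- The dual lattice as an additive subgroup. -/
def dualSubgroup (n : ℕ) (L : Set (Fin n → ℝ)) : AddSubgroup (Fin n → ℝ) where
  carrier := dualLattice n L
  zero_mem' x _ := ⟨0, by simp⟩
  add_mem' {y z} hy hz x hx := by
    obtain ⟨a, ha⟩ := hy x hx
    obtain ⟨b, hb⟩ := hz x hx
    exact ⟨a + b, by simp [mul_add, Finset.sum_add_distrib, ha, hb]⟩
  neg_mem' {y} hy x hx := by
    obtain ⟨a, ha⟩ := hy x hx
    exact ⟨-a, by simp [ha]⟩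

theorem row_inv_mem_dualLattice {n : ℕ} {B : Matrix (Fin n) (Fin n) ℝ} (hB : IsUnit B.det)
    (j : Fin n) : B⁻¹ j ∈ dualLattice n (matLattice B) := by
  rintro _ ⟨v, rfl⟩
  refine ⟨v j, ?_⟩
  have h : (B⁻¹ *ᵥ (B *ᵥ fun i => (v i : ℝ))) j = v j := by
    rw [Matrix.mulVec_mulVec, Matrix.nonsing_inv_mul B hB, Matrix.one_mulVec]
  rw [← h, Matrix.mulVec, dotProduct]
  exact Finset.sum_congr rfl fun i _ => mul_comm _ _

theorem span_dualLattice {n : ℕ} {B : Matrix (Fin n) (Fin n) ℝ} (hB : IsUnit B.det) :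
    Submodule.span ℝ (dualLattice n (matLattice B)) = ⊤ := by
  rw [eq_top_iff]
  intro y _
  have h : y = ∑ j, (y ᵥ* B) j • B⁻¹ j := by
    have h1 : (y ᵥ* B) ᵥ* B⁻¹ = y := by
      rw [Matrix.vecMul_vecMul, Matrix.mul_nonsing_inv B hB, Matrix.vecMul_one]
    conv_lhs => rw [← h1]
    ext i
    simp [Matrix.vecMul, dotProduct]
  rw [h]
  exact Submodule.sum_mem _ fun j _ =>
    Submodule.smul_mem _ _ (Submodule.subset_span (row_inv_mem_dualLattice hB j))

theorem mem_matLattice_of_forall_dualLattice {n : ℕ} {B : Matrix (Fin n) (Fin n) ℝ}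
    (hB : IsUnit B.det) {x : Fin n → ℝ}
    (hx : ∀ y ∈ dualLattice n (matLattice B), ∃ m : ℤ, ∑ i, x i * y i = m) :
    x ∈ matLattice B := by
  choose v hv using fun j => hx _ (row_inv_mem_dualLattice hB j)
  refine ⟨v, ?_⟩
  have h : (fun j => (v j : ℝ)) = B⁻¹ *ᵥ x := by
    ext j
    rw [← hv, Matrix.mulVec, dotProduct]
    exact Finset.sum_congr rfl fun i _ => mul_comm _ _
  rw [h, Matrix.mulVec_mulVec, Matrix.mul_nonsing_inv B hB, Matrix.one_mulVec]

theorem convex_polarBody (n : ℕ) (S : Set (Fin n → ℝ)) : Convex ℝ (polarBody n S) := by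
  intro y hy z hz a b ha hb hab x hx
  have h : ∑ i, x i * (a • y + b • z) i = a * ∑ i, x i * y i + b * ∑ i, x i * z i := by
    rw [Finset.mul_sum, Finset.mul_sum, ← Finset.sum_add_distrib]
    exact Finset.sum_congr rfl fun i _ => by simp; ring
  rw [h]
  nlinarith [hy x hx, hz x hx]

theorem mem_polarBody_iff_abs {n : ℕ} {S : Set (Fin n → ℝ)} (hS : ∀ x ∈ S, -x ∈ S)
    {y : Fin n → ℝ} : y ∈ polarBody n S ↔ ∀ x ∈ S, |∑ i, x i * y i| ≤ 1 := by
  refine ⟨fun h x hx => abs_le.2 ⟨?_, h x hx⟩, fun h x hx => (abs_le.1 (h x hx)).2⟩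
  have := h (-x) (hS x hx)
  simp only [Pi.neg_apply, neg_mul, Finset.sum_neg_distrib] at this
  linarith

theorem sum_mul_smul {n : ℕ} (x y : Fin n → ℝ) (a : ℝ) :
    ∑ i, x i * (a • y) i = a * ∑ i, x i * y i := by
  rw [Finset.mul_sum]
  exact Finset.sum_congr rfl fun i _ => by simp; ring

theorem balanced_polarBody {n : ℕ} {S : Set (Fin n → ℝ)} (hS : ∀ x ∈ S, -x ∈ S) :
    Balanced ℝ (polarBody n S) := by
  rintro a ha _ ⟨y, hy, rfl⟩
  refine (mem_polarBody_iff_abs hS).2 fun x hx => ?_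
  change |∑ i, x i * (a • y) i| ≤ 1
  rw [sum_mul_smul, abs_mul]
  exact mul_le_one₀ ha (abs_nonneg _) ((mem_polarBody_iff_abs hS).1 hy x hx)

theorem absorbent_polarBody {n : ℕ} {S : Set (Fin n → ℝ)} (hS : ∀ x ∈ S, -x ∈ S)
    (hc : IsCompact S) : Absorbent ℝ (polarBody n S) := by
  intro y
  obtain ⟨R, hR⟩ := hc.exists_bound_of_continuousOn (f := fun x => ∑ i, x i * y i)
    (by fun_prop)
  rw [absorbs_iff_norm]
  refine ⟨max R 1, fun c hRc => ?_⟩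
  have hc1 : 1 ≤ ‖c‖ := (le_max_right _ _).trans hRc
  have hc0 : c ≠ 0 := by
    rintro rfl
    norm_num at hc1
  rw [Set.singleton_subset_iff, Set.mem_smul_set_iff_inv_smul_mem₀ hc0, mem_polarBody_iff_abs hS]
  intro x hx
  rw [sum_mul_smul, abs_mul, abs_inv, ← Real.norm_eq_abs, inv_mul_le_iff₀ (by linarith), mul_one]
  exact (hR x hx).trans ((le_max_left _ _).trans hRc)

/-- Half of the bipolar theorem. -/
theorem mem_of_forall_polarBody {n : ℕ} {S : Set (Fin n → ℝ)} (hconv : Convex ℝ S)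
    (hcl : IsClosed S) (h0 : 0 ∈ S) {x : Fin n → ℝ}
    (hx : ∀ y ∈ polarBody n S, ∑ i, x i * y i ≤ 1) : x ∈ S := by
  by_contra hxS
  obtain ⟨f, u, hfu, hux⟩ := geometric_hahn_banach_closed_point hconv hcl hxS
  have hu : 0 < u := by simpa using hfu 0 h0
  have hf : ∀ z, ∑ i, z i * (u⁻¹ • fun i => f (Pi.single i 1)) i = u⁻¹ * f z := by
    intro z
    rw [sum_mul_smul]
    congr 1
    conv_rhs => rw [pi_eq_sum_univ' z, map_sum]
    exact Finset.sum_congr rfl fun i _ => by rw [map_smul, smul_eq_mul]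
  have h1 := hx (u⁻¹ • fun i => f (Pi.single i 1)) fun z hz => by
    rw [hf, inv_mul_le_iff₀ hu, mul_one]
    exact (hfu z hz).le
  rw [hf, inv_mul_le_iff₀ hu, mul_one] at h1
  linarith

theorem succMin_nonneg (n i : ℕ) (S L : Set (Fin n → ℝ)) : 0 ≤ succMin n i S L :=
  Real.sInf_nonneg fun _ ht => ht.1.le

theorem succMin_le {n i : ℕ} {S L : Set (Fin n → ℝ)} {t : ℝ} (ht : 0 < t)
    (hi : i ≤ Module.finrank ℝ (Submodule.span ℝ (t • S ∩ L))) : succMin n i S L ≤ t :=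
  csInf_le ⟨0, fun _ hs => hs.1.le⟩ ⟨ht, hi⟩

/-- The first minimum is a lower bound for the gauge on nonzero lattice vectors. -/
theorem succMin_one_le_gauge {n : ℕ} {S L : Set (Fin n → ℝ)} (hS : Absorbent ℝ S)
    {v : Fin n → ℝ} (hv : v ∈ L) (hv0 : v ≠ 0) : succMin n 1 S L ≤ gauge S v := by
  refine le_of_forall_gt fun t ht => ?_
  obtain ⟨b, hb, hbt, hvb⟩ := exists_lt_of_gauge_lt hS ht
  refine (succMin_le hb ?_).trans_lt hbt
  rw [← finrank_span_singleton (K := ℝ) hv0]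
  exact Submodule.finrank_mono (Submodule.span_mono (Set.singleton_subset_iff.2 ⟨hvb, hv⟩))

/-- Kannan–Lovász transference bounds, part (ii): there is `C = C(n)` with
`λ_n(K−K, L) · λ_1((K−K)*, L*) < C` for all convex bodies `K` and lattices `L`. -/
theorem kannan_lovasz_ii (n : ℕ) (hn : 1 ≤ n) :
    ∃ C : ℝ, 0 < C ∧
      ∀ K : Set (Fin n → ℝ), IsCompact K → Convex ℝ K → (interior K).Nonempty →
        ∀ L : Set (Fin n → ℝ), IsLattice n L →
          succMin n n (K - K) L *
            succMin n 1 (polarBody n (K - K)) (dualLattice n L) < C := by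
  obtain ⟨C, hC, h⟩ := exists_integral_functionals n
  refine ⟨C + 1, by linarith, ?_⟩
  rintro K hKc hKconv hKint _ ⟨B, hB, rfl⟩
  obtain ⟨k₀, hk₀⟩ := hKint.mono interior_subset
  set S := K - K
  have hneg : ∀ x ∈ S, -x ∈ S := by
    rintro _ ⟨a, ha, b, hb, rfl⟩
    exact ⟨b, hb, a, ha, (neg_sub a b).symm⟩
  have h0 : (0 : Fin n → ℝ) ∈ S := ⟨k₀, hk₀, k₀, hk₀, sub_self _⟩
  have hSc : IsCompact S := by
    have := (hKc.prod hKc).image continuous_sub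
    rwa [Set.image_prod, Set.image2_sub] at this
  have hSconv : Convex ℝ S := hKconv.sub hKconv
  have habs := absorbent_polarBody hneg hSc
  set r := succMin n 1 (polarBody n S) (dualLattice n (matLattice B)) with hr
  rcases (succMin_nonneg n 1 (polarBody n S) (dualLattice n (matLattice B))).eq_or_lt with hr0 | hr0
  · rw [hr, ← hr0, mul_zero]
    linarith
  obtain ⟨d, hd, hdint, hdle⟩ := h (Fin n → ℝ) (by simp)
    (gaugeSeminorm (balanced_polarBody hneg) (convex_polarBody n S) habs)
    (dualSubgroup n (matLattice B)) (span_dualLattice hB) r hr0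
    fun v hv hv0 => succMin_one_le_gauge habs hv hv0
  let e : ((Fin n → ℝ) →ₗ[ℝ] ℝ) ≃ₗ[ℝ] (Fin n → ℝ) := (dotProductEquiv ℝ (Fin n)).symm
  have he : ∀ i y, ∑ k, e (d i) k * y k = d i y := fun i y =>
    LinearMap.congr_fun ((dotProductEquiv ℝ (Fin n)).apply_symm_apply (d i)) y
  have hCr : 0 < C / r := div_pos hC hr0
  have hmem : Set.range (fun i => e (d i)) ⊆ (C / r) • S ∩ matLattice B := by
    rintro _ ⟨i, rfl⟩
    refine ⟨?_, mem_matLattice_of_forall_dualLattice hB fun y hy => ?_⟩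
    · rw [Set.mem_smul_set_iff_inv_smul_mem₀ hCr.ne']
      refine mem_of_forall_polarBody hSconv hSc.isClosed h0 fun y hy => ?_
      have h1 : ∑ k, ((C / r)⁻¹ • e (d i)) k * y k = (C / r)⁻¹ * d i y := by
        rw [← he, Finset.mul_sum]
        exact Finset.sum_congr rfl fun k _ => by simp [mul_assoc]
      rw [h1, inv_mul_le_iff₀ hCr]
      exact (le_abs_self _).trans ((hdle i y).trans
        (mul_le_mul_of_nonneg_left (gauge_le_one_of_mem hy) hCr.le))
    · rw [he]
      exact hdint i y hy
  have hle : succMin n n S (matLattice B) ≤ C / r := by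
    refine succMin_le hCr ?_
    have hli : LinearIndependent ℝ fun i => e (d i) := hd.map' e.toLinearMap e.ker
    have := finrank_span_eq_card hli
    rw [Fintype.card_fin] at this
    exact this.ge.trans (Submodule.finrank_mono (Submodule.span_mono hmem))
  have := mul_le_mul_of_nonneg_right hle hr0.le
  rw [div_mul_cancel₀ C hr0.ne'] at this
  linarith
end
end
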